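/- Jackson–Jordán construction of M-connected graphs: every simple graph G that is 3-vertex-connected and M-connected (i.e., every pair of edges of G lies in a common subgraph of G that is a (2,3)-circuit) can be obtained from K_4 by a finite sequence of operations, each of which is either an edge splitting operation or the addition of a new edge between two non-adjacent vertices. -/

import Mathlib

open Finset

/-- A finite simple graph given by a finite vertex set of natural numbers and a finite set of
edges (unordered pairs of distinct vertices). -/
structure FinGraph where
  verts : Finset ℕ
  edges : Finset (Sym2 ℕ)
  not_isDiag : ∀ e ∈ edges, ¬ e.IsDiag
  mem_verts : ∀ e ∈ edges, ∀ v ∈ e, v ∈ verts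

/-- Adjacency in a `FinGraph`. -/
def FinGraph.Adj (G : FinGraph) (a b : ℕ) : Prop := s(a, b) ∈ G.edges

/-- `(V', E')` is a subgraph of `G`: the vertices and edges come from `G` and every endpoint
of an edge of `E'` lies in `V'`. -/
def SubgraphPair (G : FinGraph) (V' : Finset ℕ) (E' : Finset (Sym2 ℕ)) : Prop :=
  V' ⊆ G.verts ∧ E' ⊆ G.edges ∧ ∀ e ∈ E', ∀ v ∈ e, v ∈ V'

/-- Vertex addition: add a new vertex `v` of degree 2 joined to two distinct existing
vertices `a` and `b`. -/
def VertexAddition (G G' : FinGraph) : Prop :=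
  ∃ v a b : ℕ, v ∉ G.verts ∧ a ∈ G.verts ∧ b ∈ G.verts ∧ a ≠ b ∧
    G'.verts = insert v G.verts ∧
    G'.edges = insert s(v, a) (insert s(v, b) G.edges)

/-- Edge splitting: remove an edge `xy`, add a new vertex `v` of degree 3 joined to `x`, `y`
and a third existing vertex `z` distinct from `x` and `y`. -/
def EdgeSplit (G G' : FinGraph) : Prop :=
  ∃ v x y z : ℕ, v ∉ G.verts ∧ x ∈ G.verts ∧ y ∈ G.verts ∧ z ∈ G.verts ∧
    z ≠ x ∧ z ≠ y ∧ s(x, y) ∈ G.edges ∧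
    G'.verts = insert v G.verts ∧
    G'.edges = insert s(v, x) (insert s(v, y) (insert s(v, z) (G.edges.erase s(x, y))))

/-- The graph obtained from `G` by deleting the vertex set `S` is connected: any two
remaining vertices are joined by a walk avoiding `S`. -/
def ConnectedOff (G : FinGraph) (S : Finset ℕ) : Prop :=
  ∀ a ∈ G.verts, a ∉ S → ∀ b ∈ G.verts, b ∉ S →
    Relation.ReflTransGen (fun x y => G.Adj x y ∧ x ∉ S ∧ y ∉ S) a b

/-- `G` is 3-vertex-connected: it has more than 3 vertices and remains connected after
deleting any set of fewer than 3 vertices. -/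
def ThreeConnected (G : FinGraph) : Prop :=
  3 < G.verts.card ∧ ∀ S : Finset ℕ, S.card < 3 → ConnectedOff G S

/-- `G` is a copy of `K₄`: four distinct vertices and all six edges between them. -/
def IsK4 (G : FinGraph) : Prop :=
  ∃ a b c d : ℕ, a ≠ b ∧ a ≠ c ∧ a ≠ d ∧ b ≠ c ∧ b ≠ d ∧ c ≠ d ∧
    G.verts = {a, b, c, d} ∧
    G.edges = {s(a, b), s(a, c), s(a, d), s(b, c), s(b, d), s(c, d)}

/-- The pair `(V', E')` is a (2,3)-circuit: all endpoints lie in `V'`, `|E'| = 2|V'| − 2`, and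
every proper subpair with at least one edge satisfies `|E''| ≤ 2|V''| − 3`. -/
def PairCircuit23 (V' : Finset ℕ) (E' : Finset (Sym2 ℕ)) : Prop :=
  (∀ e ∈ E', ∀ v ∈ e, v ∈ V') ∧ (E'.card : ℤ) = 2 * V'.card - 2 ∧
    ∀ V'' E'', V'' ⊆ V' → E'' ⊆ E' → (∀ e ∈ E'', ∀ v ∈ e, v ∈ V'') →
      (V'' ≠ V' ∨ E'' ≠ E') → E''.Nonempty → (E''.card : ℤ) ≤ 2 * V''.card - 3

/-- `G` is M-connected: every pair of edges of `G` lies in a common subgraph of `G` that is a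
(2,3)-circuit. -/
def MConnected (G : FinGraph) : Prop :=
  ∀ e ∈ G.edges, ∀ f ∈ G.edges,
    ∃ (V' : Finset ℕ) (E' : Finset (Sym2 ℕ)), V' ⊆ G.verts ∧ E' ⊆ G.edges ∧
      e ∈ E' ∧ f ∈ E' ∧ PairCircuit23 V' E'

/-- Edge addition: add a new edge between two non-adjacent vertices. -/
def EdgeAdd (G G' : FinGraph) : Prop :=
  ∃ a b : ℕ, a ∈ G.verts ∧ b ∈ G.verts ∧ a ≠ b ∧ s(a, b) ∉ G.edges ∧
    G'.verts = G.verts ∧ G'.edges = insert s(a, b) G.edges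

open Finset

/-- number of edges of `E` induced by `Z` -/
def ii (E : Finset (Sym2 ℕ)) (Z : Finset ℕ) : ℕ := #(E ∩ Z.sym2)

/-- no loops -/
def Nd (E : Finset (Sym2 ℕ)) : Prop := ∀ e ∈ E, ¬ e.IsDiag

/-- vertex span -/
def vs (E : Finset (Sym2 ℕ)) : Finset ℕ := E.biUnion Sym2.toFinset

def LSp (E : Finset (Sym2 ℕ)) (U : Finset ℕ) : Prop :=
  ∀ Z, Z ⊆ U → 2 ≤ #Z → ii E Z + 3 ≤ 2 * #Z

def Sparse (E : Finset (Sym2 ℕ)) : Prop := Nd E ∧ ∀ Z, 2 ≤ #Z → ii E Z + 3 ≤ 2 * #Z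

def Tight (E : Finset (Sym2 ℕ)) (T : Finset ℕ) : Prop := 2 ≤ #T ∧ ii E T + 3 = 2 * #T

theorem mem_vs {E : Finset (Sym2 ℕ)} {v : ℕ} : v ∈ vs E ↔ ∃ e ∈ E, v ∈ e := by
  simp [vs]

theorem vs_mono {E F : Finset (Sym2 ℕ)} (h : E ⊆ F) : vs E ⊆ vs F := by
  intro v hv
  obtain ⟨e, he, hv⟩ := mem_vs.1 hv
  exact mem_vs.2 ⟨e, h he, hv⟩

theorem mem_vs_left {E : Finset (Sym2 ℕ)} {a b : ℕ} (h : s(a, b) ∈ E) : a ∈ vs E :=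
  mem_vs.2 ⟨_, h, by simp⟩

theorem mem_vs_right {E : Finset (Sym2 ℕ)} {a b : ℕ} (h : s(a, b) ∈ E) : b ∈ vs E :=
  mem_vs.2 ⟨_, h, by simp⟩

theorem mem_sym2_vs {E : Finset (Sym2 ℕ)} {e : Sym2 ℕ} (h : e ∈ E) : e ∈ (vs E).sym2 := by
  rw [Finset.mem_sym2_iff]
  intro a ha
  exact mem_vs.2 ⟨e, h, ha⟩

theorem subset_sym2_vs {E : Finset (Sym2 ℕ)} : E ⊆ (vs E).sym2 := fun _ h => mem_sym2_vs h

theorem subset_sym2_iff {E : Finset (Sym2 ℕ)} {Z : Finset ℕ} : E ⊆ Z.sym2 ↔ vs E ⊆ Z := by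
  constructor
  · intro h v hv
    obtain ⟨e, he, hv⟩ := mem_vs.1 hv
    exact Finset.mem_sym2_iff.1 (h he) v hv
  · intro h
    exact subset_sym2_vs.trans (Finset.sym2_mono h)

theorem ii_of_vs_subset {E : Finset (Sym2 ℕ)} {Z : Finset ℕ} (h : vs E ⊆ Z) : ii E Z = #E := by
  unfold ii
  rw [Finset.inter_eq_left.2 (subset_sym2_iff.2 h)]

theorem Nd.ne {E : Finset (Sym2 ℕ)} (h : Nd E) {a b : ℕ} (hab : s(a, b) ∈ E) : a ≠ b := by
  have := h _ hab
  simpa using this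

theorem Nd.mono {E F : Finset (Sym2 ℕ)} (h : Nd F) (hE : E ⊆ F) : Nd E := fun e he => h e (hE he)

theorem ii_mono {E : Finset (Sym2 ℕ)} {A B : Finset ℕ} (h : A ⊆ B) : ii E A ≤ ii E B :=
  Finset.card_le_card (Finset.inter_subset_inter_left (Finset.sym2_mono h))

theorem ii_mono_left {E F : Finset (Sym2 ℕ)} {A : Finset ℕ} (h : E ⊆ F) : ii E A ≤ ii F A :=
  Finset.card_le_card (Finset.inter_subset_inter_right h)

theorem Sparse.mono {E F : Finset (Sym2 ℕ)} (h : Sparse F) (hE : E ⊆ F) : Sparse E := by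
  refine ⟨h.1.mono hE, fun Z hZ => ?_⟩
  have := h.2 Z hZ
  have := ii_mono_left (A := Z) hE
  omega

theorem Sparse.lsp {E : Finset (Sym2 ℕ)} (h : Sparse E) (U : Finset ℕ) : LSp E U :=
  fun Z _ hZ => h.2 Z hZ

theorem sym2_inter' (A B : Finset ℕ) : A.sym2 ∩ B.sym2 = (A ∩ B).sym2 := by
  ext e
  simp only [Finset.mem_inter, Finset.mem_sym2_iff]
  grind

theorem ii_super (E : Finset (Sym2 ℕ)) (A B : Finset ℕ) :
    ii E A + ii E B ≤ ii E (A ∪ B) + ii E (A ∩ B) := by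
  unfold ii
  rw [← Finset.card_union_add_card_inter]
  have h1 : (E ∩ A.sym2) ∪ (E ∩ B.sym2) ⊆ E ∩ (A ∪ B).sym2 := by
    intro e
    simp only [Finset.mem_union, Finset.mem_inter, Finset.mem_sym2_iff]
    grind
  have h2 : (E ∩ A.sym2) ∩ (E ∩ B.sym2) = E ∩ (A ∩ B).sym2 := by
    rw [← sym2_inter']; ext e; simp only [Finset.mem_inter]; tauto
  rw [h2]
  have := Finset.card_le_card h1
  omega

theorem ii_super_strict {E : Finset (Sym2 ℕ)} {A B : Finset ℕ} {e : Sym2 ℕ} (he : e ∈ E)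
    (hAB : e ∈ (A ∪ B).sym2) (hA : e ∉ A.sym2) (hB : e ∉ B.sym2) :
    ii E A + ii E B + 1 ≤ ii E (A ∪ B) + ii E (A ∩ B) := by
  have h := ii_super (E.erase e) A B
  have e1 : ∀ Z : Finset ℕ, e ∉ Z.sym2 → ii (E.erase e) Z = ii E Z := by
    intro Z hZ; unfold ii; congr 1; ext f; simp only [Finset.mem_inter, Finset.mem_erase]
    constructor
    · tauto
    · rintro ⟨h1, h2⟩; exact ⟨⟨fun h => hZ (h ▸ h2), h1⟩, h2⟩
  have e2 : ii (E.erase e) (A ∪ B) + 1 = ii E (A ∪ B) := by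
    unfold ii; rw [Finset.erase_inter]
    exact Finset.card_erase_add_one (Finset.mem_inter.2 ⟨he, hAB⟩)
  have e3 : ii (E.erase e) (A ∩ B) = ii E (A ∩ B) := e1 _ (by
    intro h; rw [← sym2_inter'] at h; exact hA (Finset.mem_inter.1 h).1)
  rw [e1 A hA, e1 B hB] at h
  omega

/-- if there is no crossing edge -/
theorem ii_modular {E : Finset (Sym2 ℕ)} {A B : Finset ℕ}
    (h : ∀ e ∈ E, e ∈ (A ∪ B).sym2 → e ∈ A.sym2 ∨ e ∈ B.sym2) :
    ii E A + ii E B = ii E (A ∪ B) + ii E (A ∩ B) := by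
  unfold ii
  rw [← Finset.card_union_add_card_inter]
  have h1 : (E ∩ A.sym2) ∪ (E ∩ B.sym2) = E ∩ (A ∪ B).sym2 := by
    ext e
    simp only [Finset.mem_union, Finset.mem_inter]
    constructor
    · rintro (h | h)
      · exact ⟨h.1, Finset.sym2_mono Finset.subset_union_left h.2⟩
      · exact ⟨h.1, Finset.sym2_mono Finset.subset_union_right h.2⟩
    · rintro ⟨h1, h2⟩
      have := h e h1 h2
      tauto
  have h2 : (E ∩ A.sym2) ∩ (E ∩ B.sym2) = E ∩ (A ∩ B).sym2 := by
    rw [← sym2_inter']; ext e; simp only [Finset.mem_inter]; tauto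
  rw [h1, h2]

theorem U1 {E : Finset (Sym2 ℕ)} {U T1 T2 : Finset ℕ} (hS : LSp E U) (hU : T1 ∪ T2 ⊆ U)
    (h1 : Tight E T1) (h2 : Tight E T2) (h : 2 ≤ #(T1 ∩ T2)) :
    Tight E (T1 ∪ T2) ∧ Tight E (T1 ∩ T2) ∧
      ∀ e ∈ E, e ∈ (T1 ∪ T2).sym2 → e ∈ T1.sym2 ∨ e ∈ T2.sym2 := by
  have hc := Finset.card_union_add_card_inter T1 T2
  have hu : 2 ≤ #(T1 ∪ T2) := h1.1.trans (Finset.card_le_card Finset.subset_union_left)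
  have a1 := hS _ hU hu
  have a2 := hS _ ((Finset.inter_subset_left.trans Finset.subset_union_left).trans hU) h
  have a3 := ii_super E T1 T2
  have b1 := h1.2
  have b2 := h2.2
  refine ⟨⟨hu, by omega⟩, ⟨h, by omega⟩, ?_⟩
  intro e he heU
  by_contra! hcon
  have := ii_super_strict he heU hcon.1 hcon.2
  omega

theorem ii_small {E : Finset (Sym2 ℕ)} (hN : Nd E) {Z : Finset ℕ} (hZ : #Z ≤ 1) : ii E Z = 0 := by
  unfold ii
  rw [Finset.card_eq_zero, Finset.eq_empty_iff_forall_notMem]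
  intro e he
  rw [Finset.mem_inter] at he
  induction e with
  | _ a b =>
    have h1 := hN.ne he.1
    rw [Finset.mk_mem_sym2_iff] at he
    exact h1 (Finset.card_le_one.1 hZ a he.2.1 b he.2.2)

theorem ii_single {E : Finset (Sym2 ℕ)} (hN : Nd E) (w : ℕ) : ii E {w} = 0 :=
  ii_small hN (by simp)

theorem LSp.one {E : Finset (Sym2 ℕ)} (hN : Nd E) {U Z : Finset ℕ} (h : LSp E U) (hZU : Z ⊆ U)
    (hZ : 1 ≤ #Z) : ii E Z + 2 ≤ 2 * #Z := by
  by_cases h2 : 2 ≤ #Z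
  · have := h Z hZU h2; omega
  · rw [ii_small hN (by omega)]; omega

theorem U2 {E : Finset (Sym2 ℕ)} {U T1 T2 T3 : Finset ℕ} (hN : Nd E) (hS : LSp E U) (hU : T1 ∪ T2 ∪ T3 ⊆ U)
    (h1 : Tight E T1) (h2 : Tight E T2) (h3 : Tight E T3) {w1 w2 w3 : ℕ}
    (h12 : w3 ∈ T1 ∩ T2) (h23 : w1 ∈ T2 ∩ T3) (h13 : w2 ∈ T1 ∩ T3)
    (n12 : w1 ≠ w2) (n13 : w1 ≠ w3) (n23 : w2 ≠ w3) :
    Tight E (T1 ∪ T2 ∪ T3) ∧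
      ∀ e ∈ E, e ∈ (T1 ∪ T2 ∪ T3).sym2 → e ∈ T1.sym2 ∨ e ∈ T2.sym2 ∨ e ∈ T3.sym2 := by
  have key : ∀ {A B C : Finset ℕ} {a b c : ℕ}, A ∪ B ∪ C ⊆ U → Tight E A → Tight E B → Tight E C →
      c ∈ A ∩ B → a ∈ B ∩ C → b ∈ A ∩ C → a ≠ b → 2 ≤ #(A ∩ B) →
      Tight E (A ∪ B ∪ C) ∧
      ∀ e ∈ E, e ∈ (A ∪ B ∪ C).sym2 → e ∈ A.sym2 ∨ e ∈ B.sym2 ∨ e ∈ C.sym2 := by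
    intro A B C a b c hU hA hB hC hc ha hb hab h
    obtain ⟨t, -, hx⟩ := U1 hS (Finset.subset_union_left.trans hU) hA hB h
    have h2 : 2 ≤ #((A ∪ B) ∩ C) := by
      have : ({a, b} : Finset ℕ) ⊆ (A ∪ B) ∩ C := by
        intro x hx; simp at hx ha hb ⊢; grind
      have := Finset.card_le_card this
      rw [Finset.card_pair hab] at this; exact this
    obtain ⟨t', -, hx'⟩ := U1 hS hU t hC h2
    refine ⟨t', fun e he heu => ?_⟩
    rcases hx' e he heu with h | h
    · rcases hx e he h with h | h <;> tauto
    · tauto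
  by_cases c12 : 2 ≤ #(T1 ∩ T2)
  · exact key hU h1 h2 h3 h12 h23 h13 n12 c12
  by_cases c13 : 2 ≤ #(T1 ∩ T3)
  · have e : T1 ∪ T2 ∪ T3 = T1 ∪ T3 ∪ T2 := by grind
    rw [e] at hU ⊢
    have := key hU h1 h3 h2 h13 (by rwa [Finset.inter_comm]) h12 n13 c13
    refine ⟨this.1, fun e he h => ?_⟩
    have := this.2 e he h; tauto
  by_cases c23 : 2 ≤ #(T2 ∩ T3)
  · have e : T1 ∪ T2 ∪ T3 = T2 ∪ T3 ∪ T1 := by grind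
    rw [e] at hU ⊢
    have := key hU h2 h3 h1 h23 (by rwa [Finset.inter_comm]) (by rwa [Finset.inter_comm]) n23 c23
    refine ⟨this.1, fun e he h => ?_⟩
    have := this.2 e he h; tauto
  have k12 : T1 ∩ T2 = {w3} := by
    symm; apply Finset.eq_of_subset_of_card_le (by simpa using h12); simp; omega
  have k23 : T2 ∩ T3 = {w1} := by
    symm; apply Finset.eq_of_subset_of_card_le (by simpa using h23); simp; omega
  have k13 : T1 ∩ T3 = {w2} := by
    symm; apply Finset.eq_of_subset_of_card_le (by simpa using h13); simp; omega
  have hc := Finset.card_union_add_card_inter T1 T2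
  have hc2 := Finset.card_union_add_card_inter (T1 ∪ T2) T3
  have k : (T1 ∪ T2) ∩ T3 = {w1, w2} := by
    rw [Finset.union_inter_distrib_right, k23, k13]; ext; simp; tauto
  rw [k, Finset.card_pair n12] at hc2
  rw [k12, Finset.card_singleton] at hc
  have hu : 2 ≤ #(T1 ∪ T2 ∪ T3) := h1.1.trans (Finset.card_le_card (by intro x; simp; tauto))
  have a1 := hS _ hU hu
  have b1 := h1.2
  have b2 := h2.2
  have b3 := h3.2
  have d1 : ((E ∩ T1.sym2) ∪ (E ∩ T2.sym2) ∪ (E ∩ T3.sym2)) ⊆ E ∩ (T1 ∪ T2 ∪ T3).sym2 := by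
    intro e
    simp only [Finset.mem_union, Finset.mem_inter, Finset.mem_sym2_iff]
    grind
  have hl : ∀ w ∈ U, ii E {w} = 0 := fun w _ => ii_single hN w
  · have hd : ∀ A B : Finset ℕ, ∀ w ∈ U, A ∩ B = {w} → Disjoint (E ∩ A.sym2) (E ∩ B.sym2) := by
      intro A B w hw hAB
      rw [Finset.disjoint_left]
      intro e heA heB
      have h0 := hl w hw
      unfold ii at h0
      rw [Finset.card_eq_zero, ← hAB, ← sym2_inter'] at h0
      have : e ∈ E ∩ (A.sym2 ∩ B.sym2) := by
        simp only [Finset.mem_inter] at *; tauto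
      rw [h0] at this; simp at this
    have D12 := hd T1 T2 w3 (hU (by simp at h12 ⊢; tauto)) k12
    have D23 := hd T2 T3 w1 (hU (by simp at h23 ⊢; tauto)) k23
    have D13 := hd T1 T3 w2 (hU (by simp at h13 ⊢; tauto)) k13
    have hcard : #((E ∩ T1.sym2) ∪ (E ∩ T2.sym2) ∪ (E ∩ T3.sym2)) = ii E T1 + ii E T2 + ii E T3 := by
      rw [Finset.card_union_of_disjoint, Finset.card_union_of_disjoint D12]; rfl
      rw [Finset.disjoint_union_left]; exact ⟨D13, D23⟩
    have hle := Finset.card_le_card d1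
    have hle' : ii E (T1 ∪ T2 ∪ T3) = #(E ∩ (T1 ∪ T2 ∪ T3).sym2) := rfl
    refine ⟨⟨hu, by omega⟩, ?_⟩
    have heq := Finset.eq_of_subset_of_card_le d1 (by omega)
    intro e he heu
    have : e ∈ E ∩ (T1 ∪ T2 ∪ T3).sym2 := Finset.mem_inter.2 ⟨he, heu⟩
    rw [← heq] at this
    simp only [Finset.mem_union, Finset.mem_inter] at this
    tauto

/-- edges of `E` at `v` going into `T` -/
theorem ii_erase_add {E : Finset (Sym2 ℕ)} {T : Finset ℕ} (v : ℕ) :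
    ii E (T.erase v) + #(E.filter (fun e => v ∈ e ∧ e ∈ T.sym2)) = ii E T := by
  unfold ii
  rw [← Finset.card_union_of_disjoint]
  · congr 1
    ext e
    simp only [Finset.mem_union, Finset.mem_inter, Finset.mem_filter, Finset.mem_sym2_iff,
      Finset.mem_erase]
    constructor
    · rintro (⟨h1, h2⟩ | ⟨h1, h2, h3⟩)
      · exact ⟨h1, fun a ha => (h2 a ha).2⟩
      · exact ⟨h1, h3⟩
    · rintro ⟨h1, h2⟩
      by_cases hv : v ∈ e
      · right; exact ⟨h1, hv, h2⟩
      · left; exact ⟨h1, fun a ha => ⟨fun h => hv (h ▸ ha), h2 a ha⟩⟩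
  · rw [Finset.disjoint_left]
    intro e he
    simp only [Finset.mem_inter, Finset.mem_filter, Finset.mem_sym2_iff,
      Finset.mem_erase] at he ⊢
    intro h
    exact (he.2 v h.2.1).1 rfl

theorem tight_two {E : Finset (Sym2 ℕ)} (hN : Nd E) {U T : Finset ℕ} (hS : LSp E U) (hU : T ⊆ U)
    (hT : Tight E T) (h3 : 3 ≤ #T) {v : ℕ} (hv : v ∈ T) :
    ∃ a ∈ T, ∃ b ∈ T, a ≠ b ∧ s(v, a) ∈ E ∧ s(v, b) ∈ E := by
  have h1 := ii_erase_add (E := E) (T := T) v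
  have h2 := Finset.card_erase_add_one hv
  have h4 := hS (T.erase v) ((Finset.erase_subset _ _).trans hU) (by omega)
  have h5 := hT.2
  have h6 : 1 < #(E.filter (fun e => v ∈ e ∧ e ∈ T.sym2)) := by omega
  obtain ⟨e, he, f, hf, hef⟩ := Finset.one_lt_card.1 h6
  simp only [Finset.mem_filter] at he hf
  obtain ⟨a, rfl⟩ := Sym2.mem_iff_exists.1 he.2.1
  obtain ⟨b, rfl⟩ := Sym2.mem_iff_exists.1 hf.2.1
  refine ⟨a, (Finset.mk_mem_sym2_iff.1 he.2.2).2, b, (Finset.mk_mem_sym2_iff.1 hf.2.2).2, ?_, he.1, hf.1⟩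
  rintro rfl; exact hef rfl

theorem tight_one {E : Finset (Sym2 ℕ)} (hN : Nd E) {U T : Finset ℕ} (hS : LSp E U) (hU : T ⊆ U)
    (hT : Tight E T) {v : ℕ} (hv : v ∈ T) :
    ∃ a ∈ T, s(v, a) ∈ E := by
  have h1 := ii_erase_add (E := E) (T := T) v
  have h2 := Finset.card_erase_add_one hv
  have h0 := hT.1
  have h4 := hS.one hN ((Finset.erase_subset v T).trans hU) (by omega)
  have h5 := hT.2
  have h6 : 0 < #(E.filter (fun e => v ∈ e ∧ e ∈ T.sym2)) := by omega
  obtain ⟨e, he⟩ := Finset.card_pos.1 h6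
  simp only [Finset.mem_filter] at he
  obtain ⟨a, rfl⟩ := Sym2.mem_iff_exists.1 he.2.1
  exact ⟨a, (Finset.mk_mem_sym2_iff.1 he.2.2).2, he.1⟩

/-- no cut of size at most one in a tight set -/
theorem tight_cut {E : Finset (Sym2 ℕ)} (hN : Nd E) {U T A B : Finset ℕ} (hS : LSp E U)
    (hU : T ⊆ U) (hT : Tight E T) (hAB : A ∪ B = T) (hA : ¬ B ⊆ A) (hB : ¬ A ⊆ B)
    (h1 : #(A ∩ B) ≤ 1) : ∃ a ∈ A, ∃ b ∈ B, a ∉ B ∧ b ∉ A ∧ s(a, b) ∈ E := by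
  by_contra! hcon
  have hm : ∀ e ∈ E, e ∈ (A ∪ B).sym2 → e ∈ A.sym2 ∨ e ∈ B.sym2 := by
    intro e
    induction e with
    | _ a b =>
      intro he
      simp only [Finset.mk_mem_sym2_iff, Finset.mem_union]
      have c1 := hcon a
      have c2 := hcon b
      have he' : s(b, a) ∈ E := by rwa [Sym2.eq_swap]
      grind
  have h := ii_modular hm
  have hc := Finset.card_union_add_card_inter A B
  rw [hAB] at h hc
  have hAU : A ⊆ U := (hAB ▸ Finset.subset_union_left).trans hU
  have hBU : B ⊆ U := (hAB ▸ Finset.subset_union_right).trans hU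
  have lA : #(A ∩ B) < #A := Finset.card_lt_card ⟨Finset.inter_subset_left, fun h => hB (h.trans Finset.inter_subset_right)⟩
  have lB : #(A ∩ B) < #B := Finset.card_lt_card ⟨Finset.inter_subset_right, fun h => hA (h.trans Finset.inter_subset_left)⟩
  have e0 : ii E (A ∩ B) = 0 := ii_small hN h1
  have t := hT.2
  by_cases hi : #(A ∩ B) = 1
  · have := hS A hAU (by omega)
    have := hS B hBU (by omega)
    omega
  · have := hS.one hN hAU (by omega)
    have := hS.one hN hBU (by omega)
    omega

theorem ii_insert {E : Finset (Sym2 ℕ)} {e : Sym2 ℕ} {Z : Finset ℕ} (he : e ∉ E) (hZ : e ∈ Z.sym2) :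
    ii (insert e E) Z = ii E Z + 1 := by
  unfold ii
  rw [Finset.insert_inter_of_mem hZ, Finset.card_insert_of_notMem]
  simp [he]

theorem ii_insert_le {E : Finset (Sym2 ℕ)} {e : Sym2 ℕ} {Z : Finset ℕ} :
    ii (insert e E) Z ≤ ii E Z + 1 := by
  unfold ii
  by_cases hZ : e ∈ Z.sym2
  · rw [Finset.insert_inter_of_mem hZ]; exact Finset.card_insert_le _ _
  · rw [Finset.insert_inter_of_notMem hZ]; omega

theorem ii_insert_not {E : Finset (Sym2 ℕ)} {e : Sym2 ℕ} {Z : Finset ℕ} (hZ : e ∉ Z.sym2) :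
    ii (insert e E) Z = ii E Z := by
  unfold ii
  rw [Finset.insert_inter_of_notMem hZ]

theorem Nd.insert {E : Finset (Sym2 ℕ)} {e : Sym2 ℕ} (h : Nd E) (he : ¬ e.IsDiag) :
    Nd (insert e E) := by
  intro f hf
  rcases Finset.mem_insert.1 hf with rfl | hf
  · exact he
  · exact h f hf

/-- adding a dependent edge -/
theorem sparse_insert_or {I : Finset (Sym2 ℕ)} (hI : Sparse I) {e : Sym2 ℕ} (hd : ¬ e.IsDiag)
    (h : ¬ Sparse (insert e I)) : ∃ T, Tight I T ∧ e ∈ T.sym2 := by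
  have hn : ¬ ∀ Z, 2 ≤ #Z → ii (insert e I) Z + 3 ≤ 2 * #Z := fun h' => h ⟨hI.1.insert hd, h'⟩
  push Not at hn
  obtain ⟨Z, hZ, hlt⟩ := hn
  have h1 := hI.2 Z hZ
  have h2 := ii_insert_le (E := I) (e := e) (Z := Z)
  by_cases he : e ∈ Z.sym2
  · exact ⟨Z, ⟨hZ, by omega⟩, he⟩
  · rw [ii_insert_not he] at hlt; omega

theorem sparse_mem_or {I : Finset (Sym2 ℕ)} (hI : Sparse I) {e : Sym2 ℕ} (he : e ∈ I) :
    ∃ T, Tight I T ∧ e ∈ T.sym2 := by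
  have hd := hI.1 e he
  refine ⟨e.toFinset, ?_, ?_⟩
  · have hc := Sym2.card_toFinset_of_not_isDiag e hd
    refine ⟨by omega, ?_⟩
    have h1 := hI.2 e.toFinset (by omega)
    have : 0 < ii I e.toFinset := Finset.card_pos.2 ⟨e, by simp [Finset.mem_sym2_iff, he]⟩
    omega
  · simp [Finset.mem_sym2_iff]

theorem not_sparse_insert {I : Finset (Sym2 ℕ)} {e : Sym2 ℕ} (he : e ∉ I)
    {T : Finset ℕ} (hT : Tight I T) (heT : e ∈ T.sym2) : ¬ Sparse (insert e I) := by
  intro h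
  have h1 := h.2 T hT.1
  rw [ii_insert he heT] at h1
  have := hT.2
  omega

/-- size of a sparse set -/
theorem sparse_card {I : Finset (Sym2 ℕ)} (hI : Sparse I) {Z : Finset ℕ} (h : vs I ⊆ Z)
    (hZ : 2 ≤ #Z) : #I + 3 ≤ 2 * #Z := by
  have := hI.2 Z hZ
  rwa [ii_of_vs_subset h] at this

open Finset

theorem tight_subset_vs {I : Finset (Sym2 ℕ)} (hI : Sparse I) {T : Finset ℕ} (hT : Tight I T) :
    T ⊆ vs I := by
  intro v hv
  obtain ⟨a, -, ha⟩ := tight_one hI.1 (hI.lsp T) subset_rfl hT hv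
  exact mem_vs_left ha

open Classical in
theorem sparse_aug {I J : Finset (Sym2 ℕ)} (hI : Sparse I) (hJ : Sparse J) (hlt : #I < #J) :
    ∃ e ∈ J, e ∉ I ∧ Sparse (insert e I) := by
  by_contra! hcon
  have hcov : ∀ e ∈ J, ∃ T, Tight I T ∧ e ∈ T.sym2 := by
    intro e he
    by_cases heI : e ∈ I
    · exact sparse_mem_or hI heI
    · exact sparse_insert_or hI (hJ.1 e he) (hcon e he heI)
  let S := (vs I).powerset.filter (fun T => Tight I T)
  let Bl := S.filter (fun T => Maximal (· ∈ S) T)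
  have hS : ∀ T, T ∈ S ↔ Tight I T := by
    intro T
    simp only [S, Finset.mem_filter, Finset.mem_powerset]
    exact ⟨fun h => h.2, fun h => ⟨tight_subset_vs hI h, h⟩⟩
  have hcov2 : J ⊆ Bl.biUnion (fun T => J ∩ T.sym2) := by
    intro e he
    obtain ⟨T, hT, heT⟩ := hcov e he
    obtain ⟨M, hTM, hM⟩ := S.exists_le_maximal ((hS T).2 hT)
    refine Finset.mem_biUnion.2 ⟨M, Finset.mem_filter.2 ⟨hM.1, hM⟩, ?_⟩
    exact Finset.mem_inter.2 ⟨he, Finset.sym2_mono hTM heT⟩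
  have hpd : (Bl : Set (Finset ℕ)).PairwiseDisjoint (fun T => I ∩ T.sym2) := by
    intro A hA B hB hne
    simp only [Bl, Finset.coe_filter, Set.mem_ofPred_eq] at hA hB
    rw [Function.onFun, Finset.disjoint_left]
    intro e heA heB
    rw [Finset.mem_inter] at heA heB
    have h2 : 2 ≤ #(A ∩ B) := by
      rw [← Sym2.card_toFinset_of_not_isDiag e (hI.1 e heA.1)]
      apply Finset.card_le_card
      intro v hv
      rw [Sym2.mem_toFinset] at hv
      exact Finset.mem_inter.2 ⟨Finset.mem_sym2_iff.1 heA.2 v hv, Finset.mem_sym2_iff.1 heB.2 v hv⟩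
    have hu := (U1 (hI.lsp _) subset_rfl ((hS A).1 hA.1) ((hS B).1 hB.1) h2).1
    have e1 := hA.2.eq_of_le ((hS _).2 hu) Finset.subset_union_left
    have e2 := hB.2.eq_of_le ((hS _).2 hu) Finset.subset_union_right
    exact hne (e1.trans e2.symm)
  have c1 : #J ≤ ∑ T ∈ Bl, #(J ∩ T.sym2) := (Finset.card_le_card hcov2).trans Finset.card_biUnion_le
  have c2 : ∑ T ∈ Bl, #(J ∩ T.sym2) ≤ ∑ T ∈ Bl, #(I ∩ T.sym2) := by
    apply Finset.sum_le_sum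
    intro T hT
    have hT' := (hS T).1 (Finset.mem_filter.1 hT).1
    have a1 := hJ.2 T hT'.1
    have a2 := hT'.2
    unfold ii at a1 a2
    omega
  have c3 : ∑ T ∈ Bl, #(I ∩ T.sym2) ≤ #I := by
    rw [← Finset.card_biUnion hpd]
    apply Finset.card_le_card
    intro e he
    obtain ⟨T, -, h⟩ := Finset.mem_biUnion.1 he
    exact (Finset.mem_inter.1 h).1
  omega

theorem sparse_empty : Sparse ∅ := by
  refine ⟨fun e he => by simp at he, fun Z hZ => ?_⟩
  simp [ii]; omega

/-- the rigidity matroid -/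
noncomputable def RM : Matroid (Sym2 ℕ) :=
  (IndepMatroid.ofFinset {e : Sym2 ℕ | ¬ e.IsDiag} Sparse sparse_empty (fun _ _ hJ h => hJ.mono h)
    (fun _ _ hI hJ h => sparse_aug hI hJ h) (fun I hI e he => Set.mem_ofPred_eq.symm ▸ hI.1 e he)).matroid

theorem RM_indep {I : Finset (Sym2 ℕ)} : RM.Indep (I : Set (Sym2 ℕ)) ↔ Sparse I := by
  unfold RM
  rw [IndepMatroid.matroid_Indep]
  exact IndepMatroid.ofFinset_indep _ _ _ _ _ _

theorem RM_ground {I : Finset (Sym2 ℕ)} (h : Nd I) : (I : Set (Sym2 ℕ)) ⊆ RM.E := by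
  intro e he
  exact h e he

def Circ (C : Finset (Sym2 ℕ)) : Prop := Nd C ∧ ¬ Sparse C ∧ ∀ e ∈ C, Sparse (C.erase e)

instance RM_finitary : RM.Finitary := by
  refine ⟨fun I h => ?_⟩
  unfold RM
  rw [IndepMatroid.matroid_Indep]
  refine (IndepMatroid.ofFinset_indep' _ _ _ _ _ _).2 ?_
  intro J hJ
  exact RM_indep.1 (h _ hJ J.finite_toSet)

theorem RM_circ {C : Finset (Sym2 ℕ)} : RM.IsCircuit (C : Set (Sym2 ℕ)) ↔ Circ C := by
  rw [Matroid.isCircuit_iff_dep_forall_sdiff_singleton_indep]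
  constructor
  · rintro ⟨h1, h2⟩
    refine ⟨fun e he => h1.subset_ground he, fun h => h1.not_indep (RM_indep.2 h), fun e he => ?_⟩
    have := h2 e he
    rw [← Finset.coe_erase] at this
    exact RM_indep.1 this
  · rintro ⟨h1, h2, h3⟩
    refine ⟨⟨fun h => h2 (RM_indep.1 h), RM_ground h1⟩, fun e he => ?_⟩
    rw [← Finset.coe_erase]
    exact RM_indep.2 (h3 e he)

theorem RM_circ_fin {C : Set (Sym2 ℕ)} (h : RM.IsCircuit C) : ∃ D : Finset (Sym2 ℕ), (D : Set _) = C ∧ Circ D := by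
  obtain ⟨D, rfl⟩ := h.finite.exists_finset_coe
  exact ⟨D, rfl, RM_circ.1 h⟩

theorem circ_sub {F : Finset (Sym2 ℕ)} (hN : Nd F) (h : ¬ Sparse F) : ∃ C ⊆ F, Circ C := by
  have hd : RM.Dep (F : Set (Sym2 ℕ)) := ⟨fun h' => h (RM_indep.1 h'), RM_ground hN⟩
  obtain ⟨C, hC, hCc⟩ := hd.exists_isCircuit_subset
  obtain ⟨D, rfl, hD⟩ := RM_circ_fin hCc
  exact ⟨D, by exact_mod_cast hC, hD⟩

theorem circ_elim {C1 C2 : Finset (Sym2 ℕ)} (h1 : Circ C1) (h2 : Circ C2) {e f : Sym2 ℕ}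
    (he1 : e ∈ C1) (he2 : e ∈ C2) (hf1 : f ∈ C1) (hf2 : f ∉ C2) :
    ∃ C ⊆ (C1 ∪ C2).erase e, Circ C ∧ f ∈ C := by
  obtain ⟨C, hC, hCc, hf⟩ := (RM_circ.2 h1).strong_elimination (RM_circ.2 h2)
    (e := e) (f := f) (by simpa using he1) (by simpa using he2) (by simpa using hf1) (by simpa using hf2)
  obtain ⟨D, rfl, hD⟩ := RM_circ_fin hCc
  refine ⟨D, ?_, hD, by simpa using hf⟩
  rw [← Finset.coe_union, ← Finset.coe_erase] at hC
  exact_mod_cast hC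

theorem Circ.eq_of_subset {C D : Finset (Sym2 ℕ)} (hC : Circ C) (hD : Circ D) (h : D ⊆ C) : D = C := by
  by_contra hne
  obtain ⟨e, he, heD⟩ := Finset.exists_of_ssubset (h.ssubset_of_ne hne)
  refine hD.2.1 ((hC.2.2 e he).mono ?_)
  intro x hx
  exact Finset.mem_erase.2 ⟨fun h' => heD (h' ▸ hx), h hx⟩

theorem circ_trans_aux : ∀ n : ℕ, ∀ C1 C2 : Finset (Sym2 ℕ), #(C1 ∪ C2) ≤ n → Circ C1 → Circ C2 →
    (C1 ∩ C2).Nonempty → ∀ e ∈ C1, ∀ f ∈ C2, ∃ C ⊆ C1 ∪ C2, Circ C ∧ e ∈ C ∧ f ∈ C := by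
  intro n
  induction n with
  | zero =>
    intro C1 C2 hn h1 h2 hne e he
    have : e ∈ C1 ∪ C2 := Finset.mem_union_left _ he
    have := Finset.card_pos.2 ⟨e, this⟩
    omega
  | succ n ih =>
    intro C1 C2 hn h1 h2 hne e he f hf
    by_cases heC2 : e ∈ C2
    · exact ⟨C2, Finset.subset_union_right, h2, heC2, hf⟩
    by_cases hfC1 : f ∈ C1
    · exact ⟨C1, Finset.subset_union_left, h1, he, hfC1⟩
    obtain ⟨g, hg⟩ := hne
    rw [Finset.mem_inter] at hg
    obtain ⟨C3, h3s, h3, he3⟩ := circ_elim h1 h2 hg.1 hg.2 he heC2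
    have h3s' : C3 ⊆ C1 ∪ C2 := h3s.trans (Finset.erase_subset _ _)
    by_cases hf3 : f ∈ C3
    · exact ⟨C3, h3s', h3, he3, hf3⟩
    have hn31 : ¬ C3 ⊆ C1 := by
      intro h
      have := h1.eq_of_subset h3 h
      have hg3 : g ∈ C3 := this ▸ hg.1
      exact (Finset.mem_erase.1 (h3s hg3)).1 rfl
    obtain ⟨h, hh3, hh1⟩ := Finset.not_subset.1 hn31
    have hh2 : h ∈ C2 := by
      have := h3s' hh3
      rw [Finset.mem_union] at this; tauto
    obtain ⟨C4, h4s, h4, hf4⟩ := circ_elim h2 h3 hh2 hh3 hf hf3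
    have h4s' : C4 ⊆ C1 ∪ C2 := by
      intro x hx
      have := Finset.mem_of_mem_erase (h4s hx)
      rw [Finset.mem_union] at this
      rcases this with h | h
      · exact Finset.mem_union_right _ h
      · exact h3s' h
    have hh4 : h ∉ C4 := fun hx => (Finset.mem_erase.1 (h4s hx)).1 rfl
    have hn42 : ¬ C4 ⊆ C2 := by
      intro hs
      have := h2.eq_of_subset h4 hs
      exact hh4 (this ▸ hh2)
    obtain ⟨k, hk4, hk2⟩ := Finset.not_subset.1 hn42
    have hk1 : k ∈ C1 := by
      have := h4s' hk4
      rw [Finset.mem_union] at this; tauto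
    have hss : C1 ∪ C4 ⊆ (C1 ∪ C2).erase h := by
      intro x hx
      rw [Finset.mem_union] at hx
      refine Finset.mem_erase.2 ⟨?_, ?_⟩
      · rintro rfl; tauto
      · rcases hx with hx | hx
        · exact Finset.mem_union_left _ hx
        · exact h4s' hx
    have hc := Finset.card_le_card hss
    have hc2 := Finset.card_erase_add_one (s := C1 ∪ C2) (a := h) (Finset.mem_union_right _ hh2)
    obtain ⟨C, hC, hCc, heC, hfC⟩ := ih C1 C4 (by omega) h1 h4 ⟨k, Finset.mem_inter.2 ⟨hk1, hk4⟩⟩ e he f hf4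
    exact ⟨C, hC.trans (hss.trans (Finset.erase_subset _ _)), hCc, heC, hfC⟩

theorem circ_trans {C1 C2 : Finset (Sym2 ℕ)} (h1 : Circ C1) (h2 : Circ C2)
    (hne : (C1 ∩ C2).Nonempty) {e f : Sym2 ℕ} (he : e ∈ C1) (hf : f ∈ C2) :
    ∃ C ⊆ C1 ∪ C2, Circ C ∧ e ∈ C ∧ f ∈ C :=
  circ_trans_aux _ C1 C2 le_rfl h1 h2 hne e he f hf

def Conn (E : Finset (Sym2 ℕ)) : Prop :=
  Nd E ∧ ∀ e ∈ E, ∀ f ∈ E, e ≠ f → ∃ C ⊆ E, Circ C ∧ e ∈ C ∧ f ∈ C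

theorem Circ.conn {C : Finset (Sym2 ℕ)} (h : Circ C) : Conn C :=
  ⟨h.1, fun _ he _ hf _ => ⟨C, subset_rfl, h, he, hf⟩⟩

theorem conn_union {D D' : Finset (Sym2 ℕ)} (h : Conn D) (h' : Conn D') (hne : (D ∩ D').Nonempty) :
    Conn (D ∪ D') := by
  refine ⟨?_, ?_⟩
  · intro e he
    rcases Finset.mem_union.1 he with he | he
    · exact h.1 e he
    · exact h'.1 e he
  obtain ⟨g, hg⟩ := hne
  rw [Finset.mem_inter] at hg
  have key : ∀ e ∈ D, ∀ f ∈ D', e ≠ f → ∃ C ⊆ D ∪ D', Circ C ∧ e ∈ C ∧ f ∈ C := by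
    intro e he f hf hef
    by_cases heg : e = g
    · subst heg
      obtain ⟨C, h1, h2⟩ := h'.2 e hg.2 f hf hef
      exact ⟨C, h1.trans Finset.subset_union_right, h2⟩
    by_cases hfg : f = g
    · subst hfg
      obtain ⟨C, h1, h2⟩ := h.2 e he f hg.1 hef
      exact ⟨C, h1.trans Finset.subset_union_left, h2⟩
    obtain ⟨C1, s1, c1, e1, g1⟩ := h.2 e he g hg.1 heg
    obtain ⟨C2, s2, c2, f2, g2⟩ := h'.2 f hf g hg.2 hfg
    obtain ⟨C, s, c, e3, f3⟩ := circ_trans c1 c2 ⟨g, Finset.mem_inter.2 ⟨g1, g2⟩⟩ e1 f2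
    exact ⟨C, s.trans (Finset.union_subset_union s1 s2), c, e3, f3⟩
  intro e he f hf hef
  rcases Finset.mem_union.1 he with he | he <;> rcases Finset.mem_union.1 hf with hf | hf
  · obtain ⟨C, h1, h2⟩ := h.2 e he f hf hef
    exact ⟨C, h1.trans Finset.subset_union_left, h2⟩
  · exact key e he f hf hef
  · obtain ⟨C, h1, h2, h3, h4⟩ := key f hf e he hef.symm
    exact ⟨C, h1, h2, h4, h3⟩
  · obtain ⟨C, h1, h2⟩ := h'.2 e he f hf hef
    exact ⟨C, h1.trans Finset.subset_union_right, h2⟩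

/-- maximal sparse extension -/
theorem exists_basis {I D : Finset (Sym2 ℕ)} (hI : Sparse I) (hID : I ⊆ D) :
    ∃ B, I ⊆ B ∧ B ⊆ D ∧ Sparse B ∧ ∀ e ∈ D, e ∉ B → ¬ Sparse (insert e B) := by
  classical
  let S := D.powerset.filter (fun B => Sparse B)
  obtain ⟨B, hIB, hB⟩ := S.exists_le_maximal (a := I) (by simp [S, hI, hID])
  have h1 := hB.1
  simp only [S, Finset.mem_filter, Finset.mem_powerset] at h1
  refine ⟨B, hIB, h1.1, h1.2, fun e he heB hs => ?_⟩
  have : insert e B ∈ S := by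
    simp only [S, Finset.mem_filter, Finset.mem_powerset]
    exact ⟨Finset.insert_subset he h1.1, hs⟩
  have := hB.eq_of_le this (Finset.subset_insert e B)
  rw [this] at heB
  exact heB (Finset.mem_insert_self e B)

open Finset

theorem card_vs_two {E : Finset (Sym2 ℕ)} (hN : Nd E) (hne : E.Nonempty) : 2 ≤ #(vs E) := by
  obtain ⟨e, he⟩ := hne
  rw [← Sym2.card_toFinset_of_not_isDiag e (hN e he)]
  apply Finset.card_le_card
  intro v hv
  exact mem_vs.2 ⟨e, he, Sym2.mem_toFinset.1 hv⟩

theorem Circ.nonempty {C : Finset (Sym2 ℕ)} (h : Circ C) : C.Nonempty := by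
  rw [Finset.nonempty_iff_ne_empty]
  rintro rfl
  exact h.2.1 sparse_empty

theorem ii_erase_not {E : Finset (Sym2 ℕ)} {e : Sym2 ℕ} {Z : Finset ℕ} (hZ : e ∉ Z.sym2) :
    ii (E.erase e) Z = ii E Z := by
  unfold ii; congr 1; ext f; simp only [Finset.mem_inter, Finset.mem_erase]
  constructor
  · tauto
  · rintro ⟨h1, h2⟩; exact ⟨⟨fun h => hZ (h ▸ h2), h1⟩, h2⟩

theorem ii_erase_mem {E : Finset (Sym2 ℕ)} {e : Sym2 ℕ} {Z : Finset ℕ} (he : e ∈ E)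
    (hZ : e ∈ Z.sym2) : ii (E.erase e) Z + 1 = ii E Z := by
  unfold ii; rw [Finset.erase_inter]
  exact Finset.card_erase_add_one (Finset.mem_inter.2 ⟨he, hZ⟩)

theorem Circ.card {C : Finset (Sym2 ℕ)} (h : Circ C) : #C + 2 = 2 * #(vs C) := by
  have h2 := h.2.1
  have hn : ¬ ∀ Z, 2 ≤ #Z → ii C Z + 3 ≤ 2 * #Z := fun h' => h2 ⟨h.1, h'⟩
  push Not at hn
  obtain ⟨Z, hZ, hlt⟩ := hn
  have hsub : C ⊆ Z.sym2 := by
    intro e he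
    by_contra hez
    have := (h.2.2 e he).2 Z hZ
    rw [ii_erase_not hez] at this
    omega
  have hv := subset_sym2_iff.1 hsub
  rw [ii_of_vs_subset hv] at hlt
  obtain ⟨e, he⟩ := h.nonempty
  have h3 := sparse_card (h.2.2 e he) (vs_mono (Finset.erase_subset e C)) (card_vs_two h.1 ⟨e, he⟩)
  have h4 := Finset.card_erase_add_one he
  have h5 := Finset.card_le_card hv
  omega

theorem Circ.tight {C : Finset (Sym2 ℕ)} (h : Circ C) {e : Sym2 ℕ} (he : e ∈ C) :
    Tight (C.erase e) (vs C) := by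
  refine ⟨card_vs_two h.1 ⟨e, he⟩, ?_⟩
  rw [ii_of_vs_subset (vs_mono (Finset.erase_subset e C))]
  have := h.card
  have h4 := Finset.card_erase_add_one he
  omega

theorem Circ.lsp {C : Finset (Sym2 ℕ)} (h : Circ C) {Z : Finset ℕ} (hZ : 2 ≤ #Z)
    (hZC : ¬ vs C ⊆ Z) : ii C Z + 3 ≤ 2 * #Z := by
  rw [← subset_sym2_iff, Finset.not_subset] at hZC
  obtain ⟨e, he, hez⟩ := hZC
  have := (h.2.2 e he).2 Z hZ
  rwa [ii_erase_not hez] at this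

theorem Circ.three_le {C : Finset (Sym2 ℕ)} (h : Circ C) : 3 ≤ #(vs C) := by
  have h2 := card_vs_two h.1 h.nonempty
  by_contra hlt
  have hc : #(vs C) = 2 := by omega
  have h3 := h.card
  obtain ⟨a, b, hab, hv⟩ := Finset.card_eq_two.1 hc
  have : C ⊆ {s(a, b)} := by
    intro e
    induction e with
    | _ x y =>
      intro he
      have hx := mem_vs_left he
      have hy := mem_vs_right he
      have hne := h.1.ne he
      rw [hv] at hx hy
      simp only [Finset.mem_insert, Finset.mem_singleton] at hx hy ⊢
      rcases hx with rfl | rfl <;> rcases hy with rfl | rfl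
      · exact absurd rfl hne
      · rfl
      · exact Sym2.eq_swap
      · exact absurd rfl hne
  have := Finset.card_le_card this
  rw [Finset.card_singleton] at this
  omega

theorem Circ.deg {C : Finset (Sym2 ℕ)} (h : Circ C) {v : ℕ} (hv : v ∈ vs C) :
    ∃ a b c, a ≠ b ∧ a ≠ c ∧ b ≠ c ∧ s(v, a) ∈ C ∧ s(v, b) ∈ C ∧ s(v, c) ∈ C := by
  obtain ⟨e, he, hve⟩ := mem_vs.1 hv
  obtain ⟨a, rfl⟩ := Sym2.mem_iff_exists.1 hve
  have hs := h.2.2 _ he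
  obtain ⟨b, -, c, -, hbc, hb, hc⟩ := tight_two hs.1 (hs.lsp _) subset_rfl (h.tight he) h.three_le hv
  rw [Finset.mem_erase] at hb hc
  refine ⟨a, b, c, ?_, ?_, hbc, he, hb.2, hc.2⟩
  · rintro rfl; exact hb.1 rfl
  · rintro rfl; exact hc.1 rfl

theorem Conn.exists_circ {D : Finset (Sym2 ℕ)} (h : Conn D) (h1 : 1 < #D) {e : Sym2 ℕ} (he : e ∈ D) :
    ∃ C ⊆ D, Circ C ∧ e ∈ C := by
  obtain ⟨f, hf, hfe⟩ := Finset.exists_mem_ne h1 e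
  obtain ⟨C, h1, h2, h3, -⟩ := h.2 e he f hf hfe.symm
  exact ⟨C, h1, h2, h3⟩

theorem Conn.deg {D : Finset (Sym2 ℕ)} (h : Conn D) (h1 : 1 < #D) {v : ℕ} (hv : v ∈ vs D) :
    ∃ a b c, a ≠ b ∧ a ≠ c ∧ b ≠ c ∧ s(v, a) ∈ D ∧ s(v, b) ∈ D ∧ s(v, c) ∈ D := by
  obtain ⟨e, he, hve⟩ := mem_vs.1 hv
  obtain ⟨C, hCD, hC, heC⟩ := h.exists_circ h1 he
  obtain ⟨a, b, c, h1, h2, h3, h4, h5, h6⟩ := hC.deg (mem_vs.2 ⟨e, heC, hve⟩)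
  exact ⟨a, b, c, h1, h2, h3, hCD h4, hCD h5, hCD h6⟩

theorem Conn.four_le {D : Finset (Sym2 ℕ)} (h : Conn D) (h1 : 1 < #D) : 4 ≤ #(vs D) := by
  obtain ⟨e, he⟩ := Finset.card_pos.1 (show 0 < #D by omega)
  obtain ⟨v, hv⟩ := Finset.card_pos.1 (show 0 < #(vs D) by have := card_vs_two h.1 ⟨e, he⟩; omega)
  obtain ⟨a, b, c, hab, hac, hbc, ha, hb, hc⟩ := h.deg h1 hv
  have : ({v, a, b, c} : Finset ℕ) ⊆ vs D := by
    intro x hx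
    simp only [Finset.mem_insert, Finset.mem_singleton] at hx
    rcases hx with rfl | rfl | rfl | rfl
    · exact hv
    · exact mem_vs_right ha
    · exact mem_vs_right hb
    · exact mem_vs_right hc
  have h4 : #({v, a, b, c} : Finset ℕ) = 4 := by
    have := h.1.ne ha
    have := h.1.ne hb
    have := h.1.ne hc
    rw [Finset.card_insert_of_notMem, Finset.card_insert_of_notMem, Finset.card_pair hbc] <;> simp <;> tauto
  have := Finset.card_le_card this
  omega

theorem mem_cl {I : Finset (Sym2 ℕ)} (hI : Sparse I) {e : Sym2 ℕ} (hd : ¬ e.IsDiag) :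
    e ∈ RM.closure (I : Set (Sym2 ℕ)) ↔ ∃ T, Tight I T ∧ e ∈ T.sym2 := by
  rw [(RM_indep.2 hI).mem_closure_iff]
  constructor
  · rintro (h | h)
    · rw [← Finset.coe_insert] at h
      exact sparse_insert_or hI hd (fun h' => h.not_indep (RM_indep.2 h'))
    · exact sparse_mem_or hI h
  · rintro ⟨T, hT, heT⟩
    by_cases he : e ∈ I
    · right; exact he
    · left
      rw [← Finset.coe_insert]
      exact ⟨fun h => not_sparse_insert he hT heT (RM_indep.1 h), RM_ground (hI.1.insert hd)⟩

/-- `B` is a basis of `D` -/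
def Bas (B D : Finset (Sym2 ℕ)) : Prop := B ⊆ D ∧ Sparse B ∧ ∀ e ∈ D, e ∉ B → ¬ Sparse (insert e B)

theorem Bas.closure {B D : Finset (Sym2 ℕ)} (h : Bas B D) (hN : Nd D) {J : Finset (Sym2 ℕ)}
    (hJ : J ⊆ D) : RM.closure (J : Set (Sym2 ℕ)) ⊆ RM.closure (B : Set (Sym2 ℕ)) := by
  apply RM.closure_subset_closure_of_subset_closure
  intro e he
  have heD := hJ he
  rw [mem_cl h.2.1 (hN e heD)]
  by_cases heB : e ∈ B
  · exact sparse_mem_or h.2.1 heB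
  · exact sparse_insert_or h.2.1 (hN e heD) (h.2.2 e heD heB)

theorem max_tight {B : Finset (Sym2 ℕ)} (hB : Sparse B) {T : Finset ℕ} (hT : Tight B T) :
    ∃ M, T ⊆ M ∧ Tight B M ∧ ∀ M', Tight B M' → M ⊆ M' → M = M' := by
  classical
  let S := (vs B).powerset.filter (fun T => Tight B T)
  have hS : ∀ T, T ∈ S ↔ Tight B T := by
    intro T
    simp only [S, Finset.mem_filter, Finset.mem_powerset]
    exact ⟨fun h => h.2, fun h => ⟨tight_subset_vs hB h, h⟩⟩
  obtain ⟨M, hTM, hM⟩ := S.exists_le_maximal ((hS T).2 hT)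
  exact ⟨M, hTM, (hS M).1 hM.1, fun M' h1 h2 => hM.eq_of_le ((hS M').2 h1) h2⟩

theorem circ_pair_cl {B D C : Finset (Sym2 ℕ)} (hB : Bas B D) (hN : Nd D) (hC : Circ C) (hCD : C ⊆ D)
    {p r : ℕ} (hp : p ∈ vs C) (hr : r ∈ vs C) (hpr : p ≠ r) : ∃ T, Tight B T ∧ p ∈ T ∧ r ∈ T := by
  obtain ⟨e, he⟩ := hC.nonempty
  have h1 : s(p, r) ∈ RM.closure ((C.erase e : Finset _) : Set (Sym2 ℕ)) :=
    (mem_cl (hC.2.2 e he) (by simpa using hpr)).2 ⟨vs C, hC.tight he, by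
      rw [Finset.mk_mem_sym2_iff]; exact ⟨hp, hr⟩⟩
  have h2 := hB.closure hN ((Finset.erase_subset e C).trans hCD) h1
  obtain ⟨T, hT, h⟩ := (mem_cl hB.2.1 (by simpa using hpr)).1 h2
  rw [Finset.mk_mem_sym2_iff] at h
  exact ⟨T, hT, h⟩

theorem rig {B D : Finset (Sym2 ℕ)} (hD : Conn D) (hne : D.Nonempty) (hB : Bas B D) :
    Tight B (vs D) := by
  obtain ⟨e0, he0⟩ := hne
  have hcl : ∃ T, Tight B T ∧ e0 ∈ T.sym2 := by
    by_cases heB : e0 ∈ B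
    · exact sparse_mem_or hB.2.1 heB
    · exact sparse_insert_or hB.2.1 (hD.1 e0 he0) (hB.2.2 e0 he0 heB)
  obtain ⟨T, hT, heT⟩ := hcl
  obtain ⟨Z, hTZ, hZ, hmax⟩ := max_tight hB.2.1 hT
  induction e0 with
  | _ p q =>
  have hpq := hD.1.ne he0
  rw [Finset.mk_mem_sym2_iff] at heT
  have hsub : vs D ⊆ Z := by
    intro r hr
    obtain ⟨f, hf, hrf⟩ := mem_vs.1 hr
    by_cases hfe : f = s(p, q)
    · subst hfe
      rw [Sym2.mem_iff] at hrf
      rcases hrf with rfl | rfl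
      · exact hTZ heT.1
      · exact hTZ heT.2
    obtain ⟨C, hCD, hC, h1, h2⟩ := hD.2 _ he0 f hf (Ne.symm hfe)
    by_contra hrZ
    have hpr : p ≠ r := by rintro rfl; exact hrZ (hTZ heT.1)
    have hqr : q ≠ r := by rintro rfl; exact hrZ (hTZ heT.2)
    have hrC : r ∈ vs C := mem_vs.2 ⟨f, h2, hrf⟩
    obtain ⟨T1, t1, hp1, hr1⟩ := circ_pair_cl hB hD.1 hC hCD (mem_vs_left h1) hrC hpr
    obtain ⟨T2, t2, hp2, hr2⟩ := circ_pair_cl hB hD.1 hC hCD (mem_vs_right h1) hrC hqr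
    have := (U2 hB.2.1.1 (hB.2.1.lsp _) subset_rfl hZ t1 t2 (w1 := r) (w2 := q) (w3 := p)
      (by simp [hp1, hTZ heT.1]) (by simp [hr1, hr2]) (by simp [hp2, hTZ heT.2]) hqr.symm hpr.symm hpq.symm).1
    have := hmax _ this (by intro x; simp; tauto)
    apply hrZ
    rw [this]; simp [hr1]
  have : Z = vs D := (tight_subset_vs hB.2.1 hZ |>.trans (vs_mono hB.1)).antisymm hsub
  rwa [← this]

theorem exists_bas {I D : Finset (Sym2 ℕ)} (hI : Sparse I) (hID : I ⊆ D) : ∃ B, I ⊆ B ∧ Bas B D := by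
  obtain ⟨B, h1, h2, h3, h4⟩ := exists_basis hI hID
  exact ⟨B, h1, h2, h3, h4⟩

theorem rig_card {B D : Finset (Sym2 ℕ)} (hD : Conn D) (hne : D.Nonempty) (hB : Bas B D) :
    #B + 3 = 2 * #(vs D) := by
  have := (rig hD hne hB).2
  rwa [ii_of_vs_subset (vs_mono hB.1)] at this

theorem rig_erase {D : Finset (Sym2 ℕ)} (hD : Conn D) (h1 : 1 < #D) (e : Sym2 ℕ) :
    ∃ B, B ⊆ D.erase e ∧ Sparse B ∧ Tight B (vs D) ∧ Bas B D := by
  have hne : D.Nonempty := Finset.card_pos.1 (by omega)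
  by_cases he : e ∈ D
  · obtain ⟨C, hCD, hC, heC⟩ := hD.exists_circ h1 he
    obtain ⟨B, hIB, hB⟩ := exists_bas (hC.2.2 e heC) ((Finset.erase_subset e C).trans hCD)
    refine ⟨B, ?_, hB.2.1, rig hD hne hB, hB⟩
    intro f hf
    refine Finset.mem_erase.2 ⟨?_, hB.1 hf⟩
    rintro rfl
    refine hC.2.1 (hB.2.1.mono ?_)
    intro x hx
    by_cases hxf : x = f
    · subst hxf; exact hf
    · exact hIB (Finset.mem_erase.2 ⟨hxf, hx⟩)
  · obtain ⟨B, -, hB⟩ := exists_bas sparse_empty (Finset.empty_subset D)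
    exact ⟨B, by rw [Finset.erase_eq_of_notMem he]; exact hB.1, hB.2.1, rig hD hne hB, hB⟩

open Finset

theorem conn_of_hub {E K : Finset (Sym2 ℕ)} (hK : Conn K) (hKE : K ⊆ E)
    (h : ∀ e ∈ E, ∃ D ⊆ E, Conn D ∧ e ∈ D ∧ (D ∩ K).Nonempty) : Conn E := by
  refine ⟨fun e he => ?_, fun e he f hf hef => ?_⟩
  · obtain ⟨D, -, hD, heD, -⟩ := h e he
    exact hD.1 e heD
  obtain ⟨D1, s1, c1, e1, n1⟩ := h e he
  obtain ⟨D2, s2, c2, e2, n2⟩ := h f hf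
  have u1 := conn_union c1 hK n1
  have u2 : Conn (D1 ∪ K ∪ D2) := by
    apply conn_union u1 c2
    obtain ⟨g, hg⟩ := n2
    rw [Finset.mem_inter] at hg
    exact ⟨g, by simp [hg.1, hg.2]⟩
  obtain ⟨C, hC, h1⟩ := u2.2 e (by simp [e1]) f (by simp [e2]) hef
  refine ⟨C, hC.trans ?_, h1⟩
  exact Finset.union_subset (Finset.union_subset s1 hKE) s2

theorem Circ.four_le {C : Finset (Sym2 ℕ)} (h : Circ C) : 4 ≤ #C := by
  have := h.card
  have := h.three_le
  omega

theorem conn_add {E : Finset (Sym2 ℕ)} (hE : Conn E) {a b : ℕ} (ha : a ∈ vs E) (hb : b ∈ vs E)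
    (hab : a ≠ b) : Conn (insert s(a, b) E) := by
  by_cases he : s(a, b) ∈ E
  · rwa [Finset.insert_eq_of_mem he]
  have hne : E.Nonempty := by
    obtain ⟨e, he, -⟩ := mem_vs.1 ha
    exact ⟨e, he⟩
  obtain ⟨B, -, hB⟩ := exists_bas sparse_empty (Finset.empty_subset E)
  have ht := rig hE hne hB
  have heB : s(a, b) ∉ B := fun h => he (hB.1 h)
  have hns := not_sparse_insert heB ht (Finset.mk_mem_sym2_iff.2 ⟨ha, hb⟩)
  obtain ⟨C, hCs, hC⟩ := circ_sub (hB.2.1.1.insert (by simpa using hab)) hns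
  have heC : s(a, b) ∈ C := by
    by_contra h
    refine hC.2.1 (hB.2.1.mono ?_)
    exact (Finset.subset_insert_iff_of_notMem h).1 hCs
  obtain ⟨f, hf, hfe⟩ := Finset.exists_mem_ne (show 1 < #C by have := hC.four_le; omega) s(a, b)
  have hfE : f ∈ E := by
    have := hCs hf
    rw [Finset.mem_insert] at this
    rcases this with h | h
    · exact absurd h hfe
    · exact hB.1 h
  have := conn_union hE hC.conn ⟨f, Finset.mem_inter.2 ⟨hfE, hf⟩⟩
  have heq : E ∪ C = insert s(a, b) E := by
    ext x
    simp only [Finset.mem_union, Finset.mem_insert]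
    constructor
    · rintro (h | h)
      · exact Or.inr h
      · have := hCs h
        rw [Finset.mem_insert] at this
        rcases this with h | h
        · exact Or.inl h
        · exact Or.inr (hB.1 h)
    · rintro (rfl | h)
      · exact Or.inr heC
      · exact Or.inl h
  rwa [heq] at this

def spl (E : Finset (Sym2 ℕ)) (v x y z : ℕ) : Finset (Sym2 ℕ) :=
  insert s(v, x) (insert s(v, y) (insert s(v, z) (E.erase s(x, y))))

theorem mem_spl {E : Finset (Sym2 ℕ)} {v x y z : ℕ} {e : Sym2 ℕ} :
    e ∈ spl E v x y z ↔ e = s(v, x) ∨ e = s(v, y) ∨ e = s(v, z) ∨ (e ≠ s(x, y) ∧ e ∈ E) := by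
  simp [spl]

theorem spl_mono {E F : Finset (Sym2 ℕ)} {v x y z : ℕ} (h : E ⊆ F) : spl E v x y z ⊆ spl F v x y z := by
  intro e
  rw [mem_spl, mem_spl]
  have := @h e
  tauto

theorem notMem_of_vs {E : Finset (Sym2 ℕ)} {v w : ℕ} (h : v ∉ vs E) : s(v, w) ∉ E :=
  fun h' => h (mem_vs_left h')

theorem notMem_of_vs' {E : Finset (Sym2 ℕ)} {v w : ℕ} (h : v ∉ vs E) : s(w, v) ∉ E :=
  fun h' => h (mem_vs_right h')

theorem circ_spl {C : Finset (Sym2 ℕ)} (hC : Circ C) {v x y z : ℕ} (hxy : s(x, y) ∈ C)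
    (hz : z ∈ vs C) (hzx : z ≠ x) (hzy : z ≠ y) (hv : v ∉ vs C) : Circ (spl C v x y z) := by
  have hx := mem_vs_left hxy
  have hy := mem_vs_right hxy
  have hxy' := hC.1.ne hxy
  have hvx : v ≠ x := fun h => hv (h ▸ hx)
  have hvy : v ≠ y := fun h => hv (h ▸ hy)
  have hvz : v ≠ z := fun h => hv (h ▸ hz)
  have hN : Nd (spl C v x y z) := by
    intro e he
    rw [mem_spl] at he
    rcases he with rfl | rfl | rfl | h
    · simpa using hvx
    · simpa using hvy
    · simpa using hvz
    · exact hC.1 e h.2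
  have hve : v ∉ vs (C.erase s(x, y)) := fun h => hv (vs_mono (Finset.erase_subset _ _) h)
  have hcard : #(spl C v x y z) = #C + 2 := by
    have := Finset.card_erase_add_one hxy
    unfold spl
    rw [Finset.card_insert_of_notMem, Finset.card_insert_of_notMem, Finset.card_insert_of_notMem]
    · omega
    · exact notMem_of_vs hve
    · simp only [Finset.mem_insert, not_or]
      exact ⟨by simp [hzy.symm, hvz], notMem_of_vs hve⟩
    · simp only [Finset.mem_insert, not_or]
      exact ⟨by simp [hxy', hvy], by simp [hzx.symm, hvz], notMem_of_vs hve⟩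
  have hvs : vs (spl C v x y z) ⊆ insert v (vs C) := by
    intro u hu
    obtain ⟨e, he, hue⟩ := mem_vs.1 hu
    rw [Finset.mem_insert]
    rw [mem_spl] at he
    rcases he with rfl | rfl | rfl | h
    · rw [Sym2.mem_iff] at hue; rcases hue with rfl | rfl <;> tauto
    · rw [Sym2.mem_iff] at hue; rcases hue with rfl | rfl <;> tauto
    · rw [Sym2.mem_iff] at hue; rcases hue with rfl | rfl <;> tauto
    · right; exact mem_vs.2 ⟨e, h.2, hue⟩
  refine ⟨hN, ?_, ?_⟩
  · intro hs
    have h1 := sparse_card hs hvs (by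
      rw [Finset.card_insert_of_notMem hv]
      have := hC.three_le
      omega)
    rw [Finset.card_insert_of_notMem hv] at h1
    have := hC.card
    omega
  · intro f hf
    refine ⟨hN.mono (Finset.erase_subset _ _), fun Z hZ => ?_⟩
    have hsp := hC.2.2 _ hxy
    by_cases hvZ : v ∈ Z
    · have h1 := ii_erase_add (E := (spl C v x y z).erase f) (T := Z) v
      have h2 := Finset.card_erase_add_one hvZ
      have hle : ii ((spl C v x y z).erase f) (Z.erase v) ≤ ii (C.erase s(x, y)) (Z.erase v) := by
        apply Finset.card_le_card
        intro e he
        simp only [Finset.mem_inter, Finset.mem_erase, mem_spl] at he ⊢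
        have hvn : v ∉ e := fun h => by
          have := Finset.mem_sym2_iff.1 he.2 v h
          simp at this
        rcases he with ⟨⟨h1, rfl | rfl | rfl | h⟩, h3⟩
        · simp at hvn
        · simp at hvn
        · simp at hvn
        · exact ⟨h, h3⟩
      have hsub : ((spl C v x y z).erase f).filter (fun e => v ∈ e ∧ e ∈ Z.sym2) ⊆
          {s(v, x), s(v, y), s(v, z)} := by
        intro e he
        simp only [Finset.mem_filter, Finset.mem_erase, mem_spl] at he
        simp only [Finset.mem_insert, Finset.mem_singleton]
        rcases he with ⟨⟨h1, h | h | h | h⟩, h3, h4⟩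
        · tauto
        · tauto
        · tauto
        · exact absurd (mem_vs.2 ⟨e, h.2, h3⟩) hv
      by_cases hZ1 : #(Z.erase v) ≤ 1
      · have h0 : ii ((spl C v x y z).erase f) (Z.erase v) = 0 :=
          ii_small (hN.mono (Finset.erase_subset _ _)) hZ1
        have : #(((spl C v x y z).erase f).filter (fun e => v ∈ e ∧ e ∈ Z.sym2)) ≤ 1 := by
          rw [Finset.card_le_one]
          intro a ha b hb
          have ha' := hsub ha
          have hb' := hsub hb
          simp only [Finset.mem_insert, Finset.mem_singleton, Finset.mem_filter] at ha hb ha' hb'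
          rw [Finset.card_le_one] at hZ1
          have key : ∀ p ∈ Z, ∀ q ∈ Z, v ≠ p → v ≠ q → p = q := by
            intro p hp q hq h1 h2
            exact hZ1 p (by simp [hp, Ne.symm h1]) q (by simp [hq, Ne.symm h2])
          rcases ha' with rfl | rfl | rfl <;> rcases hb' with rfl | rfl | rfl <;>
            simp only [Finset.mk_mem_sym2_iff] at ha hb <;> grind
        omega
      · have h3 := hsp.2 (Z.erase v) (by omega)
        by_cases h3' : #(((spl C v x y z).erase f).filter (fun e => v ∈ e ∧ e ∈ Z.sym2)) ≤ 2
        · omega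
        · have hle3 : #({s(v, x), s(v, y), s(v, z)} : Finset (Sym2 ℕ)) ≤ 3 := Finset.card_le_three
          have heq := Finset.eq_of_subset_of_card_le hsub (by omega)
          have m1 : s(v, x) ∈ ((spl C v x y z).erase f).filter (fun e => v ∈ e ∧ e ∈ Z.sym2) := by
            rw [heq]; simp
          have m2 : s(v, y) ∈ ((spl C v x y z).erase f).filter (fun e => v ∈ e ∧ e ∈ Z.sym2) := by
            rw [heq]; simp
          have m3 : s(v, z) ∈ ((spl C v x y z).erase f).filter (fun e => v ∈ e ∧ e ∈ Z.sym2) := by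
            rw [heq]; simp
          simp only [Finset.mem_filter, Finset.mem_erase, Finset.mk_mem_sym2_iff] at m1 m2 m3
          rw [mem_spl] at hf
          have hfC : f ≠ s(x, y) ∧ f ∈ C := by
            rcases hf with rfl | rfl | rfl | h
            · exact absurd rfl m1.1.1
            · exact absurd rfl m2.1.1
            · exact absurd rfl m3.1.1
            · exact h
          have hmem : s(x, y) ∈ (Z.erase v).sym2 := by
            rw [Finset.mk_mem_sym2_iff]
            simp [m1.2.2.2, m2.2.2.2, hvx.symm, hvy.symm]
          have hs2 := (hC.2.2 f hfC.2).2 (Z.erase v) (by omega)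
          have hem := ii_erase_mem (E := C.erase f) (e := s(x, y)) (Z := Z.erase v)
            (Finset.mem_erase.2 ⟨hfC.1.symm, hxy⟩) hmem
          have hle2 : ii ((spl C v x y z).erase f) (Z.erase v) ≤ ii ((C.erase f).erase s(x, y)) (Z.erase v) := by
            apply Finset.card_le_card
            intro e he
            simp only [Finset.mem_inter, Finset.mem_erase, mem_spl] at he ⊢
            have hvn : v ∉ e := fun h => by
              have := Finset.mem_sym2_iff.1 he.2 v h
              simp at this
            rcases he with ⟨⟨h1, rfl | rfl | rfl | h⟩, h3⟩
            · simp at hvn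
            · simp at hvn
            · simp at hvn
            · exact ⟨⟨h.1, h1, h.2⟩, h3⟩
          have := Finset.card_le_card hsub
          omega
    · have h1 := hsp.2 Z hZ
      have : ii ((spl C v x y z).erase f) Z ≤ ii (C.erase s(x, y)) Z := by
        apply Finset.card_le_card
        intro e he
        simp only [Finset.mem_inter, Finset.mem_erase, mem_spl] at he ⊢
        have hvn : v ∉ e := fun h => hvZ (Finset.mem_sym2_iff.1 he.2 v h)
        rcases he with ⟨⟨h1, rfl | rfl | rfl | h⟩, h3⟩
        · simp at hvn
        · simp at hvn
        · simp at hvn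
        · exact ⟨h, h3⟩
      omega

theorem conn_spl {E : Finset (Sym2 ℕ)} (hE : Conn E) {v x y z : ℕ} (hxy : s(x, y) ∈ E)
    (hz : z ∈ vs E) (hzx : z ≠ x) (hzy : z ≠ y) (hv : v ∉ vs E) : Conn (spl E v x y z) := by
  obtain ⟨f, hf, hzf⟩ := mem_vs.1 hz
  have hfxy : s(x, y) ≠ f := by
    rintro rfl
    rw [Sym2.mem_iff] at hzf
    tauto
  obtain ⟨C, hCE, hC, hxyC, hfC⟩ := hE.2 _ hxy f hf hfxy
  have hK := circ_spl hC hxyC (mem_vs.2 ⟨f, hfC, hzf⟩) hzx hzy (fun h => hv (vs_mono hCE h))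
  refine conn_of_hub hK.conn (spl_mono hCE) ?_
  intro e he
  by_cases heK : e ∈ spl C v x y z
  · exact ⟨_, spl_mono hCE, hK.conn, heK, ⟨e, by simp [heK]⟩⟩
  have he' : e ≠ s(x, y) ∧ e ∈ E := by
    rw [mem_spl] at he heK
    tauto
  have heC : e ∉ C := by
    rw [mem_spl] at heK
    tauto
  obtain ⟨Ce, hCeE, hCe, hxyCe, heCe⟩ := hE.2 _ hxy e he'.2 he'.1.symm
  obtain ⟨D, hDs, hD, heD⟩ := circ_elim hCe hC hxyCe hxyC heCe heC
  refine ⟨D, ?_, hD.conn, heD, ?_⟩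
  · intro g hg
    have := hDs hg
    rw [Finset.mem_erase, Finset.mem_union] at this
    rw [mem_spl]
    right; right; right
    exact ⟨this.1, this.2.elim (fun h => hCeE h) (fun h => hCE h)⟩
  · by_contra hcon
    rw [Finset.not_nonempty_iff_eq_empty] at hcon
    have hsub : D ⊆ Ce := by
      intro g hg
      have := hDs hg
      rw [Finset.mem_erase, Finset.mem_union] at this
      rcases this.2 with h | h
      · exact h
      · exfalso
        have : g ∈ D ∩ spl C v x y z := Finset.mem_inter.2 ⟨hg, mem_spl.2 (by tauto)⟩
        rw [hcon] at this
        simp at this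
    have := hCe.eq_of_subset hD hsub
    have h1 : s(x, y) ∈ D := this ▸ hxyCe
    exact (Finset.mem_erase.1 (hDs h1)).1 rfl

open Finset

theorem mem_sym2_of_mem {E : Finset (Sym2 ℕ)} {e : Sym2 ℕ} {A : Finset ℕ} (he : e ∈ E)
    (h : e ∈ A.sym2) : e ∈ (vs E ∩ A).sym2 := by
  rw [← sym2_inter']
  exact Finset.mem_inter.2 ⟨mem_sym2_vs he, h⟩

theorem card_two_of_edge {e : Sym2 ℕ} (hd : ¬ e.IsDiag) {A : Finset ℕ} (h : e ∈ A.sym2) : 2 ≤ #A := by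
  rw [← Sym2.card_toFinset_of_not_isDiag e hd]
  apply Finset.card_le_card
  intro v hv
  exact Finset.mem_sym2_iff.1 h v (Sym2.mem_toFinset.1 hv)

/-- a circuit crossing a separation of order at most two -/
theorem circ_cross {C : Finset (Sym2 ℕ)} (hC : Circ C) {A B : Finset ℕ} (hAB : #(A ∩ B) ≤ 2)
    (hcov : ∀ e ∈ C, e ∈ A.sym2 ∨ e ∈ B.sym2) {f g : Sym2 ℕ} (hf : f ∈ C) (hfB : f ∉ B.sym2)
    (hg : g ∈ C) (hgA : g ∉ A.sym2) :
    #(A ∩ B) = 2 ∧ A ∩ B ⊆ vs C ∧ ii C (A ∩ B) = 0 ∧ Tight C (vs C ∩ A) ∧ Tight C (vs C ∩ B) := by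
  have hfA : f ∈ A.sym2 := (hcov f hf).resolve_right hfB
  have hgB : g ∈ B.sym2 := (hcov g hg).resolve_left hgA
  have hun : (vs C ∩ A) ∪ (vs C ∩ B) = vs C := by
    ext v
    simp only [Finset.mem_union, Finset.mem_inter]
    constructor
    · tauto
    · intro hv
      obtain ⟨e, he, hve⟩ := mem_vs.1 hv
      rcases hcov e he with h | h
      · left; exact ⟨hv, Finset.mem_sym2_iff.1 h v hve⟩
      · right; exact ⟨hv, Finset.mem_sym2_iff.1 h v hve⟩
  have hABi : (vs C ∩ A) ∩ (vs C ∩ B) = vs C ∩ (A ∩ B) := by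
    ext v; simp only [Finset.mem_inter]; tauto
  have hm := ii_modular (E := C) (A := vs C ∩ A) (B := vs C ∩ B) (by
    intro e he _
    rcases hcov e he with h | h
    · left; exact mem_sym2_of_mem he h
    · right; exact mem_sym2_of_mem he h)
  have hc := Finset.card_union_add_card_inter (vs C ∩ A) (vs C ∩ B)
  rw [hun, hABi] at hm hc
  have a2 := card_two_of_edge (hC.1 f hf) (mem_sym2_of_mem hf hfA)
  have b2 := card_two_of_edge (hC.1 g hg) (mem_sym2_of_mem hg hgB)
  have la := hC.lsp a2 (by
    intro h
    rw [← subset_sym2_iff] at h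
    exact hgA (Finset.sym2_mono Finset.inter_subset_right (h hg)))
  have lb := hC.lsp b2 (by
    intro h
    rw [← subset_sym2_iff] at h
    exact hfB (Finset.sym2_mono Finset.inter_subset_right (h hf)))
  have hcard := hC.card
  rw [ii_of_vs_subset subset_rfl] at hm
  have hle : #(vs C ∩ (A ∩ B)) ≤ #(A ∩ B) := Finset.card_le_card Finset.inter_subset_right
  have heq : vs C ∩ (A ∩ B) = A ∩ B :=
    Finset.eq_of_subset_of_card_le Finset.inter_subset_right (by omega)
  rw [heq] at hm hc
  refine ⟨by omega, ?_, by omega, ⟨a2, by omega⟩, ⟨b2, by omega⟩⟩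
  rw [← heq]; exact Finset.inter_subset_left

theorem circ_side {C : Finset (Sym2 ℕ)} (hC : Circ C) {A B : Finset ℕ} {c d : ℕ} (hcd : c ≠ d)
    (hAB : A ∩ B = {c, d})
    (hcov : ∀ e ∈ C, e ∈ A.sym2 ∨ e ∈ B.sym2) {f g : Sym2 ℕ} (hf : f ∈ C) (hfB : f ∉ B.sym2)
    (hg : g ∈ C) (hgA : g ∉ A.sym2) : Circ (insert s(c, d) (C ∩ A.sym2)) := by
  obtain ⟨-, h2, h3, h4, h5⟩ := circ_cross hC (by rw [hAB]; exact Finset.card_le_two) hcov hf hfB hg hgA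
  have hcdC : s(c, d) ∉ C := by
    intro h
    unfold ii at h3
    rw [Finset.card_eq_zero] at h3
    have : s(c, d) ∈ C ∩ (A ∩ B).sym2 := Finset.mem_inter.2 ⟨h, by rw [hAB]; simp [Finset.mk_mem_sym2_iff]⟩
    rw [h3] at this
    simp at this
  have hcA : c ∈ vs C ∩ A := Finset.mem_inter.2 ⟨h2 (by simp [hAB]), by
    have : c ∈ A ∩ B := by simp [hAB]
    exact (Finset.mem_inter.1 this).1⟩
  have hdA : d ∈ vs C ∩ A := Finset.mem_inter.2 ⟨h2 (by simp [hAB]), by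
    have : d ∈ A ∩ B := by simp [hAB]
    exact (Finset.mem_inter.1 this).1⟩
  have hcB : c ∈ vs C ∩ B := Finset.mem_inter.2 ⟨h2 (by simp [hAB]), by
    have : c ∈ A ∩ B := by simp [hAB]
    exact (Finset.mem_inter.1 this).2⟩
  have hdB : d ∈ vs C ∩ B := Finset.mem_inter.2 ⟨h2 (by simp [hAB]), by
    have : d ∈ A ∩ B := by simp [hAB]
    exact (Finset.mem_inter.1 this).2⟩
  have hNA : Nd (C ∩ A.sym2) := hC.1.mono Finset.inter_subset_left
  have hdd : ¬ (s(c, d) : Sym2 ℕ).IsDiag := by simpa using hcd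
  have hcdA : s(c, d) ∉ C ∩ A.sym2 := fun h => hcdC (Finset.mem_inter.1 h).1
  have hsub : C ∩ A.sym2 ⊆ C.erase g := by
    intro e he
    rw [Finset.mem_inter] at he
    exact Finset.mem_erase.2 ⟨fun h => hgA (h ▸ he.2), he.1⟩
  refine ⟨hNA.insert hdd, ?_, ?_⟩
  · apply not_sparse_insert hcdA (T := vs C ∩ A)
    · refine ⟨h4.1, ?_⟩
      rw [← h4.2]
      unfold ii
      congr 2
      ext e
      simp only [Finset.mem_inter]
      constructor
      · tauto
      · rintro ⟨h, h'⟩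
        exact ⟨⟨h, Finset.sym2_mono Finset.inter_subset_right h'⟩, h'⟩
    · rw [Finset.mk_mem_sym2_iff]; exact ⟨hcA, hdA⟩
  · intro e he
    rw [Finset.mem_insert] at he
    by_cases hecd : e = s(c, d)
    · subst hecd
      rw [Finset.erase_insert hcdA]
      exact (hC.2.2 g hg).mono hsub
    have heCA : e ∈ C ∩ A.sym2 := he.resolve_left hecd
    rw [Finset.erase_insert_of_ne (Ne.symm hecd)]
    have hspe : Sparse ((C ∩ A.sym2).erase e) :=
      (hC.2.2 e (Finset.mem_inter.1 heCA).1).mono (Finset.erase_subset_erase _ Finset.inter_subset_left)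
    by_contra hns
    obtain ⟨T, hT, hcdT⟩ := sparse_insert_or hspe hdd hns
    rw [Finset.mk_mem_sym2_iff] at hcdT
    have hTv := tight_subset_vs hspe hT
    have hTA : T ⊆ A := by
      refine hTv.trans ?_
      rw [← subset_sym2_iff]
      exact (Finset.erase_subset _ _).trans Finset.inter_subset_right
    have hsC := hC.2.2 e (Finset.mem_inter.1 heCA).1
    have hT' : Tight (C.erase e) T := by
      refine ⟨hT.1, ?_⟩
      have h1 := hsC.2 T hT.1
      have h2 := hT.2
      have h3 := ii_mono_left (A := T) (Finset.erase_subset_erase e (Finset.inter_subset_left : C ∩ A.sym2 ⊆ C))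
      omega
    have heB : e ∉ (vs C ∩ B).sym2 := by
      intro h
      have : e ∈ C ∩ (A ∩ B).sym2 := by
        rw [← sym2_inter']
        rw [Finset.mem_inter] at heCA
        simp only [Finset.mem_inter]
        exact ⟨heCA.1, heCA.2, Finset.sym2_mono Finset.inter_subset_right h⟩
      unfold ii at h3
      rw [Finset.card_eq_zero] at h3
      rw [h3] at this
      simp at this
    have hTB : Tight (C.erase e) (vs C ∩ B) := ⟨h5.1, by rw [ii_erase_not heB]; exact h5.2⟩
    have hss : T ∩ (vs C ∩ B) = {c, d} := by
      apply Finset.Subset.antisymm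
      · rw [← hAB]
        intro v hv
        simp only [Finset.mem_inter] at hv ⊢
        exact ⟨hTA hv.1, hv.2.2⟩
      · intro v hv
        simp only [Finset.mem_insert, Finset.mem_singleton] at hv
        rcases hv with rfl | rfl
        · exact Finset.mem_inter.2 ⟨hcdT.1, hcB⟩
        · exact Finset.mem_inter.2 ⟨hcdT.2, hdB⟩
    have ht := (U1 (hsC.lsp _) subset_rfl hT' hTB (by rw [hss, Finset.card_pair hcd])).2.1
    rw [hss, ← hAB] at ht
    have h6 := ht.2
    have h7 := ii_mono_left (A := A ∩ B) (Finset.erase_subset e C)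
    rw [hAB, Finset.card_pair hcd] at h6
    rw [hAB] at h3 h7
    omega

theorem edge_eq_of_mem {c d : ℕ} {e : Sym2 ℕ} (hd : ¬ e.IsDiag) (h : e ∈ ({c, d} : Finset ℕ).sym2) :
    e = s(c, d) := by
  induction e with
  | _ x y =>
    simp only [Finset.mk_mem_sym2_iff, Finset.mem_insert, Finset.mem_singleton, Sym2.isDiag_iff_proj_eq] at h hd
    rcases h with ⟨rfl | rfl, rfl | rfl⟩
    · exact absurd rfl hd
    · rfl
    · exact Sym2.eq_swap
    · exact absurd rfl hd

theorem conn_side {E : Finset (Sym2 ℕ)} (hE : Conn E) {A B : Finset ℕ} {c d : ℕ} (hcd : c ≠ d)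
    (hAB : A ∩ B = {c, d})
    (hcov : ∀ e ∈ E, e ∈ A.sym2 ∨ e ∈ B.sym2) {f g : Sym2 ℕ} (hf : f ∈ E) (hfB : f ∉ B.sym2)
    (hg : g ∈ E) (hgA : g ∉ A.sym2) : Conn (insert s(c, d) (E ∩ A.sym2)) := by
  have hfA : f ∈ A.sym2 := (hcov f hf).resolve_right hfB
  have key : ∀ e ∈ E, e ∈ A.sym2 → e ≠ s(c, d) → ∃ K ⊆ insert s(c, d) (E ∩ A.sym2),
      Circ K ∧ e ∈ K ∧ s(c, d) ∈ K := by
    intro e he heA hecd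
    have heB : e ∉ B.sym2 := by
      intro h
      apply hecd
      apply edge_eq_of_mem (hE.1 e he)
      rw [← hAB, ← sym2_inter']
      exact Finset.mem_inter.2 ⟨heA, h⟩
    obtain ⟨C, hCE, hC, heC, hgC⟩ := hE.2 e he g hg (fun h => hgA (h ▸ heA))
    refine ⟨_, ?_, circ_side hC hcd hAB (fun e he => hcov e (hCE he)) heC heB hgC hgA, ?_, ?_⟩
    · exact Finset.insert_subset_insert _ (Finset.inter_subset_inter_right hCE)
    · simp [heC, heA]
    · simp
  have hfcd : f ≠ s(c, d) := by
    rintro rfl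
    apply hfB
    have : ({c, d} : Finset ℕ) ⊆ B := by rw [← hAB]; exact Finset.inter_subset_right
    exact Finset.sym2_mono this (by simp [Finset.mk_mem_sym2_iff])
  obtain ⟨K, hKE, hK, hfK, hcdK⟩ := key f hf hfA hfcd
  refine conn_of_hub hK.conn hKE ?_
  intro e he
  rw [Finset.mem_insert] at he
  by_cases hecd : e = s(c, d)
  · subst hecd
    exact ⟨K, hKE, hK.conn, hcdK, ⟨_, by rw [Finset.mem_inter]; exact ⟨hcdK, hcdK⟩⟩⟩
  have he' := Finset.mem_inter.1 (he.resolve_left hecd)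
  obtain ⟨K', h1, h2, h3, h4⟩ := key e he'.1 he'.2 hecd
  exact ⟨K', h1, h2.conn, h3, ⟨_, by rw [Finset.mem_inter]; exact ⟨h4, hcdK⟩⟩⟩

theorem conn_sep_card {E : Finset (Sym2 ℕ)} (hE : Conn E) {A B : Finset ℕ}
    (hAB : #(A ∩ B) ≤ 2)
    (hcov : ∀ e ∈ E, e ∈ A.sym2 ∨ e ∈ B.sym2) {f g : Sym2 ℕ} (hf : f ∈ E) (hfB : f ∉ B.sym2)
    (hg : g ∈ E) (hgA : g ∉ A.sym2) : #(A ∩ B) = 2 := by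
  have hfA : f ∈ A.sym2 := (hcov f hf).resolve_right hfB
  obtain ⟨C, hCE, hC, hfC, hgC⟩ := hE.2 f hf g hg (fun h => hgA (h ▸ hfA))
  exact (circ_cross hC hAB (fun e he => hcov e (hCE he)) hfC hfB hgC hgA).1

theorem vs_sep {C1 C2 : Finset (Sym2 ℕ)} {c d : ℕ} (hcd1 : s(c, d) ∈ C1) (hcd2 : s(c, d) ∈ C2)
    {V1 V2 : Finset ℕ} (h1 : vs C1 ⊆ V1) (h2 : vs C2 ⊆ V2) (hv : V1 ∩ V2 = {c, d}) :
    vs C1 ∩ vs C2 = {c, d} := by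
  apply Finset.Subset.antisymm
  · rw [← hv]; exact Finset.inter_subset_inter h1 h2
  · intro v hv
    simp only [Finset.mem_insert, Finset.mem_singleton] at hv
    rcases hv with rfl | rfl
    · exact Finset.mem_inter.2 ⟨mem_vs_left hcd1, mem_vs_left hcd2⟩
    · exact Finset.mem_inter.2 ⟨mem_vs_right hcd1, mem_vs_right hcd2⟩

theorem circ_two_sum {C1 C2 : Finset (Sym2 ℕ)} (h1 : Circ C1) (h2 : Circ C2) {c d : ℕ}
    (hcd1 : s(c, d) ∈ C1) (hcd2 : s(c, d) ∈ C2) (hv : vs C1 ∩ vs C2 = {c, d}) :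
    Circ ((C1 ∪ C2).erase s(c, d)) := by
  have hcd := h1.1.ne hcd1
  have key : ∀ {e : Sym2 ℕ}, e ∈ C1 → e ∈ C2 → e = s(c, d) := by
    intro e he1 he2
    apply edge_eq_of_mem (h1.1 e he1)
    rw [← hv, ← sym2_inter']
    exact Finset.mem_inter.2 ⟨mem_sym2_vs he1, mem_sym2_vs he2⟩
  obtain ⟨f, hf, hfe⟩ := Finset.exists_mem_ne (show 1 < #C1 by have := h1.four_le; omega) s(c, d)
  have hf2 : f ∉ C2 := fun h => hfe (key hf h)
  obtain ⟨D, hDs, hD, hfD⟩ := circ_elim h1 h2 hcd1 hcd2 hf hf2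
  have hDmem : ∀ e ∈ D, e ≠ s(c, d) ∧ (e ∈ C1 ∨ e ∈ C2) := by
    intro e he
    have := hDs he
    rwa [Finset.mem_erase, Finset.mem_union] at this
  have hnot1 : ∀ e ∈ C2, e ≠ s(c, d) → e ∉ (vs C1).sym2 := by
    intro e he hne h
    apply hne
    apply edge_eq_of_mem (h2.1 e he)
    rw [← hv, ← sym2_inter']
    exact Finset.mem_inter.2 ⟨h, mem_sym2_vs he⟩
  have hnot2 : ∀ e ∈ C1, e ≠ s(c, d) → e ∉ (vs C2).sym2 := by
    intro e he hne h
    apply hne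
    apply edge_eq_of_mem (h1.1 e he)
    rw [← hv, ← sym2_inter']
    exact Finset.mem_inter.2 ⟨mem_sym2_vs he, h⟩
  have hg : ∃ g ∈ D, g ∉ C1 := by
    by_contra! hcon
    have := h1.eq_of_subset hD hcon
    have h' : s(c, d) ∈ D := this ▸ hcd1
    exact (hDmem _ h').1 rfl
  obtain ⟨g, hgD, hgC1⟩ := hg
  have hg2 := hDmem g hgD
  have hcov : ∀ e ∈ D, e ∈ (vs C1).sym2 ∨ e ∈ (vs C2).sym2 := by
    intro e he
    rcases (hDmem e he).2 with h | h
    · left; exact mem_sym2_vs h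
    · right; exact mem_sym2_vs h
  have hfB := hnot2 f hf hfe
  have hgA := hnot1 g (hg2.2.resolve_left hgC1) hg2.1
  have k1 := circ_side hD hcd hv hcov hfD hfB hgD hgA
  have k2 := circ_side hD hcd (by rw [Finset.inter_comm]; exact hv) (fun e he => (hcov e he).symm) hgD hgA hfD hfB
  have e1 : insert s(c, d) (D ∩ (vs C1).sym2) = C1 := by
    apply h1.eq_of_subset k1
    intro e he
    rw [Finset.mem_insert, Finset.mem_inter] at he
    rcases he with rfl | ⟨he, he'⟩
    · exact hcd1
    · rcases (hDmem e he).2 with h | h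
      · exact h
      · exact absurd he' (hnot1 e h (hDmem e he).1)
  have e2 : insert s(c, d) (D ∩ (vs C2).sym2) = C2 := by
    apply h2.eq_of_subset k2
    intro e he
    rw [Finset.mem_insert, Finset.mem_inter] at he
    rcases he with rfl | ⟨he, he'⟩
    · exact hcd2
    · rcases (hDmem e he).2 with h | h
      · exact absurd he' (hnot2 e h (hDmem e he).1)
      · exact h
  have : (C1 ∪ C2).erase s(c, d) = D := by
    apply Finset.Subset.antisymm _ hDs
    intro e he
    rw [Finset.mem_erase, Finset.mem_union] at he
    rcases he with ⟨hne, he | he⟩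
    · rw [← e1, Finset.mem_insert, Finset.mem_inter] at he
      exact (he.resolve_left hne).1
    · rw [← e2, Finset.mem_insert, Finset.mem_inter] at he
      exact (he.resolve_left hne).1
  rwa [this]

theorem conn_two_sum {P Q : Finset (Sym2 ℕ)} (hP : Conn P) (hQ : Conn Q) {c d : ℕ}
    (hcdP : s(c, d) ∈ P) (hcdQ : s(c, d) ∈ Q) (hv : vs P ∩ vs Q = {c, d}) (h1 : 1 < #P) (h2 : 1 < #Q) :
    Conn ((P ∪ Q).erase s(c, d)) := by
  obtain ⟨e0, he0, hne0⟩ := Finset.exists_mem_ne h1 s(c, d)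
  obtain ⟨f0, hf0, hnf0⟩ := Finset.exists_mem_ne h2 s(c, d)
  have key : ∀ e ∈ P, e ≠ s(c, d) → ∀ f ∈ Q, f ≠ s(c, d) →
      ∃ C ⊆ (P ∪ Q).erase s(c, d), Circ C ∧ e ∈ C ∧ f ∈ C := by
    intro e he hne f hf hnf
    obtain ⟨C1, s1, c1, m1, m1'⟩ := hP.2 e he _ hcdP hne
    obtain ⟨C2, s2, c2, m2, m2'⟩ := hQ.2 f hf _ hcdQ hnf
    refine ⟨_, ?_, circ_two_sum c1 c2 m1' m2' (vs_sep m1' m2' (vs_mono s1) (vs_mono s2) hv), ?_, ?_⟩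
    · exact Finset.erase_subset_erase _ (Finset.union_subset_union s1 s2)
    · simp [hne, m1]
    · simp [hnf, m2]
  obtain ⟨K, hKs, hK, heK, hfK⟩ := key e0 he0 hne0 f0 hf0 hnf0
  refine conn_of_hub hK.conn hKs ?_
  intro e he
  rw [Finset.mem_erase, Finset.mem_union] at he
  rcases he with ⟨hne, he | he⟩
  · obtain ⟨C, a1, a2, a3, a4⟩ := key e he hne f0 hf0 hnf0
    exact ⟨C, a1, a2.conn, a3, f0, Finset.mem_inter.2 ⟨a4, hfK⟩⟩
  · obtain ⟨C, a1, a2, a3, a4⟩ := key e0 he0 hne0 e he hne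
    exact ⟨C, a1, a2.conn, a4, e0, Finset.mem_inter.2 ⟨a3, heK⟩⟩

open Finset

/-- neighbours -/
def nb (E : Finset (Sym2 ℕ)) (v : ℕ) : Finset ℕ := (vs E).filter (fun u => s(v, u) ∈ E)

theorem mem_nb {E : Finset (Sym2 ℕ)} {v u : ℕ} : u ∈ nb E v ↔ s(v, u) ∈ E := by
  unfold nb
  rw [Finset.mem_filter]
  exact ⟨fun h => h.2, fun h => ⟨mem_vs_right h, h⟩⟩

theorem nb_symm {E : Finset (Sym2 ℕ)} {v u : ℕ} : u ∈ nb E v ↔ v ∈ nb E u := by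
  rw [mem_nb, mem_nb, Sym2.eq_swap]

theorem filter_card {E : Finset (Sym2 ℕ)} (v : ℕ) (T : Finset ℕ) (hv : v ∈ T) :
    #(E.filter (fun e => v ∈ e ∧ e ∈ T.sym2)) = #(nb E v ∩ T) := by
  have : E.filter (fun e => v ∈ e ∧ e ∈ T.sym2) = (nb E v ∩ T).image (fun u => s(v, u)) := by
    ext e
    simp only [Finset.mem_filter, Finset.mem_image, Finset.mem_inter, mem_nb]
    constructor
    · rintro ⟨h1, h2, h3⟩
      obtain ⟨a, rfl⟩ := Sym2.mem_iff_exists.1 h2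
      exact ⟨a, ⟨h1, (Finset.mk_mem_sym2_iff.1 h3).2⟩, rfl⟩
    · rintro ⟨a, ⟨h1, h2⟩, rfl⟩
      exact ⟨h1, by simp, Finset.mk_mem_sym2_iff.2 ⟨hv, h2⟩⟩
  rw [this, Finset.card_image_of_injective]
  intro a b h
  simp only [Sym2.eq_iff] at h
  rcases h with ⟨_, h⟩ | ⟨h1, h2⟩
  · exact h
  · exact h2.trans h1

theorem ii_erase_nb {E : Finset (Sym2 ℕ)} {T : Finset ℕ} {v : ℕ} (hv : v ∈ T) :
    ii E (T.erase v) + #(nb E v ∩ T) = ii E T := by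
  rw [← ii_erase_add (E := E) (T := T) v, filter_card v T hv]

theorem ii_insert_nb {E : Finset (Sym2 ℕ)} (hN : Nd E) {T : Finset ℕ} {v : ℕ} (hv : v ∉ T) :
    ii E (insert v T) = ii E T + #(nb E v ∩ T) := by
  have h := ii_erase_nb (E := E) (T := insert v T) (v := v) (by simp)
  rw [Finset.erase_insert hv] at h
  rw [← h]
  congr 2
  ext u
  simp only [Finset.mem_inter, Finset.mem_insert]
  constructor
  · rintro ⟨h1, h2 | h2⟩
    · subst h2
      exact absurd rfl (hN.ne (mem_nb.1 h1))
    · exact ⟨h1, h2⟩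
  · tauto

theorem notMem_nb_self {E : Finset (Sym2 ℕ)} (hN : Nd E) (v : ℕ) : v ∉ nb E v := by
  intro h
  exact hN.ne (mem_nb.1 h) rfl

theorem handshake {E : Finset (Sym2 ℕ)} (hN : Nd E) (N : Finset ℕ) :
    ∑ u ∈ N, #(nb E u ∩ N) = 2 * ii E N := by
  induction N using Finset.induction_on with
  | empty => simp [ii]
  | insert v N hv ih =>
    rw [ii_insert_nb hN hv, Finset.sum_insert hv]
    have h1 : ∀ u ∈ N, #(nb E u ∩ insert v N) = #(nb E u ∩ N) + if u ∈ nb E v then 1 else 0 := by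
      intro u hu
      by_cases h : u ∈ nb E v
      · have h' : v ∈ nb E u := nb_symm.1 h
        rw [Finset.inter_insert_of_mem h', Finset.card_insert_of_notMem (by simp [hv])]
        simp [h]
      · have h' : v ∉ nb E u := fun h' => h (nb_symm.1 h')
        rw [Finset.inter_insert_of_notMem h']
        simp [h]
    rw [Finset.sum_congr rfl h1, Finset.sum_add_distrib, ih, Finset.sum_ite_mem,
      Finset.inter_insert_of_notMem (notMem_nb_self hN v)]
    simp only [Finset.sum_const, smul_eq_mul, mul_one]
    rw [Finset.inter_comm N]
    ring

theorem degsum {E : Finset (Sym2 ℕ)} (hN : Nd E) {V : Finset ℕ} (hV : vs E ⊆ V) (N : Finset ℕ) :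
    N ⊆ V → ∑ u ∈ N, #(nb E u) + ii E (V \ N) = #E + ii E N := by
  induction N using Finset.induction_on with
  | empty =>
    intro _
    have h0 : ii E ∅ = 0 := by simp [ii]
    rw [Finset.sum_empty, Finset.sdiff_empty, ii_of_vs_subset hV, h0]
    omega
  | insert v N hv ih =>
    intro hs
    have ih' := ih ((Finset.subset_insert v N).trans hs)
    have hvV : v ∈ V := hs (by simp)
    rw [ii_insert_nb hN hv, Finset.sum_insert hv]
    have h1 := ii_erase_nb (E := E) (T := V \ N) (v := v) (by simp [hv, hvV])
    have h2 : (V \ N).erase v = V \ insert v N := by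
      ext x; simp only [Finset.mem_erase, Finset.mem_sdiff, Finset.mem_insert]; tauto
    rw [h2] at h1
    have h3 : #(nb E v) = #(nb E v ∩ N) + #(nb E v ∩ (V \ N)) := by
      rw [← Finset.card_union_of_disjoint]
      · congr 1
        ext x
        simp only [Finset.mem_union, Finset.mem_inter, Finset.mem_sdiff]
        constructor
        · intro h
          have : x ∈ V := hV (mem_vs_right (mem_nb.1 h))
          tauto
        · tauto
      · rw [Finset.disjoint_left]
        intro x h1 h2
        simp only [Finset.mem_inter, Finset.mem_sdiff] at h1 h2
        tauto
    omega

structure Lobe (H : Finset (Sym2 ℕ)) (X Y : Finset ℕ) : Prop where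
  hN : Nd H
  disj : Disjoint X Y
  hV : vs H ⊆ X ∪ Y
  hX : Tight H X
  hL : #H + 2 = 2 * (#X + #Y)
  hsp : ∀ f ∈ H, f ∉ X.sym2 → Sparse (H.erase f)
  hdeg : ∀ v ∈ Y, 3 ≤ #(nb H v)
  h3c : ∀ u ∈ Y, ∀ w ∈ Y, ∀ c d, u ≠ w → ¬ (nb H u = {w, c, d} ∧ nb H w = {u, c, d})
  hY : 2 ≤ #Y

/-- T is a bad set for `w` -/
def Bad (H : Finset (Sym2 ℕ)) (X : Finset ℕ) (w x y : ℕ) (T : Finset ℕ) : Prop :=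
  Tight H T ∧ w ∉ T ∧ x ∈ T ∧ y ∈ T ∧ ∃ f ∈ H, f ∉ X.sym2 ∧ w ∉ f ∧ f ∉ T.sym2

def Good (H : Finset (Sym2 ℕ)) (X : Finset ℕ) (w x y : ℕ) : Prop :=
  s(w, x) ∈ H ∧ s(w, y) ∈ H ∧ x ≠ y ∧ ∀ T, ¬ Bad H X w x y T

namespace Lobe

variable {H : Finset (Sym2 ℕ)} {X Y : Finset ℕ}

theorem notX (h : Lobe H X Y) {w : ℕ} (hw : w ∈ Y) : w ∉ X := fun hx =>
  Finset.disjoint_left.1 h.disj hx hw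

theorem edge_notX (h : Lobe H X Y) {w : ℕ} (hw : w ∈ Y) {f : Sym2 ℕ} (hf : w ∈ f) : f ∉ X.sym2 :=
  fun h' => h.notX hw (Finset.mem_sym2_iff.1 h' w hf)

theorem exists_edge (h : Lobe H X Y) {w : ℕ} (hw : w ∈ Y) : ∃ u, s(w, u) ∈ H := by
  have := h.hdeg w hw
  obtain ⟨u, hu⟩ := Finset.card_pos.1 (show 0 < #(nb H w) by omega)
  exact ⟨u, mem_nb.1 hu⟩

theorem F1 (h : Lobe H X Y) {f : Sym2 ℕ} (hf : f ∈ H) (hfX : f ∉ X.sym2) {Z : Finset ℕ}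
    (hfZ : f ∉ Z.sym2) (hZ : 2 ≤ #Z) : ii H Z + 3 ≤ 2 * #Z := by
  have := (h.hsp f hf hfX).2 Z hZ
  rwa [ii_erase_not hfZ] at this

theorem lsp (h : Lobe H X Y) {w : ℕ} (hw : w ∈ Y) {U : Finset ℕ} (hwU : w ∉ U) : LSp H U := by
  intro Z hZU hZ
  obtain ⟨u, hu⟩ := h.exists_edge hw
  refine h.F1 hu (h.edge_notX hw (by simp)) ?_ hZ
  intro h'
  exact hwU (hZU (Finset.mk_mem_sym2_iff.1 h').1)

theorem F2 (h : Lobe H X Y) {Z : Finset ℕ} (hZ : 2 ≤ #Z) : ii H Z + 2 ≤ 2 * #Z := by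
  obtain ⟨w, hw⟩ := Finset.card_pos.1 (show 0 < #Y by have := h.hY; omega)
  obtain ⟨u, hu⟩ := h.exists_edge hw
  have h1 := (h.hsp _ hu (h.edge_notX hw (by simp))).2 Z hZ
  by_cases hm : s(w, u) ∈ Z.sym2
  · have := ii_erase_mem hu hm
    omega
  · rw [ii_erase_not hm] at h1
    omega

theorem cardV (h : Lobe H X Y) : #(X ∪ Y) = #X + #Y := Finset.card_union_of_disjoint h.disj

/-- edges meeting `N` -/
theorem F3 (h : Lobe H X Y) {N : Finset ℕ} (hN : N ⊆ Y) (hne : N.Nonempty) :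
    ii H ((X ∪ Y) \ N) + 2 * #N + 1 ≤ #H := by
  obtain ⟨w, hw⟩ := hne
  have hX2 := h.hX.1
  have hsub : X ⊆ (X ∪ Y) \ N := by
    intro x hx
    simp only [Finset.mem_sdiff, Finset.mem_union]
    exact ⟨Or.inl hx, fun hn => h.notX (hN hn) hx⟩
  have h1 := h.lsp (hN hw) (U := (X ∪ Y) \ N) (by simp [hw]) _ subset_rfl
    (hX2.trans (Finset.card_le_card hsub))
  have h2 := Finset.card_sdiff_add_card_eq_card (hN.trans (Finset.subset_union_right : Y ⊆ X ∪ Y))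
  have := h.cardV
  have := h.hL
  omega

/-- number of edges not inside X -/
theorem cardL (h : Lobe H X Y) : #(H \ X.sym2) = 2 * #Y + 1 := by
  have h1 := h.hX.2
  have h2 := h.hL
  unfold ii at h1
  have := Finset.card_inter_add_card_sdiff H X.sym2
  omega

theorem F4 (h : Lobe H X Y) {T : Finset ℕ} (hT : ∀ f ∈ H, f ∉ X.sym2 → f ∈ T.sym2) : 2 ≤ #(T ∩ X) := by
  have hsub : H \ X.sym2 ⊆ H ∩ (Y ∪ (T ∩ X)).sym2 := by
    intro f hf
    rw [Finset.mem_sdiff] at hf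
    rw [Finset.mem_inter]
    refine ⟨hf.1, ?_⟩
    rw [Finset.mem_sym2_iff]
    intro a ha
    have h1 : a ∈ T := Finset.mem_sym2_iff.1 (hT f hf.1 hf.2) a ha
    have h2 : a ∈ X ∪ Y := h.hV (mem_vs.2 ⟨f, hf.1, ha⟩)
    simp only [Finset.mem_union, Finset.mem_inter] at h2 ⊢
    tauto
  have h1 := Finset.card_le_card hsub
  rw [h.cardL] at h1
  have hY := h.hY
  have h2 := h.F2 (Z := Y ∪ (T ∩ X)) (hY.trans (Finset.card_le_card Finset.subset_union_left))
  unfold ii at h2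
  have := Finset.card_union_le Y (T ∩ X)
  omega

theorem F5 (h : Lobe H X Y) {w : ℕ} (hd : #(nb H w) = 3) {T : Finset ℕ} (hT : Tight H T)
    (hwT : w ∉ T) (hs : nb H w ⊆ T) : ∀ f ∈ H, f ∉ X.sym2 → f ∈ (insert w T).sym2 := by
  intro f hf hfX
  by_contra hcon
  have h1 := h.F1 hf hfX hcon (hT.1.trans (Finset.card_le_card (Finset.subset_insert _ _)))
  rw [ii_insert_nb h.hN hwT, Finset.inter_eq_left.2 hs, Finset.card_insert_of_notMem hwT] at h1
  have := hT.2
  omega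

theorem tight_bound (h : Lobe H X Y) {w : ℕ} (hw : w ∈ Y) {R T : Finset ℕ} (hd : #(nb H w) = 3)
    (hXR : X ⊆ R) (hR : Tight H R) (hwR : w ∉ R) (hT : Tight H T) (hwT : w ∉ T) (hs : nb H w ⊆ T) :
    2 ≤ #(T ∩ R) ∧ Tight H (T ∩ R) := by
  have h4 := h.F4 (h.F5 hd hT hwT hs)
  have e : insert w T ∩ X = T ∩ X := by
    rw [Finset.insert_inter_of_notMem (h.notX hw)]
  rw [e] at h4
  have h2 : 2 ≤ #(T ∩ R) := h4.trans (Finset.card_le_card (Finset.inter_subset_inter_left hXR))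
  exact ⟨h2, (U1 (h.lsp hw (U := T ∪ R) (by simp [hwT, hwR])) subset_rfl hT hR h2).2.1⟩

/-- the final contradiction -/
theorem final (h : Lobe H X Y) {w : ℕ} (hw : w ∈ Y) {R T : Finset ℕ} (hd : #(nb H w) = 3)
    (hXR : X ⊆ R) (hR : Tight H R) (hwR : w ∉ R) (hT : Tight H T) (hwT : w ∉ T) (hs : nb H w ⊆ T)
    {S : Finset ℕ} {b : ℕ} (hb : b ∈ nb H w) (hbS : b ∉ S) (hbR : b ∈ R ∨ #(S ∩ R) ≤ 1)
    (hcov : ∀ e ∈ H, e ∈ T.sym2 → e ∈ S.sym2 ∨ ∃ S', #(S' ∩ R) ≤ 1 ∧ e ∈ S'.sym2) : False := by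
  obtain ⟨h2, ht⟩ := h.tight_bound hw hd hXR hR hwR hT hwT hs
  have hsub : T ∩ R ⊆ S := by
    intro v hv
    obtain ⟨a, ha, hva⟩ := tight_one h.hN (h.lsp hw (U := T ∩ R) (by simp [hwT])) subset_rfl ht hv
    have hmem : s(v, a) ∈ (T ∩ R).sym2 := Finset.mk_mem_sym2_iff.2 ⟨hv, ha⟩
    rcases hcov _ hva (Finset.sym2_mono Finset.inter_subset_left hmem) with h' | ⟨S', h1, h'⟩
    · exact (Finset.mk_mem_sym2_iff.1 h').1
    · exfalso
      rw [Finset.mk_mem_sym2_iff] at h'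
      simp only [Finset.mem_inter] at hv ha
      exact h.hN.ne hva (Finset.card_le_one.1 h1 v (by simp [h'.1, hv.2]) a (by simp [h'.2, ha.2]))
  rcases hbR with hbR | hbR
  · exact hbS (hsub (Finset.mem_inter.2 ⟨hs hb, hbR⟩))
  · have : T ∩ R ⊆ S ∩ R := fun v hv => Finset.mem_inter.2 ⟨hsub hv, (Finset.mem_inter.1 hv).2⟩
    have := Finset.card_le_card this
    omega

/-- bad sets miss the third neighbour -/
theorem bad_notMem (h : Lobe H X Y) {w x y z : ℕ} (hd : #(nb H w) = 3)
    (hnb : nb H w = {x, y, z}) {T : Finset ℕ} (hT : Bad H X w x y T) : z ∉ T := by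
  intro hz
  obtain ⟨h1, h2, h3, h4, f, hf, hfX, hwf, hfT⟩ := hT
  have h5 := h.F5 hd h1 h2 (by rw [hnb]; intro v; simp only [Finset.mem_insert, Finset.mem_singleton]; rintro (rfl | rfl | rfl) <;> assumption) f hf hfX
  apply hfT
  rw [Finset.mem_sym2_iff] at h5 ⊢
  intro a ha
  have := h5 a ha
  rw [Finset.mem_insert] at this
  rcases this with rfl | h'
  · exact absurd ha hwf
  · exact h'

end Lobe

open Finset

def Pe (H : Finset (Sym2 ℕ)) (X R : Finset ℕ) (w a : ℕ) : Prop :=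
  ∀ x y T, x ≠ y → x ∈ nb H w → y ∈ nb H w → x ≠ a → y ≠ a → Bad H X w x y T → a ∉ T → #(T ∩ R) ≤ 1

theorem Bad.symm {H : Finset (Sym2 ℕ)} {X : Finset ℕ} {w x y : ℕ} {T : Finset ℕ} (h : Bad H X w x y T) :
    Bad H X w y x T := ⟨h.1, h.2.1, h.2.2.2.1, h.2.2.1, h.2.2.2.2⟩

theorem Good.symm {H : Finset (Sym2 ℕ)} {X : Finset ℕ} {w x y : ℕ} (h : Good H X w x y) :
    Good H X w y x := ⟨h.2.1, h.1, h.2.2.1.symm, fun T hT => h.2.2.2 T hT.symm⟩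

/-- data for the low-vertex analysis -/
structure LowCtx (H : Finset (Sym2 ℕ)) (X Y R F : Finset ℕ) (w : ℕ) : Prop where
  lobe : Lobe H X Y
  hw : w ∈ Y
  hd : #(nb H w) = 3
  hXR : X ⊆ R
  hR : Tight H R
  hwR : w ∉ R
  hF : F ⊆ Y
  hFd : ∀ u ∈ F, #(nb H u) = 3
  p1 : ∀ a ∈ nb H w, a ∉ F → a ∈ R ∨ Pe H X R w a
  p2 : ∀ a ∈ nb H w, ∀ b ∈ nb H w, a ∉ F → b ∉ F → a ≠ b → Pe H X R w a ∨ Pe H X R w b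

namespace LowCtx

variable {H : Finset (Sym2 ℕ)} {X Y R F : Finset ℕ} {w : ℕ}

theorem small_or (h : LowCtx H X Y R F w) {a x y : ℕ} {T : Finset ℕ} (hnb : nb H w = {x, y, a})
    (hxy : x ≠ y) (hxa : x ≠ a) (hya : y ≠ a) (haF : a ∉ F) (hT : Bad H X w x y T) :
    a ∈ R ∨ #(T ∩ R) ≤ 1 := by
  rcases h.p1 a (by simp [hnb]) haF with h1 | h1
  · exact Or.inl h1
  · exact Or.inr (h1 x y T hxy (by simp [hnb]) (by simp [hnb]) hxa hya hT (h.lobe.bad_notMem h.hd hnb hT))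

theorem pair_aux (h : LowCtx H X Y R F w) {a b u : ℕ} {Ta Tb : Finset ℕ} (hnb : nb H w = {u, a, b})
    (hab : a ≠ b) (hua : u ≠ a) (hub : u ≠ b) (haF : a ∉ F) (hTa : Bad H X w u b Ta)
    (hTb : Bad H X w u a Tb) (h2 : 2 ≤ #(Ta ∩ Tb)) (hPb : Pe H X R w b) : False := by
  have hnb' : nb H w = {u, b, a} := by rw [hnb]; ext; simp; tauto
  have haT := h.lobe.bad_notMem h.hd hnb' hTa
  have hbT := h.lobe.bad_notMem h.hd hnb hTb
  have hU := U1 (h.lobe.lsp h.hw (U := Ta ∪ Tb) (by simp [hTa.2.1, hTb.2.1])) subset_rfl hTa.1 hTb.1 h2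
  refine h.lobe.final h.hw h.hd h.hXR h.hR h.hwR hU.1 (by simp [hTa.2.1, hTb.2.1]) ?_ (S := Ta) (b := a)
    (by simp [hnb]) haT (h.small_or hnb' hub hua hab.symm haF hTa) ?_
  · rw [hnb]
    intro v
    simp only [Finset.mem_insert, Finset.mem_singleton, Finset.mem_union]
    rintro (rfl | rfl | rfl)
    · exact Or.inl hTa.2.2.1
    · exact Or.inr hTb.2.2.2.1
    · exact Or.inl hTa.2.2.2.1
  · intro e he heT
    rcases hU.2.2 e he heT with h' | h'
    · exact Or.inl h'
    · exact Or.inr ⟨Tb, hPb u a Tb hua (by simp [hnb]) (by simp [hnb]) hub hab hTb hbT, h'⟩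

theorem pair (h : LowCtx H X Y R F w) {a b u : ℕ} {Ta Tb : Finset ℕ} (hnb : nb H w = {u, a, b})
    (hab : a ≠ b) (hua : u ≠ a) (hub : u ≠ b) (haF : a ∉ F) (hbF : b ∉ F) (hTa : Bad H X w u b Ta)
    (hTb : Bad H X w u a Tb) (h2 : 2 ≤ #(Ta ∩ Tb)) : False := by
  have hnb' : nb H w = {u, b, a} := by rw [hnb]; ext; simp; tauto
  rcases h.p2 a (by simp [hnb]) b (by simp [hnb]) haF hbF hab with h' | h'
  · rw [Finset.inter_comm] at h2
    exact h.pair_aux hnb' hab.symm hub hua hbF hTb hTa h2 h'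
  · exact h.pair_aux hnb hab hua hub haF hTa hTb h2 h'

theorem zero_aux (h : LowCtx H X Y R F w) {a b c : ℕ} {Ta Tb Tc : Finset ℕ} (hnb : nb H w = {a, b, c})
    (hab : a ≠ b) (hac : a ≠ c) (hbc : b ≠ c) (hc : c ∉ F)
    (hTa : Bad H X w b c Ta) (hTb : Bad H X w a c Tb) (hTc : Bad H X w a b Tc)
    (hPa : Pe H X R w a) (hPb : Pe H X R w b) : False := by
  have hnba : nb H w = {b, c, a} := by rw [hnb]; ext; simp; tauto
  have hnbb : nb H w = {a, c, b} := by rw [hnb]; ext; simp; tauto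
  have haT := h.lobe.bad_notMem h.hd hnba hTa
  have hbT := h.lobe.bad_notMem h.hd hnbb hTb
  have hcT := h.lobe.bad_notMem h.hd hnb hTc
  have hwU : w ∉ Ta ∪ Tb ∪ Tc := by simp [hTa.2.1, hTb.2.1, hTc.2.1]
  have hU := U2 (T1 := Ta) (T2 := Tb) (T3 := Tc) (w1 := a) (w2 := b) (w3 := c) h.lobe.hN (h.lobe.lsp h.hw hwU) subset_rfl hTa.1 hTb.1 hTc.1
    (by simp [hTa.2.2.2.1, hTb.2.2.2.1]) (by simp [hTb.2.2.1, hTc.2.2.1]) (by simp [hTa.2.2.1, hTc.2.2.2.1])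
    hab hac hbc
  refine h.lobe.final h.hw h.hd h.hXR h.hR h.hwR hU.1 hwU ?_ (S := Tc) (b := c)
    (by simp [hnb]) hcT (h.small_or hnb hab hac hbc hc hTc) ?_
  · rw [hnb]
    intro v
    simp only [Finset.mem_insert, Finset.mem_singleton, Finset.mem_union]
    rintro (rfl | rfl | rfl)
    · exact Or.inr hTc.2.2.1
    · exact Or.inr hTc.2.2.2.1
    · exact Or.inl (Or.inl hTa.2.2.2.1)
  · intro e he heT
    rcases hU.2 e he heT with h' | h' | h'
    · exact Or.inr ⟨Ta, hPa b c Ta hbc (by simp [hnb]) (by simp [hnb]) hab.symm hac.symm hTa haT, h'⟩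
    · exact Or.inr ⟨Tb, hPb a c Tb hac (by simp [hnb]) (by simp [hnb]) hab hbc.symm hTb hbT, h'⟩
    · exact Or.inl h'

theorem zero (h : LowCtx H X Y R F w) {a b c : ℕ} {Ta Tb Tc : Finset ℕ} (hnb : nb H w = {a, b, c})
    (hab : a ≠ b) (hac : a ≠ c) (hbc : b ≠ c) (ha : a ∉ F) (hb : b ∉ F) (hc : c ∉ F)
    (hTa : Bad H X w b c Ta) (hTb : Bad H X w a c Tb) (hTc : Bad H X w a b Tc) : False := by
  have hnba : nb H w = {b, c, a} := by rw [hnb]; ext; simp; tauto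
  have hnbb : nb H w = {a, c, b} := by rw [hnb]; ext; simp; tauto
  have q1 := h.p2 a (by simp [hnb]) b (by simp [hnb]) ha hb hab
  have q2 := h.p2 a (by simp [hnb]) c (by simp [hnb]) ha hc hac
  have q3 := h.p2 b (by simp [hnb]) c (by simp [hnb]) hb hc hbc
  have : (Pe H X R w a ∧ Pe H X R w b) ∨ (Pe H X R w a ∧ Pe H X R w c) ∨
    (Pe H X R w b ∧ Pe H X R w c) := by tauto
  rcases this with ⟨h1, h2⟩ | ⟨h1, h2⟩ | ⟨h1, h2⟩
  · exact h.zero_aux hnb hab hac hbc hc hTa hTb hTc h1 h2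
  · exact h.zero_aux hnbb hac hab hbc.symm hb hTa.symm hTc hTb h1 h2
  · exact h.zero_aux hnba hbc hab.symm hac.symm ha hTb.symm hTc.symm hTa h1 h2

/-- if u is a degree three neighbour of `w` inside a bad set not adjacent to the other element -/
theorem nbrs_in (h : LowCtx H X Y R F w) {u a : ℕ} {T : Finset ℕ} (huw : w ∈ nb H u) (hu3 : #(nb H u) = 3)
    (hua : u ≠ a) (hT : Bad H X w u a T) (hna : a ∉ nb H u) : ∀ p ∈ nb H u, p ≠ w → p ∈ T := by
  have hsp := h.lobe.lsp h.hw hT.2.1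
  have h3 : 3 ≤ #T := by
    by_contra hlt
    have h2 : #T = 2 := by have := hT.1.1; omega
    have hsub : ({u, a} : Finset ℕ) = T := by
      apply Finset.eq_of_subset_of_card_le
      · intro v
        simp only [Finset.mem_insert, Finset.mem_singleton]
        rintro (rfl | rfl)
        · exact hT.2.2.1
        · exact hT.2.2.2.1
      · rw [Finset.card_pair hua]; omega
    obtain ⟨b, hb, hub⟩ := tight_one h.lobe.hN hsp subset_rfl hT.1 hT.2.2.1
    rw [← hsub] at hb
    simp only [Finset.mem_insert, Finset.mem_singleton] at hb
    rcases hb with rfl | rfl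
    · exact h.lobe.hN.ne hub rfl
    · exact hna (mem_nb.2 hub)
  obtain ⟨p, hp, q, hq, hpq, hup, huq⟩ := tight_two h.lobe.hN hsp subset_rfl hT.1 h3 hT.2.2.1
  have hpw : p ≠ w := by rintro rfl; exact hT.2.1 hp
  have hqw : q ≠ w := by rintro rfl; exact hT.2.1 hq
  have hs : ({w, p, q} : Finset ℕ) = nb H u := by
    apply Finset.eq_of_subset_of_card_le
    · intro v
      simp only [Finset.mem_insert, Finset.mem_singleton]
      rintro (rfl | rfl | rfl)
      · exact huw
      · exact mem_nb.2 hup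
      · exact mem_nb.2 huq
    · rw [hu3, Finset.card_eq_three.2 ⟨w, p, q, hpw.symm, hqw.symm, hpq, rfl⟩]
  intro r hr hrw
  rw [← hs] at hr
  simp only [Finset.mem_insert, Finset.mem_singleton] at hr
  rcases hr with rfl | rfl | rfl
  · exact absurd rfl hrw
  · exact hp
  · exact hq

theorem one (h : LowCtx H X Y R F w) {a b u : ℕ} {Ta Tb : Finset ℕ} (hnb : nb H w = {u, a, b})
    (hab : a ≠ b) (hua : u ≠ a) (hub : u ≠ b) (huF : u ∈ F) (haF : a ∉ F) (hbF : b ∉ F)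
    (hTa : Bad H X w u b Ta) (hTb : Bad H X w u a Tb) : False := by
  have hnb' : nb H w = {u, b, a} := by rw [hnb]; ext; simp; tauto
  have haT := h.lobe.bad_notMem h.hd hnb' hTa
  have hbT := h.lobe.bad_notMem h.hd hnb hTb
  have hwu : w ∈ nb H u := nb_symm.1 (by simp [hnb])
  have hu3 := h.hFd u huF
  have hwn := notMem_nb_self h.lobe.hN w
  have haw : a ≠ w := by rintro rfl; apply hwn; simp [hnb]
  have hbw : b ≠ w := by rintro rfl; apply hwn; simp [hnb]
  have huw : u ≠ w := by rintro rfl; apply hwn; simp [hnb]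
  by_cases h1 : a ∈ nb H u
  · by_cases h2 : b ∈ nb H u
    · have e : nb H u = {w, a, b} := by
        symm
        apply Finset.eq_of_subset_of_card_le
        · intro v
          simp only [Finset.mem_insert, Finset.mem_singleton]
          rintro (rfl | rfl | rfl) <;> assumption
        · rw [hu3, Finset.card_eq_three.2 ⟨w, a, b, haw.symm, hbw.symm, hab, rfl⟩]
      exact h.lobe.h3c u (h.hF huF) w h.hw a b huw ⟨e, hnb⟩
    · exact haT (h.nbrs_in hwu hu3 hub hTa h2 a h1 haw)
  · by_cases h2 : b ∈ nb H u
    · exact hbT (h.nbrs_in hwu hu3 hua hTb h1 b h2 hbw)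
    · have hN1 := h.nbrs_in hwu hu3 hub hTa h2
      have hN2 := h.nbrs_in hwu hu3 hua hTb h1
      have : ∃ p ∈ nb H u, p ≠ w := Finset.exists_mem_ne (by omega) w
      obtain ⟨p, hp, hpw⟩ := this
      refine h.pair hnb hab hua hub haF hbF hTa hTb ?_
      have hup : u ≠ p := by rintro rfl; exact notMem_nb_self h.lobe.hN u hp
      rw [← Finset.card_pair hup]
      apply Finset.card_le_card
      intro v
      simp only [Finset.mem_insert, Finset.mem_singleton, Finset.mem_inter]
      rintro (rfl | rfl)
      · exact ⟨hTa.2.2.1, hTb.2.2.1⟩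
      · exact ⟨hN1 _ hp hpw, hN2 _ hp hpw⟩

theorem good_of_not {x y : ℕ} (hx : x ∈ nb H w) (hy : y ∈ nb H w) (hxy : x ≠ y)
    (h : ¬ Good H X w x y) : ∃ T, Bad H X w x y T := by
  by_contra hc
  push Not at hc
  exact h ⟨mem_nb.1 hx, mem_nb.1 hy, hxy, hc⟩

theorem low (h : LowCtx H X Y R F w) (hlow : #(nb H w ∩ F) ≤ 1) :
    ∃ x y, Good H X w x y ∧ ∀ u ∈ nb H w, u ∈ F → u = x ∨ u = y := by
  obtain ⟨a, b, c, hab, hac, hbc, hnb⟩ := Finset.card_eq_three.1 h.hd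
  have key : ∀ a b u, nb H w = {u, a, b} → a ≠ b → u ≠ a → u ≠ b → u ∈ F →
      ∃ x y, Good H X w x y ∧ ∀ u ∈ nb H w, u ∈ F → u = x ∨ u = y := by
    intro a b u hnb hab hua hub huF
    have huniq : ∀ v ∈ nb H w, v ∈ F → v = u := by
      intro v hv hvF
      exact Finset.card_le_one.1 hlow v (by simp [hv, hvF]) u (by simp [hnb, huF])
    have haF : a ∉ F := fun h' => hua (huniq a (by simp [hnb]) h').symm
    have hbF : b ∉ F := fun h' => hub (huniq b (by simp [hnb]) h').symm
    by_contra hcon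
    push Not at hcon
    have g1 : ¬ Good H X w u b := fun hg => by
      obtain ⟨v, hv, hvF, h1, _⟩ := hcon u b hg
      exact h1 (huniq v hv hvF)
    have g2 : ¬ Good H X w u a := fun hg => by
      obtain ⟨v, hv, hvF, h1, _⟩ := hcon u a hg
      exact h1 (huniq v hv hvF)
    obtain ⟨Ta, hTa⟩ := good_of_not (by simp [hnb]) (by simp [hnb]) hub g1
    obtain ⟨Tb, hTb⟩ := good_of_not (by simp [hnb]) (by simp [hnb]) hua g2
    exact h.one hnb hab hua hub huF haF hbF hTa hTb
  by_cases ha : a ∈ F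
  · exact key b c a hnb hbc hab hac ha
  by_cases hb : b ∈ F
  · exact key a c b (by rw [hnb]; ext; simp; tauto) hac hab.symm hbc hb
  by_cases hc : c ∈ F
  · exact key a b c (by rw [hnb]; ext; simp; tauto) hab hac.symm hbc.symm hc
  have hno : ∀ x y, ∀ u ∈ nb H w, u ∈ F → u = x ∨ u = y := by
    intro x y u hu huF
    rw [hnb] at hu
    simp only [Finset.mem_insert, Finset.mem_singleton] at hu
    rcases hu with rfl | rfl | rfl <;> contradiction
  by_contra hcon
  push Not at hcon
  have gg : ∀ x y, x ∈ nb H w → y ∈ nb H w → x ≠ y → ∃ T, Bad H X w x y T := by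
    intro x y hx hy hxy
    refine good_of_not hx hy hxy fun hg => ?_
    obtain ⟨v, hv, hvF, h1, h2⟩ := hcon x y hg
    rcases hno x y v hv hvF with h' | h' <;> contradiction
  obtain ⟨Ta, hTa⟩ := gg b c (by simp [hnb]) (by simp [hnb]) hbc
  obtain ⟨Tb, hTb⟩ := gg a c (by simp [hnb]) (by simp [hnb]) hac
  obtain ⟨Tc, hTc⟩ := gg a b (by simp [hnb]) (by simp [hnb]) hab
  exact h.zero hnb hab hac hbc ha hb hc hTa hTb hTc

end LowCtx

open Finset

namespace Lobe

variable {H : Finset (Sym2 ℕ)} {X Y : Finset ℕ}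

theorem ii_nodes (h : Lobe H X Y) {N : Finset ℕ} (hN : N ⊆ Y) (h3 : ∀ u ∈ N, #(nb H u) = 3)
    (hne : N.Nonempty) : ii H N + 1 ≤ #N := by
  have h1 := degsum h.hN h.hV N (hN.trans Finset.subset_union_right)
  have h2 := h.F3 hN hne
  rw [Finset.sum_congr rfl h3, Finset.sum_const, smul_eq_mul] at h1
  omega

theorem two_low (h : Lobe H X Y) {F : Finset ℕ} (hF : F ⊆ Y) (h3 : ∀ u ∈ F, #(nb H u) = 3)
    (h2 : 2 ≤ #F) : ∃ w1 ∈ F, ∃ w2 ∈ F, w1 ≠ w2 ∧ #(nb H w1 ∩ F) ≤ 1 ∧ #(nb H w2 ∩ F) ≤ 1 := by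
  have hF0 : F.Nonempty := Finset.card_pos.1 (by omega)
  have e1 : ∃ v ∈ F, #(nb H v ∩ F) ≤ 1 := by
    by_contra! hcon
    have := h.ii_nodes hF h3 hF0
    have hs := handshake h.hN F
    have : ∑ u ∈ F, 2 ≤ ∑ u ∈ F, #(nb H u ∩ F) := Finset.sum_le_sum fun u hu => hcon u hu
    rw [Finset.sum_const, smul_eq_mul] at this
    omega
  obtain ⟨v, hv, hvl⟩ := e1
  by_contra! hcon
  have hc := Finset.card_erase_add_one hv
  have hNe : (F.erase v).Nonempty := Finset.card_pos.1 (by omega)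
  have hi := h.ii_nodes ((Finset.erase_subset v F).trans hF) (fun u hu => h3 u (Finset.mem_of_mem_erase hu)) hNe
  have hs := handshake h.hN (F.erase v)
  have hle : ∑ u ∈ F.erase v, 2 ≤ ∑ u ∈ F.erase v, (#(nb H u ∩ F.erase v) + if u ∈ nb H v then 1 else 0) := by
    apply Finset.sum_le_sum
    intro u hu
    have hu' := Finset.mem_erase.1 hu
    have h1 := hcon v hv u hu'.2 hu'.1.symm hvl
    have h4 : nb H u ∩ F.erase v = (nb H u ∩ F).erase v := by rw [Finset.inter_erase]
    rw [h4]
    by_cases hm : u ∈ nb H v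
    · have := Finset.pred_card_le_card_erase (s := nb H u ∩ F) (a := v)
      simp only [hm, if_true]
      omega
    · rw [Finset.erase_eq_of_notMem]
      · omega
      · intro h'
        exact hm (nb_symm.1 (Finset.mem_inter.1 h').1)
  rw [Finset.sum_add_distrib, Finset.sum_ite_mem] at hle
  simp only [Finset.sum_const, smul_eq_mul, mul_one] at hle
  have h5 : #(F.erase v ∩ nb H v) ≤ 1 := by
    refine le_trans (Finset.card_le_card ?_) hvl
    intro x hx
    simp only [Finset.mem_inter, Finset.mem_erase] at hx ⊢
    tauto
  omega

theorem ctx_all (h : Lobe H X Y) (hall : ∀ u ∈ Y, #(nb H u) = 3) {w : ℕ} (hw : w ∈ Y) :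
    LowCtx H X Y X Y w := by
  have hX : ∀ a ∈ nb H w, a ∉ Y → a ∈ X := by
    intro a ha haY
    have := h.hV (mem_vs_right (mem_nb.1 ha))
    rw [Finset.mem_union] at this
    tauto
  have hPe : ∀ a ∈ nb H w, a ∉ Y → Pe H X X w a := by
    intro a ha haY x y T hxy hx hy hxa hya hT haT
    by_contra! hcon
    have haX := hX a ha haY
    have hwU : w ∉ T ∪ X := by simp [hT.2.1, h.notX hw]
    have hU := U1 (h.lsp hw hwU) subset_rfl hT.1 h.hX hcon
    have hnb : ({x, y, a} : Finset ℕ) = nb H w := by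
      apply Finset.eq_of_subset_of_card_le
      · intro v
        simp only [Finset.mem_insert, Finset.mem_singleton]
        rintro (rfl | rfl | rfl) <;> assumption
      · rw [hall w hw, Finset.card_eq_three.2 ⟨x, y, a, hxy, hxa, hya, rfl⟩]
    obtain ⟨hT1, hT2, hT3, hT4, f, hf, hfX, hwf, hfT⟩ := hT
    have h5 := h.F5 (hall w hw) hU.1 hwU (by
      rw [← hnb]
      intro v
      simp only [Finset.mem_insert, Finset.mem_singleton, Finset.mem_union]
      rintro (rfl | rfl | rfl) <;> tauto) f hf hfX
    have h6 : f ∈ (T ∪ X).sym2 := by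
      rw [Finset.mem_sym2_iff] at h5 ⊢
      intro b hbf
      have := h5 b hbf
      rw [Finset.mem_insert] at this
      rcases this with rfl | h'
      · exact absurd hbf hwf
      · exact h'
    rcases hU.2.2 f hf h6 with h' | h' <;> contradiction
  exact ⟨h, hw, hall w hw, subset_rfl, h.hX, h.notX hw, subset_rfl, hall,
    fun a ha haY => Or.inl (hX a ha haY), fun a ha b _ haY _ _ => Or.inl (hPe a ha haY)⟩

theorem exists_ctx (h : Lobe H X Y) : ∃ R F, F ⊆ Y ∧ (∀ u ∈ F, #(nb H u) = 3) ∧ 2 ≤ #F ∧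
    ∀ w ∈ F, LowCtx H X Y R F w := by
  classical
  by_cases hall : ∀ u ∈ Y, #(nb H u) = 3
  · exact ⟨X, Y, subset_rfl, hall, h.hY, fun w hw => h.ctx_all hall hw⟩
  push Not at hall
  obtain ⟨v1, hv1, hd1⟩ := hall
  set fam := (X ∪ Y).powerset.filter (fun R => X ⊆ R ∧ Tight H R ∧ ∃ v ∈ Y, v ∉ R ∧ #(nb H v) ≠ 3) with hfam
  have hXf : X ∈ fam := by
    rw [hfam, Finset.mem_filter, Finset.mem_powerset]
    exact ⟨Finset.subset_union_left, subset_rfl, h.hX, v1, hv1, h.notX hv1, hd1⟩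
  obtain ⟨R, hRf, hmax⟩ := Finset.exists_max_image fam (fun R => #R) ⟨X, hXf⟩
  have hRf' := hRf
  rw [hfam, Finset.mem_filter, Finset.mem_powerset] at hRf'
  obtain ⟨hRV, hXR, hR, v0, hv0Y, hv0R, hv0⟩ := hRf'
  have hmax' : ∀ R', Tight H R' → R ⊆ R' → R' ⊆ X ∪ Y → (∃ v ∈ Y, v ∉ R' ∧ #(nb H v) ≠ 3) → R' = R := by
    intro R' h1 h2 h3 h4
    symm
    apply Finset.eq_of_subset_of_card_le h2
    apply hmax
    rw [hfam, Finset.mem_filter, Finset.mem_powerset]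
    exact ⟨h3, hXR.trans h2, h1, h4⟩
  set F := (Y \ R).filter (fun u => #(nb H u) = 3) with hFdef
  have hF : ∀ u, u ∈ F ↔ u ∈ Y ∧ u ∉ R ∧ #(nb H u) = 3 := by
    intro u
    rw [hFdef, Finset.mem_filter, Finset.mem_sdiff]; tauto
  have hle1 : ∀ w ∈ F, #(nb H w ∩ R) ≤ 1 := by
    intro w hw
    obtain ⟨hwY, hwR, hw3⟩ := (hF w).1 hw
    by_contra! hcon
    have hne : v0 ≠ w := by rintro rfl; exact hv0 hw3
    have hv0i : v0 ∉ insert w R := by simp [hne, hv0R]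
    have h1 := ii_insert_nb h.hN hwR
    have h2 := h.lsp hv0Y hv0i _ subset_rfl (hR.1.trans (Finset.card_le_card (Finset.subset_insert _ _)))
    have h3 := hR.2
    have h4 := Finset.card_insert_of_notMem hwR
    have ht : Tight H (insert w R) := ⟨by have := hR.1; omega, by omega⟩
    have := hmax' _ ht (Finset.subset_insert _ _)
      (Finset.insert_subset (Finset.mem_union_right _ hwY) hRV) ⟨v0, hv0Y, hv0i, hv0⟩
    rw [this] at h4
    omega
  have hPe : ∀ w ∈ F, ∀ a ∈ nb H w, a ∉ F → a ∉ R → Pe H X R w a := by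
    intro w hw a ha haF haR x y T hxy hx hy hxa hya hT haT
    obtain ⟨hwY, hwR, hw3⟩ := (hF w).1 hw
    by_contra! hcon
    have haY : a ∈ Y := by
      have := h.hV (mem_vs_right (mem_nb.1 ha))
      rw [Finset.mem_union] at this
      rcases this with h' | h'
      · exact absurd (hXR h') haR
      · exact h'
    have ha3 : #(nb H a) ≠ 3 := fun h' => haF ((hF a).2 ⟨haY, haR, h'⟩)
    have haU : a ∉ T ∪ R := by simp [haT, haR]
    have hsp := h.lsp haY haU
    have hU := U1 hsp subset_rfl hT.1 hR hcon
    have hTV : T ⊆ X ∪ Y := by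
      intro v hv
      obtain ⟨b, hb, hvb⟩ := tight_one h.hN hsp Finset.subset_union_left hT.1 hv
      exact h.hV (mem_vs_left hvb)
    have e := hmax' _ hU.1 Finset.subset_union_right (Finset.union_subset hTV hRV) ⟨a, haY, haU, ha3⟩
    have hTR : T ⊆ R := by rw [← e]; exact Finset.subset_union_left
    have := Finset.card_le_one.1 (hle1 w hw) x (by simp [hx, hTR hT.2.2.1]) y (by simp [hy, hTR hT.2.2.2.1])
    exact hxy this
  have hFY : F ⊆ Y := fun u hu => ((hF u).1 hu).1
  have hF3 : ∀ u ∈ F, #(nb H u) = 3 := fun u hu => ((hF u).1 hu).2.2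
  refine ⟨R, F, hFY, hF3, ?_, ?_⟩
  · set W := Y \ R with hW
    have hWY : W ⊆ Y := Finset.sdiff_subset
    have hv0W : v0 ∈ W := by rw [hW, Finset.mem_sdiff]; exact ⟨hv0Y, hv0R⟩
    have hVW : (X ∪ Y) \ W = R := by
      ext u
      simp only [hW, Finset.mem_sdiff, Finset.mem_union]
      constructor
      · rintro ⟨h1 | h1, h2⟩
        · exact hXR h1
        · tauto
      · intro hu
        have := hRV hu
        rw [Finset.mem_union] at this
        tauto
    have hds := degsum h.hN h.hV W (hWY.trans Finset.subset_union_right)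
    rw [hVW] at hds
    have hc := Finset.card_sdiff_add_card_eq_card (hWY.trans (Finset.subset_union_right : Y ⊆ X ∪ Y))
    rw [hVW, h.cardV] at hc
    have hR2 := hR.2
    have hL := h.hL
    have hlow : ∑ u ∈ W, 4 ≤ ∑ u ∈ W, (#(nb H u) + if u ∈ F then 1 else 0) := by
      apply Finset.sum_le_sum
      intro u hu
      have h3 := h.hdeg u (hWY hu)
      by_cases huF : u ∈ F
      · simp only [huF, if_true]; omega
      · simp only [huF, if_false]
        have : #(nb H u) ≠ 3 := fun h' => huF (by rw [hFdef, Finset.mem_filter]; exact ⟨hu, h'⟩)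
        omega
    rw [Finset.sum_add_distrib, Finset.sum_ite_mem] at hlow
    simp only [Finset.sum_const, smul_eq_mul, mul_one] at hlow
    have hWF : #(W ∩ F) ≤ #F := Finset.card_le_card Finset.inter_subset_right
    by_cases hW2 : 2 ≤ #W
    · have : ∃ f ∈ H, f ∉ X.sym2 ∧ f ∉ W.sym2 := by
        by_contra! hcon
        have hs : H \ X.sym2 ⊆ H ∩ W.sym2 := by
          intro f hf
          rw [Finset.mem_sdiff] at hf
          exact Finset.mem_inter.2 ⟨hf.1, hcon f hf.1 hf.2⟩
        have h1 := Finset.card_le_card hs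
        have h2 := h.F2 hW2
        have h3 := h.cardL
        have h4 := Finset.card_le_card hWY
        unfold ii at h2
        omega
      obtain ⟨f, hf, hfX, hfW⟩ := this
      have := h.F1 hf hfX hfW hW2
      omega
    · have h1 := Finset.card_pos.2 ⟨v0, hv0W⟩
      have h0 := ii_small h.hN (Z := W) (by omega)
      have hW1 : #W = 1 := by omega
      obtain ⟨v, hv⟩ := Finset.card_eq_one.1 hW1
      have hvv : v0 = v := by rw [hv] at hv0W; simpa using hv0W
      rw [hv, Finset.sum_singleton, ← hvv] at hds
      rw [hv, ← hvv] at h0 hW1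
      omega
  · intro w hw
    obtain ⟨hwY, hwR, hw3⟩ := (hF w).1 hw
    refine ⟨h, hwY, hw3, hXR, hR, hwR, hFY, hF3, ?_, ?_⟩
    · intro a ha haF
      by_cases haR : a ∈ R
      · exact Or.inl haR
      · exact Or.inr (hPe w hw a ha haF haR)
    · intro a ha b hb haF hbF hab
      by_cases haR : a ∈ R
      · by_cases hbR : b ∈ R
        · exact absurd (Finset.card_le_one.1 (hle1 w hw) a (by simp [ha, haR]) b (by simp [hb, hbR])) hab
        · exact Or.inr (hPe w hw b hb hbF hbR)
      · exact Or.inl (hPe w hw a ha haF haR)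

theorem main (h : Lobe H X Y) : ∃ w1 ∈ Y, ∃ w2 ∈ Y, ∃ x1 y1 x2 y2, w1 ≠ w2 ∧ #(nb H w1) = 3 ∧ #(nb H w2) = 3 ∧
    Good H X w1 x1 y1 ∧ Good H X w2 x2 y2 ∧ (w2 ∈ nb H w1 → w2 = x1 ∨ w2 = y1) ∧
    (w1 ∈ nb H w2 → w1 = x2 ∨ w1 = y2) := by
  obtain ⟨R, F, hF, h3, h2, hctx⟩ := h.exists_ctx
  obtain ⟨w1, hw1, w2, hw2, hne, hl1, hl2⟩ := h.two_low hF h3 h2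
  obtain ⟨x1, y1, g1, k1⟩ := (hctx w1 hw1).low hl1
  obtain ⟨x2, y2, g2, k2⟩ := (hctx w2 hw2).low hl2
  exact ⟨w1, hF hw1, w2, hF hw2, x1, y1, x2, y2, hne, h3 _ hw1, h3 _ hw2, g1, g2,
    fun hh => k1 _ hh hw2, fun hh => k2 _ hh hw1⟩

/-! Consequences of goodness. -/

theorem card_filter_mem {E : Finset (Sym2 ℕ)} (w : ℕ) : #(E.filter (fun e => w ∈ e)) = #(nb E w) := by
  by_cases hw : w ∈ vs E
  · have := filter_card (E := E) w (vs E) hw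
    rw [Finset.inter_eq_left.2 (show nb E w ⊆ vs E from Finset.filter_subset _ _)] at this
    rw [← this]
    congr 1
    apply Finset.filter_congr
    intro e he
    simp [mem_sym2_vs he]
  · have h1 : E.filter (fun e => w ∈ e) = ∅ := by
      rw [Finset.filter_eq_empty_iff]
      intro e he hwe
      exact hw (mem_vs.2 ⟨e, he, hwe⟩)
    have h2 : nb E w = ∅ := by
      rw [Finset.eq_empty_iff_forall_notMem]
      intro u hu
      exact hw (mem_vs_left (mem_nb.1 hu))
    rw [h1, h2]; rfl

theorem card_Lw (h : Lobe H X Y) {w : ℕ} (hw : w ∈ Y) (hd : #(nb H w) = 3) :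
    #((H \ X.sym2).filter (fun e => w ∉ e)) + 3 = 2 * #Y + 1 := by
  rw [← h.cardL, ← hd, ← card_filter_mem (E := H) w]
  have h1 := Finset.card_filter_add_card_filter_not (s := H \ X.sym2) (fun e => w ∈ e)
  have h2 : (H \ X.sym2).filter (fun e => w ∈ e) = H.filter (fun e => w ∈ e) := by
    ext e
    simp only [Finset.mem_filter, Finset.mem_sdiff]
    constructor
    · tauto
    · rintro ⟨h1, h2⟩
      exact ⟨⟨h1, h.edge_notX hw h2⟩, h2⟩
  rw [h2] at h1
  omega

theorem good_notMem (h : Lobe H X Y) {w x y : ℕ} (hw : w ∈ Y) (hd : #(nb H w) = 3) (hg : Good H X w x y) :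
    s(x, y) ∉ H := by
  intro hxy
  have hc := h.card_Lw hw hd
  have hY := h.hY
  obtain ⟨f, hf, hne⟩ := Finset.exists_mem_ne (s := (H \ X.sym2).filter (fun e => w ∉ e)) (by omega) s(x, y)
  rw [Finset.mem_filter, Finset.mem_sdiff] at hf
  obtain ⟨hwx, hwy, hne', hb⟩ := hg
  refine hb {x, y} ⟨?_, ?_, by simp, by simp, f, hf.1.1, hf.1.2, hf.2, ?_⟩
  · refine ⟨by rw [Finset.card_pair hne'], ?_⟩
    rw [Finset.card_pair hne']
    have : H ∩ ({x, y} : Finset ℕ).sym2 = {s(x, y)} := by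
      ext e
      rw [Finset.mem_inter, Finset.mem_singleton]
      constructor
      · rintro ⟨h1, h2⟩
        exact edge_eq_of_mem (h.hN e h1) h2
      · rintro rfl
        exact ⟨hxy, by simp⟩
    unfold ii
    rw [this]; rfl
  · simp only [Finset.mem_insert, Finset.mem_singleton]
    rintro (rfl | rfl)
    · exact h.hN.ne hwx rfl
    · exact h.hN.ne hwy rfl
  · intro h'
    exact hne (edge_eq_of_mem (h.hN f hf.1.1) h')

theorem good_notX (h : Lobe H X Y) {w x y : ℕ} (hw : w ∈ Y) (hd : #(nb H w) = 3) (hg : Good H X w x y) :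
    ¬ (x ∈ X ∧ y ∈ X) := by
  rintro ⟨hx, hy⟩
  have hc := h.card_Lw hw hd
  have hY := h.hY
  obtain ⟨f, hf⟩ := Finset.card_pos.1 (show 0 < #((H \ X.sym2).filter (fun e => w ∉ e)) by omega)
  rw [Finset.mem_filter, Finset.mem_sdiff] at hf
  exact hg.2.2.2 X ⟨h.hX, h.notX hw, hx, hy, f, hf.1.1, hf.1.2, hf.2, hf.1.2⟩

theorem good_sparse (h : Lobe H X Y) {w x y : ℕ} (hw : w ∈ Y) (hd : #(nb H w) = 3) (hg : Good H X w x y)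
    {f : Sym2 ℕ} (hf : f ∈ insert s(x, y) (H.filter (fun e => w ∉ e))) (hfX : f ∉ X.sym2) :
    Sparse ((insert s(x, y) (H.filter (fun e => w ∉ e))).erase f) := by
  have hxy := h.good_notMem hw hd hg
  by_cases hfe : f = s(x, y)
  · subst hfe
    rw [Finset.erase_insert (by simp [hxy])]
    refine (h.hsp _ hg.1 (h.edge_notX hw (by simp))).mono ?_
    intro e he
    rw [Finset.mem_filter] at he
    rw [Finset.mem_erase]
    refine ⟨?_, he.1⟩
    rintro rfl
    exact he.2 (by simp)
  · rw [Finset.mem_insert, or_iff_right hfe, Finset.mem_filter] at hf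
    rw [Finset.erase_insert_of_ne (Ne.symm hfe)]
    have hsub : (H.filter (fun e => w ∉ e)).erase f ⊆ H.erase f :=
      Finset.erase_subset_erase _ (Finset.filter_subset _ _)
    have hsp := (h.hsp f hf.1 hfX).mono hsub
    by_contra hcon
    obtain ⟨T, hT, hxT⟩ := sparse_insert_or hsp (by simpa using hg.2.2.1) hcon
    rw [Finset.mk_mem_sym2_iff] at hxT
    have hwT : w ∉ T := by
      intro hwT
      obtain ⟨e, he, hwe⟩ := mem_vs.1 (tight_subset_vs hsp hT hwT)
      simp only [Finset.mem_erase, Finset.mem_filter] at he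
      exact he.2.2 hwe
    have h1 := h.lsp hw hwT T subset_rfl hT.1
    have h2 : ii ((H.filter (fun e => w ∉ e)).erase f) T ≤ ii (H.erase f) T := ii_mono_left hsub
    have h3 : ii (H.erase f) T ≤ ii H T := ii_mono_left (Finset.erase_subset _ _)
    have h4 := hT.2
    have htT : Tight H T := ⟨hT.1, by omega⟩
    by_cases hfT : f ∈ T.sym2
    · have := ii_erase_mem hf.1 hfT
      omega
    · exact hg.2.2.2 T ⟨htT, hwT, hxT.1, hxT.2, f, hf.1, hfX, hf.2, hfT⟩

end Lobe

open Finset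

/-- 3-connectivity in separation form -/
def TC (E : Finset (Sym2 ℕ)) : Prop :=
  3 < #(vs E) ∧ ∀ A B : Finset ℕ, A ∪ B = vs E → #(A ∩ B) ≤ 2 → ¬ A ⊆ B → ¬ B ⊆ A →
    ∃ a ∈ A, ∃ b ∈ B, a ∉ B ∧ b ∉ A ∧ s(a, b) ∈ E

/-- inverse of splitting -/
def Red (E : Finset (Sym2 ℕ)) (w x y : ℕ) : Finset (Sym2 ℕ) := insert s(x, y) (E.filter (fun e => w ∉ e))

structure RNode (E : Finset (Sym2 ℕ)) (w x y : ℕ) : Prop where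
  deg : #(nb E w) = 3
  ne : x ≠ y
  hx : x ∈ nb E w
  hy : y ∈ nb E w
  hxy : s(x, y) ∉ E
  conn : Conn (Red E w x y)

/-- maximal proper connected subset -/
structure MaxD (E D : Finset (Sym2 ℕ)) : Prop where
  hE : Conn E
  hD : Conn D
  hDE : D ⊆ E
  ne : D ≠ E
  non : D.Nonempty
  mx : ∀ D', D ⊆ D' → D' ⊆ E → Conn D' → D' = D ∨ D' = E

theorem exists_maxD {E D0 : Finset (Sym2 ℕ)} (hE : Conn E) (hD : Conn D0) (hDE : D0 ⊆ E) (hne : D0 ≠ E)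
    (hnon : D0.Nonempty) : ∃ D, D0 ⊆ D ∧ MaxD E D := by
  classical
  set fam := E.powerset.filter (fun D => D0 ⊆ D ∧ Conn D ∧ D ≠ E) with hfam
  obtain ⟨D, hDf, hmax⟩ := Finset.exists_max_image fam (fun R => #R)
    ⟨D0, by rw [hfam, Finset.mem_filter, Finset.mem_powerset]; exact ⟨hDE, subset_rfl, hD, hne⟩⟩
  have hDf' := hDf
  rw [hfam, Finset.mem_filter, Finset.mem_powerset] at hDf'
  obtain ⟨h1, h2, h3, h4⟩ := hDf'
  refine ⟨D, h2, hE, h3, h1, h4, hnon.mono h2, ?_⟩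
  intro D' hD1 hD2 hD3
  by_cases hc : D' = E
  · exact Or.inr hc
  · left
    symm
    apply Finset.eq_of_subset_of_card_le hD1
    apply hmax
    rw [hfam, Finset.mem_filter, Finset.mem_powerset]
    exact ⟨hD2, h2.trans hD1, hD3, hc⟩

theorem conn_single {e : Sym2 ℕ} (he : ¬ e.IsDiag) : Conn {e} := by
  refine ⟨fun f hf => ?_, fun f hf g hg hne => ?_⟩
  · rw [Finset.mem_singleton] at hf; subst hf; exact he
  · rw [Finset.mem_singleton] at hf hg
    exact absurd (hf.trans hg.symm) hne

namespace MaxD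
variable {E D : Finset (Sym2 ℕ)}

theorem circ_all (h : MaxD E D) {C : Finset (Sym2 ℕ)} (hC : Circ C) (hCE : C ⊆ E) (hm : (D ∩ C).Nonempty)
    (hn : ¬ C ⊆ D) : E \ D ⊆ C := by
  have h1 := conn_union h.hD hC.conn hm
  rcases h.mx _ Finset.subset_union_left (Finset.union_subset h.hDE hCE) h1 with h2 | h2
  · exact absurd (by rw [← h2]; exact Finset.subset_union_right) hn
  · intro e he
    rw [Finset.mem_sdiff, ← h2, Finset.mem_union] at he
    tauto

theorem exists_L (h : MaxD E D) : ∃ f, f ∈ E ∧ f ∉ D := by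
  by_contra! hcon
  exact h.ne (Finset.Subset.antisymm h.hDE hcon)

theorem circ_DL (h : MaxD E D) {g d : Sym2 ℕ} (hg : g ∈ E) (hgD : g ∉ D) (hd : d ∈ D) :
    ∃ C ⊆ E, Circ C ∧ g ∈ C ∧ d ∈ C ∧ E \ D ⊆ C := by
  obtain ⟨C, hCE, hC, h1, h2⟩ := h.hE.2 g hg d (h.hDE hd) (by rintro rfl; exact hgD hd)
  exact ⟨C, hCE, hC, h1, h2, h.circ_all hC hCE ⟨d, by simp [hd, h2]⟩ (fun h' => hgD (h' h1))⟩

theorem sparse_L (h : MaxD E D) {B : Finset (Sym2 ℕ)} (hB : Bas B D) {f : Sym2 ℕ} (hf : f ∈ E \ D) :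
    Sparse (B ∪ (E \ D).erase f) := by
  by_contra hcon
  have hsubE : B ∪ (E \ D).erase f ⊆ E :=
    Finset.union_subset (hB.1.trans h.hDE) ((Finset.erase_subset _ _).trans Finset.sdiff_subset)
  obtain ⟨C, hCs, hC⟩ := circ_sub (h.hE.1.mono hsubE) hcon
  by_cases hm : (D ∩ C).Nonempty
  · have hn : ¬ C ⊆ D := by
      intro hCD
      apply hC.2.1
      refine hB.2.1.mono ?_
      intro e he
      have h1 := hCs he
      have h2 := hCD he
      simp only [Finset.mem_union, Finset.mem_erase, Finset.mem_sdiff] at h1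
      tauto
    have := hCs (h.circ_all hC (hCs.trans hsubE) hm hn hf)
    rw [Finset.mem_union] at this
    rcases this with h1 | h1
    · exact (Finset.mem_sdiff.1 hf).2 (hB.1 h1)
    · simp at h1
  · have hd : ∀ e ∈ C, e ∉ D := fun e he heD => hm ⟨e, by simp [he, heD]⟩
    obtain ⟨g, hg⟩ := hC.nonempty
    obtain ⟨d, hdD⟩ := h.non
    obtain ⟨C2, hC2E, hC2, h1, h2, h3⟩ := h.circ_DL (hCs.trans hsubE hg) (hd g hg) hdD
    have : C ⊆ C2 := fun e he => h3 (Finset.mem_sdiff.2 ⟨hCs.trans hsubE he, hd e he⟩)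
    have := hC2.eq_of_subset hC this
    rw [← this] at h2
    exact hd d h2 hdD

theorem exists_B (h : MaxD E D) : ∃ B, Bas B D ∧ ¬ Sparse (B ∪ (E \ D)) := by
  obtain ⟨f, hf, hfD⟩ := h.exists_L
  obtain ⟨d, hd⟩ := h.non
  obtain ⟨C, hCE, hC, h1, h2, h3⟩ := h.circ_DL hf hfD hd
  have hs : Sparse (C ∩ D) := (hC.2.2 f h1).mono (fun e he => by
    rw [Finset.mem_inter] at he
    exact Finset.mem_erase.2 ⟨by rintro rfl; exact hfD he.2, he.1⟩)
  obtain ⟨B, hB1, hB⟩ := exists_bas hs Finset.inter_subset_right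
  refine ⟨B, hB, fun hsp => hC.2.1 (hsp.mono ?_)⟩
  intro e he
  by_cases heD : e ∈ D
  · exact Finset.mem_union_left _ (hB1 (by simp [he, heD]))
  · exact Finset.mem_union_right _ (Finset.mem_sdiff.2 ⟨hCE he, heD⟩)

theorem card_L (h : MaxD E D) : #(E \ D) = 2 * #(vs E \ vs D) + 1 := by
  obtain ⟨B, hB, hns⟩ := h.exists_B
  obtain ⟨f, hf, hfD⟩ := h.exists_L
  have hfL : f ∈ E \ D := Finset.mem_sdiff.2 ⟨hf, hfD⟩
  have hsubE : B ∪ (E \ D).erase f ⊆ E :=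
    Finset.union_subset (hB.1.trans h.hDE) ((Finset.erase_subset _ _).trans Finset.sdiff_subset)
  obtain ⟨B2, h1, h2⟩ := exists_bas (h.sparse_L hB hfL) hsubE
  have hB2 : B2 = B ∪ (E \ D).erase f := by
    refine Finset.Subset.antisymm ?_ h1
    intro e he
    by_cases heD : e ∈ D
    · by_contra hc
      have heB : e ∉ B := fun h' => hc (Finset.mem_union_left _ h')
      exact hB.2.2 e heD heB (h2.2.1.mono (Finset.insert_subset he (Finset.subset_union_left.trans h1)))
    · apply Finset.mem_union_right
      refine Finset.mem_erase.2 ⟨?_, Finset.mem_sdiff.2 ⟨h2.1 he, heD⟩⟩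
      rintro rfl
      apply hns
      refine h2.2.1.mono ?_
      intro g hg
      by_cases hge : g = e
      · subst hge; exact he
      · apply h1
        simp only [Finset.mem_union, Finset.mem_erase] at hg ⊢
        tauto
  have c1 := rig_card h.hE (h.non.mono h.hDE) h2
  have c2 := rig_card h.hD h.non hB
  have hdis : Disjoint B ((E \ D).erase f) := by
    rw [Finset.disjoint_left]
    intro e he he'
    rw [Finset.mem_erase, Finset.mem_sdiff] at he'
    exact he'.2.2 (hB.1 he)
  rw [hB2, Finset.card_union_of_disjoint hdis] at c1
  have c3 := Finset.card_erase_add_one hfL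
  have c4 := Finset.card_sdiff_add_card_eq_card (vs_mono h.hDE)
  omega

theorem L_notX (h : MaxD E D) (hY : (vs E \ vs D).Nonempty) {f : Sym2 ℕ} (hf : f ∈ E) (hfD : f ∉ D) :
    f ∉ (vs D).sym2 := by
  intro hfX
  induction f with
  | _ a b =>
  rw [Finset.mk_mem_sym2_iff] at hfX
  have h1 := conn_add h.hD hfX.1 hfX.2 (h.hE.1.ne hf)
  rcases h.mx _ (Finset.subset_insert _ _) (Finset.insert_subset hf h.hDE) h1 with h2 | h2
  · exact hfD (by rw [← h2]; simp)
  · obtain ⟨v, hv⟩ := hY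
    rw [Finset.mem_sdiff] at hv
    apply hv.2
    have hv1 := hv.1
    rw [← h2, mem_vs] at hv1
    obtain ⟨e, he, hve⟩ := hv1
    rw [Finset.mem_insert] at he
    rcases he with rfl | he
    · rw [Sym2.mem_iff] at hve
      rcases hve with rfl | rfl
      · exact hfX.1
      · exact hfX.2
    · exact mem_vs.2 ⟨e, he, hve⟩

theorem nb_eq (h : MaxD E D) {B : Finset (Sym2 ℕ)} (hB : B ⊆ D) {v : ℕ} (hv : v ∉ vs D) :
    nb (B ∪ (E \ D)) v = nb E v := by
  ext u
  rw [mem_nb, mem_nb, Finset.mem_union, Finset.mem_sdiff]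
  constructor
  · rintro (h1 | h1)
    · exact h.hDE (hB h1)
    · exact h1.1
  · intro h1
    exact Or.inr ⟨h1, notMem_of_vs hv⟩

theorem _root_.Conn.nb_deg {E : Finset (Sym2 ℕ)} (h : Conn E) (h1 : 1 < #E) {v : ℕ} (hv : v ∈ vs E) : 3 ≤ #(nb E v) := by
  obtain ⟨a, b, c, hab, hac, hbc, ha, hb, hc⟩ := h.deg h1 hv
  rw [← Finset.card_eq_three.2 ⟨a, b, c, hab, hac, hbc, rfl⟩]
  apply Finset.card_le_card
  intro u
  simp only [Finset.mem_insert, Finset.mem_singleton]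
  rintro (rfl | rfl | rfl) <;> exact mem_nb.2 (by assumption)

theorem lobe (h : MaxD E D) (hTC : TC E) (h5 : 5 ≤ #(vs E)) (hY : 2 ≤ #(vs E \ vs D)) {B : Finset (Sym2 ℕ)}
    (hB : Bas B D) : Lobe (B ∪ (E \ D)) (vs D) (vs E \ vs D) := by
  have hYn : (vs E \ vs D).Nonempty := Finset.card_pos.1 (by omega)
  have hBE : B ∪ (E \ D) ⊆ E := Finset.union_subset (hB.1.trans h.hDE) Finset.sdiff_subset
  have hcL := h.card_L
  have h1E : 1 < #E := by
    have := Finset.card_le_card (Finset.sdiff_subset : E \ D ⊆ E)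
    omega
  have hdis : Disjoint B (E \ D) := by
    rw [Finset.disjoint_left]
    intro e he he'
    exact (Finset.mem_sdiff.1 he').2 (hB.1 he)
  have c2 := rig_card h.hD h.non hB
  have hii : (B ∪ (E \ D)) ∩ (vs D).sym2 = B := by
    ext e
    simp only [Finset.mem_inter, Finset.mem_union, Finset.mem_sdiff]
    constructor
    · rintro ⟨h1 | h1, h2⟩
      · exact h1
      · exact absurd h2 (h.L_notX hYn h1.1 h1.2)
    · intro he
      exact ⟨Or.inl he, mem_sym2_vs (hB.1 he)⟩
  refine ⟨h.hE.1.mono hBE, Finset.disjoint_sdiff, ?_, ?_, ?_, ?_, ?_, ?_, hY⟩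
  · intro v hv
    have := vs_mono hBE hv
    simp only [Finset.mem_union, Finset.mem_sdiff]
    tauto
  · refine ⟨card_vs_two h.hD.1 h.non, ?_⟩
    unfold ii
    rw [hii]; exact c2
  · rw [Finset.card_union_of_disjoint hdis]
    omega
  · intro f hf hfX
    have hfL : f ∈ E \ D := by
      rw [Finset.mem_union] at hf
      rcases hf with h' | h'
      · exact absurd (mem_sym2_vs (hB.1 h')) hfX
      · exact h'
    refine (h.sparse_L hB hfL).mono ?_
    intro e he
    simp only [Finset.mem_erase, Finset.mem_union] at he ⊢
    tauto
  · intro v hv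
    rw [Finset.mem_sdiff] at hv
    rw [h.nb_eq hB.1 hv.2]
    exact h.hE.nb_deg h1E hv.1
  · rintro u hu w hw c d huw ⟨e1, e2⟩
    rw [Finset.mem_sdiff] at hu hw
    rw [h.nb_eq hB.1 hu.2] at e1
    rw [h.nb_eq hB.1 hw.2] at e2
    have hcE : c ∈ vs E := mem_vs_right (mem_nb.1 (show c ∈ nb E u by simp [e1]))
    have hdE : d ∈ vs E := mem_vs_right (mem_nb.1 (show d ∈ nb E u by simp [e1]))
    have huc : u ≠ c := by
      rintro rfl
      exact notMem_nb_self h.hE.1 u (by simp [e1])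
    have hud : u ≠ d := by
      rintro rfl
      exact notMem_nb_self h.hE.1 u (by simp [e1])
    have hwc : w ≠ c := by
      rintro rfl
      exact notMem_nb_self h.hE.1 w (by simp [e2])
    have hwd : w ≠ d := by
      rintro rfl
      exact notMem_nb_self h.hE.1 w (by simp [e2])
    obtain ⟨a, ha, b, hb, haB, hbA, hab⟩ := hTC.2 {u, w, c, d} (vs E \ {u, w}) (by
        ext v
        simp only [Finset.mem_union, Finset.mem_insert, Finset.mem_singleton, Finset.mem_sdiff]
        constructor
        · rintro ((rfl | rfl | rfl | rfl) | h')
          · exact hu.1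
          · exact hw.1
          · exact hcE
          · exact hdE
          · exact h'.1
        · tauto) (by
        refine (Finset.card_le_card (t := {c, d}) ?_).trans Finset.card_le_two
        intro v
        simp only [Finset.mem_inter, Finset.mem_insert, Finset.mem_singleton, Finset.mem_sdiff]
        tauto) (by
        intro h'
        have := h' (show u ∈ _ by simp)
        simp at this) (by
        intro h'
        have hsub : vs E ⊆ {u, w, c, d} := by
          intro v hv
          by_cases hv' : v ∈ ({u, w} : Finset ℕ)
          · simp only [Finset.mem_insert, Finset.mem_singleton] at hv' ⊢
            tauto
          · exact h' (Finset.mem_sdiff.2 ⟨hv, hv'⟩)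
        have := Finset.card_le_card hsub
        have := Finset.card_le_four (a := u) (b := w) (c := c) (d := d)
        omega)
    simp only [Finset.mem_insert, Finset.mem_singleton, Finset.mem_sdiff, not_and, not_not, not_or] at ha hb haB hbA
    have := haB (by
      rcases ha with rfl | rfl | rfl | rfl
      · exact hu.1
      · exact hw.1
      · exact hcE
      · exact hdE)
    rcases (show a = u ∨ a = w by tauto) with rfl | rfl
    · have : b ∈ nb E a := mem_nb.2 hab
      rw [e1] at this
      simp at this
      tauto
    · have : b ∈ nb E a := mem_nb.2 hab
      rw [e2] at this
      simp at this
      tauto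

theorem rnode_of_good (h : MaxD E D) {B : Finset (Sym2 ℕ)} (hB : Bas B D)
    (hl : Lobe (B ∪ (E \ D)) (vs D) (vs E \ vs D)) {w x y : ℕ}
    (hw : w ∈ vs E \ vs D) (hd : #(nb (B ∪ (E \ D)) w) = 3) (hg : Good (B ∪ (E \ D)) (vs D) w x y) :
    RNode E w x y := by
  have hwX := hl.notX hw
  have hBE : B ∪ (E \ D) ⊆ E := Finset.union_subset (hB.1.trans h.hDE) Finset.sdiff_subset
  have hxyH := hl.good_notMem hw hd hg
  have hxyX := hl.good_notX hw hd hg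
  have hxy : s(x, y) ∉ E := by
    intro hE
    by_cases hD : s(x, y) ∈ D
    · exact hxyX ⟨mem_vs_left hD, mem_vs_right hD⟩
    · exact hxyH (Finset.mem_union_right _ (Finset.mem_sdiff.2 ⟨hE, hD⟩))
  have hYn : (vs E \ vs D).Nonempty := ⟨w, hw⟩
  have hnb := h.nb_eq hB.1 hwX
  have hBw : ∀ e ∈ D, w ∉ e := fun e he hwe => hwX (mem_vs.2 ⟨e, he, hwe⟩)
  refine ⟨by rw [← hnb]; exact hd, hg.2.2.1, ?_, ?_, hxy, ?_⟩
  · rw [← hnb]; exact mem_nb.2 hg.1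
  · rw [← hnb]; exact mem_nb.2 hg.2.1
  set F := insert s(x, y) ((B ∪ (E \ D)).filter (fun e => w ∉ e)) with hF
  set L' := insert s(x, y) ((E \ D).filter (fun e => w ∉ e)) with hL'
  have hFB : F = B ∪ L' := by
    ext e
    simp only [hF, hL', Finset.mem_insert, Finset.mem_filter, Finset.mem_union]
    constructor
    · tauto
    · rintro (h1 | h1 | h1)
      · exact Or.inr ⟨Or.inl h1, hBw e (hB.1 h1)⟩
      · exact Or.inl h1
      · tauto
  have hLeq : (B ∪ (E \ D)) \ (vs D).sym2 = E \ D := by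
    ext e
    simp only [Finset.mem_union, Finset.mem_sdiff]
    constructor
    · rintro ⟨h1 | h1, h2⟩
      · exact absurd (mem_sym2_vs (hB.1 h1)) h2
      · exact h1
    · intro h1
      exact ⟨Or.inr h1, h.L_notX hYn h1.1 h1.2⟩
  have hcL' : #L' + 2 = 2 * #(vs E \ vs D) + 1 := by
    have := hl.card_Lw hw hd
    rw [hLeq] at this
    rw [hL', Finset.card_insert_of_notMem (by
      intro h'
      exact hxy (Finset.mem_sdiff.1 (Finset.mem_filter.1 h').1).1)]
    omega
  have hL'D : ∀ e ∈ L', e ∉ (vs D).sym2 := by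
    intro e he
    rw [hL', Finset.mem_insert] at he
    rcases he with rfl | he
    · rw [Finset.mk_mem_sym2_iff]; exact hxyX
    · rw [Finset.mem_filter, Finset.mem_sdiff] at he
      exact h.L_notX hYn he.1.1 he.1.2
  have hdis : Disjoint B L' := by
    rw [Finset.disjoint_left]
    intro e he he'
    exact hL'D e he' (mem_sym2_vs (hB.1 he))
  have hNF : Nd F := by
    rw [hF]
    refine (hl.hN.mono (Finset.filter_subset _ _)).insert ?_
    simpa using hg.2.2.1
  have hvF : vs F ⊆ (vs E).erase w := by
    intro v hv
    obtain ⟨e, he, hve⟩ := mem_vs.1 hv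
    rw [hF, Finset.mem_insert] at he
    rw [Finset.mem_erase]
    rcases he with rfl | he
    · rw [Sym2.mem_iff] at hve
      rcases hve with rfl | rfl
      · refine ⟨?_, mem_vs_right (hBE hg.1)⟩
        rintro rfl; exact hl.hN.ne hg.1 rfl
      · refine ⟨?_, mem_vs_right (hBE hg.2.1)⟩
        rintro rfl; exact hl.hN.ne hg.2.1 rfl
    · rw [Finset.mem_filter] at he
      refine ⟨?_, mem_vs.2 ⟨e, hBE he.1, hve⟩⟩
      rintro rfl; exact he.2 hve
  have c2 := rig_card h.hD h.non hB
  have c4 := Finset.card_sdiff_add_card_eq_card (vs_mono h.hDE)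
  have hY2 := hl.hY
  have c5 := Finset.card_erase_add_one (Finset.mem_sdiff.1 hw).1
  have hnsF : ¬ Sparse F := by
    intro hsp
    have := sparse_card hsp hvF (by omega)
    rw [hFB, Finset.card_union_of_disjoint hdis] at this
    omega
  obtain ⟨C, hCF, hC⟩ := circ_sub hNF hnsF
  have hLC : L' ⊆ C := by
    intro f hf
    by_contra hfC
    have hfF : f ∈ F := by rw [hFB]; exact Finset.mem_union_right _ hf
    apply hC.2.1
    refine (hl.good_sparse hw hd hg hfF (hL'D f hf)).mono ?_
    intro e he
    exact Finset.mem_erase.2 ⟨by rintro rfl; exact hfC he, hCF he⟩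
  have hm : (D ∩ C).Nonempty := by
    by_contra hcon
    have : C = L' := by
      refine Finset.Subset.antisymm ?_ hLC
      intro e he
      have := hCF he
      rw [hFB, Finset.mem_union] at this
      rcases this with h' | h'
      · exact absurd ⟨e, by simp [he, hB.1 h']⟩ hcon
      · exact h'
    have hcc := hC.card
    rw [this] at hcc
    omega
  have hfin := conn_union h.hD hC.conn hm
  have : D ∪ C = Red E w x y := by
    ext e
    unfold Red
    simp only [Finset.mem_union, Finset.mem_insert, Finset.mem_filter]
    constructor
    · rintro (h1 | h1)
      · exact Or.inr ⟨h.hDE h1, hBw e h1⟩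
      · have := hCF h1
        rw [hF, Finset.mem_insert, Finset.mem_filter] at this
        rcases this with h2 | h2
        · exact Or.inl h2
        · exact Or.inr ⟨hBE h2.1, h2.2⟩
    · rintro (h1 | h1)
      · right; apply hLC; rw [hL', h1]; simp
      · by_cases heD : e ∈ D
        · exact Or.inl heD
        · right; apply hLC
          rw [hL', Finset.mem_insert, Finset.mem_filter, Finset.mem_sdiff]
          exact Or.inr ⟨⟨h1.1, heD⟩, h1.2⟩
  rwa [this] at hfin

end MaxD

open Finset

namespace MaxD
variable {E D : Finset (Sym2 ℕ)}

theorem R_two (h : MaxD E D) (hTC : TC E) (h5 : 5 ≤ #(vs E)) (hY : 2 ≤ #(vs E \ vs D)) :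
    ∃ w1 ∈ vs E \ vs D, ∃ w2 ∈ vs E \ vs D, ∃ x1 y1 x2 y2, w1 ≠ w2 ∧ RNode E w1 x1 y1 ∧ RNode E w2 x2 y2 ∧
      (w2 ∈ nb E w1 → w2 = x1 ∨ w2 = y1) ∧ (w1 ∈ nb E w2 → w1 = x2 ∨ w1 = y2) := by
  obtain ⟨B, hB, _⟩ := h.exists_B
  have hl := h.lobe hTC h5 hY hB
  obtain ⟨w1, hw1, w2, hw2, x1, y1, x2, y2, hne, hd1, hd2, g1, g2, k1, k2⟩ := hl.main
  have e1 := h.nb_eq hB.1 (hl.notX hw1)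
  have e2 := h.nb_eq hB.1 (hl.notX hw2)
  refine ⟨w1, hw1, w2, hw2, x1, y1, x2, y2, hne, h.rnode_of_good hB hl hw1 hd1 g1,
    h.rnode_of_good hB hl hw2 hd2 g2, ?_, ?_⟩
  · rw [← e1]; exact k1
  · rw [← e2]; exact k2

theorem R_core (h : MaxD E D) (hTC : TC E) (h5 : 5 ≤ #(vs E)) :
    (∃ e ∈ E, e ∉ D ∧ Conn (E.erase e)) ∨
    (∃ w ∈ vs E, w ∉ vs D ∧ ∃ x y, RNode E w x y) ∨
    (∃ e1 ∈ E, ∃ e2 ∈ E, ∃ e3 ∈ E, e1 ≠ e2 ∧ e1 ≠ e3 ∧ e2 ≠ e3 ∧ Conn (E.erase e1) ∧ Conn (E.erase e2) ∧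
      Conn (E.erase e3)) := by
  have hcL := h.card_L
  rcases Nat.lt_or_ge #(vs E \ vs D) 2 with hlt | hge
  swap
  · right; left
    obtain ⟨w1, hw1, w2, hw2, x1, y1, x2, y2, hne, hr, _⟩ := h.R_two hTC h5 hge
    rw [Finset.mem_sdiff] at hw1
    exact ⟨w1, hw1.1, hw1.2, x1, y1, hr⟩
  rcases Nat.eq_zero_or_pos #(vs E \ vs D) with h0 | h1
  · left
    rw [h0] at hcL
    obtain ⟨f, hf⟩ := Finset.card_eq_one.1 hcL
    have hfm : f ∈ E \ D := by rw [hf]; simp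
    rw [Finset.mem_sdiff] at hfm
    refine ⟨f, hfm.1, hfm.2, ?_⟩
    have : E.erase f = D := by
      ext e
      rw [Finset.mem_erase]
      constructor
      · rintro ⟨h1, h2⟩
        by_contra hc
        have : e ∈ E \ D := Finset.mem_sdiff.2 ⟨h2, hc⟩
        rw [hf, Finset.mem_singleton] at this
        exact h1 this
      · intro he
        exact ⟨by rintro rfl; exact hfm.2 he, h.hDE he⟩
    rw [this]; exact h.hD
  · right
    have h1' : #(vs E \ vs D) = 1 := by omega
    rw [h1'] at hcL
    obtain ⟨w, hw⟩ := Finset.card_eq_one.1 h1'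
    have hwm : w ∈ vs E \ vs D := by rw [hw]; simp
    rw [Finset.mem_sdiff] at hwm
    have hYn : (vs E \ vs D).Nonempty := by rw [hw]; simp
    have hX : ∀ v ∈ vs E, v ≠ w → v ∈ vs D := by
      intro v hv hvw
      by_contra hc
      have : v ∈ vs E \ vs D := Finset.mem_sdiff.2 ⟨hv, hc⟩
      rw [hw, Finset.mem_singleton] at this
      exact hvw this
    have hDw : ∀ e ∈ E, (e ∈ D ↔ w ∉ e) := by
      intro e he
      constructor
      · intro heD hwe
        exact hwm.2 (mem_vs.2 ⟨e, heD, hwe⟩)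
      · intro hwe
        by_contra heD
        apply h.L_notX hYn he heD
        rw [Finset.mem_sym2_iff]
        intro a ha
        exact hX a (mem_vs.2 ⟨e, he, ha⟩) (by rintro rfl; exact hwe ha)
    have hdeg : #(nb E w) = 3 := by
      rw [← Lobe.card_filter_mem]
      have : E.filter (fun e => w ∈ e) = E \ D := by
        ext e
        rw [Finset.mem_filter, Finset.mem_sdiff]
        constructor
        · rintro ⟨h1, h2⟩
          exact ⟨h1, fun h' => (hDw e h1).1 h' h2⟩
        · rintro ⟨h1, h2⟩
          refine ⟨h1, ?_⟩
          by_contra hc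
          exact h2 ((hDw e h1).2 hc)
      rw [this]; exact hcL
    obtain ⟨x, y, z, hxy, hxz, hyz, hnb⟩ := Finset.card_eq_three.1 hdeg
    have hnw : ∀ v ∈ nb E w, v ≠ w := by
      rintro v hv rfl
      exact notMem_nb_self h.hE.1 v hv
    have hnX : ∀ v ∈ nb E w, v ∈ vs D := fun v hv => hX v (mem_vs_right (mem_nb.1 hv)) (hnw v hv)
    by_cases hex : ∃ a ∈ nb E w, ∃ b ∈ nb E w, a ≠ b ∧ s(a, b) ∉ E
    · left
      obtain ⟨a, ha, b, hb, hab, habE⟩ := hex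
      refine ⟨w, hwm.1, hwm.2, a, b, hdeg, hab, ha, hb, habE, ?_⟩
      have : Red E w a b = insert s(a, b) D := by
        unfold Red
        congr 1
        ext e
        rw [Finset.mem_filter]
        constructor
        · rintro ⟨h1, h2⟩; exact (hDw e h1).2 h2
        · intro he; exact ⟨h.hDE he, (hDw e (h.hDE he)).1 he⟩
      rw [this]
      exact conn_add h.hD (hnX a ha) (hnX b hb) hab
    · right
      push Not at hex
      have key : ∀ a b c, nb E w = {a, b, c} → a ≠ b → a ≠ c → b ≠ c → Conn (E.erase s(a, b)) := by
        intro a b c hnb hab hac hbc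
        have ha : a ∈ nb E w := by simp [hnb]
        have hb : b ∈ nb E w := by simp [hnb]
        have hc : c ∈ nb E w := by simp [hnb]
        have habE := hex a ha b hb hab
        have habw : w ∉ s(a, b) := by
          rw [Sym2.mem_iff]
          rintro (h' | h')
          · exact hnw a ha h'.symm
          · exact hnw b hb h'.symm
        have := conn_spl h.hD ((hDw _ habE).2 habw) (hnX c hc) hac.symm hbc.symm hwm.2
        have e : spl D w a b c = E.erase s(a, b) := by
          ext e
          rw [mem_spl, Finset.mem_erase]
          constructor
          · have hne : ∀ u, s(w, u) ≠ s(a, b) := by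
              intro u hu
              apply habw
              rw [← hu]; simp
            rintro (rfl | rfl | rfl | h')
            · exact ⟨hne _, mem_nb.1 ha⟩
            · exact ⟨hne _, mem_nb.1 hb⟩
            · exact ⟨hne _, mem_nb.1 hc⟩
            · exact ⟨h'.1, h.hDE h'.2⟩
          · rintro ⟨h1, h2⟩
            by_cases heD : e ∈ D
            · tauto
            · have hwe : w ∈ e := by
                by_contra hc
                exact heD ((hDw e h2).2 hc)
              obtain ⟨u, rfl⟩ := Sym2.mem_iff_exists.1 hwe
              have : u ∈ nb E w := mem_nb.2 h2
              rw [hnb] at this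
              simp only [Finset.mem_insert, Finset.mem_singleton] at this
              rcases this with rfl | rfl | rfl <;> tauto
        rwa [e] at this
      have hx : x ∈ nb E w := by simp [hnb]
      have hy : y ∈ nb E w := by simp [hnb]
      have hz : z ∈ nb E w := by simp [hnb]
      refine ⟨s(x, y), hex x hx y hy hxy, s(x, z), hex x hx z hz hxz, s(y, z), hex y hy z hz hyz, ?_, ?_, ?_,
        key x y z hnb hxy hxz hyz, key x z y (by rw [hnb]; ext; simp; tauto) hxz hxy hyz.symm,
        key y z x (by rw [hnb]; ext; simp; tauto) hyz hxy.symm hxz.symm⟩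
      · intro h'; rw [Sym2.eq_iff] at h'; rcases h' with h' | h' <;> tauto
      · intro h'; rw [Sym2.eq_iff] at h'; rcases h' with h' | h' <;> tauto
      · intro h'; rw [Sym2.eq_iff] at h'; rcases h' with h' | h' <;> tauto

end MaxD

/-- marks either lie in a proper connected set or the whole graph is a circuit -/
theorem marks {E : Finset (Sym2 ℕ)} (hE : Conn E) {e f : Sym2 ℕ} (he : e ∈ E) (hf : f ∈ E) (hne : e ≠ f) :
    (∃ D, e ∈ D ∧ f ∈ D ∧ MaxD E D) ∨ MaxD E {e} := by
  by_cases hc : ∃ D0 ⊆ E, Conn D0 ∧ D0 ≠ E ∧ e ∈ D0 ∧ f ∈ D0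
  · left
    obtain ⟨D0, h1, h2, h3, h4, h5⟩ := hc
    obtain ⟨D, hD, hm⟩ := exists_maxD hE h2 h1 h3 ⟨e, h4⟩
    exact ⟨D, hD h4, hD h5, hm⟩
  · right
    push Not at hc
    obtain ⟨C, hCE, hC, h1, h2⟩ := hE.2 e he f hf hne
    have hCeq : C = E := by
      by_contra h'
      exact hc C hCE hC.conn h' h1 h2
    subst hCeq
    refine ⟨hE, conn_single (hE.1 e he), by simpa using he, ?_, by simp, ?_⟩
    · intro h'
      rw [← h', Finset.mem_singleton] at h2
      exact hne h2.symm
    · intro D' hD1 hD2 hD3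
      by_cases hcard : 1 < #D'
      · right
        have heD : e ∈ D' := hD1 (by simp)
        obtain ⟨C', hC'D, hC', _⟩ := hD3.exists_circ hcard heD
        have := hC.eq_of_subset hC' (hC'D.trans hD2)
        rw [this] at hC'D
        exact Finset.Subset.antisymm hD2 hC'D
      · left
        symm
        apply Finset.eq_of_subset_of_card_le hD1
        simp only [Finset.card_singleton]; omega

theorem vs_single (c d : ℕ) : vs {s(c, d)} = {c, d} := by
  ext v
  rw [mem_vs]
  simp

theorem R_vertex {A : Finset (Sym2 ℕ)} (hA : Conn A) (hTC : TC A) (h5 : 5 ≤ #(vs A)) {c d z : ℕ}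
    (hcd : s(c, d) ∈ A) (hz : z ∈ vs A) (hzc : z ≠ c) (hzd : z ≠ d) :
    (∃ e ∈ A, e ≠ s(c, d) ∧ Conn (A.erase e)) ∨
    (∃ w x y, w ≠ c ∧ w ≠ d ∧ w ≠ z ∧ RNode A w x y) := by
  obtain ⟨f, hf, hzf⟩ := mem_vs.1 hz
  have hne : s(c, d) ≠ f := by
    rintro rfl
    rw [Sym2.mem_iff] at hzf
    tauto
  rcases marks hA hcd hf hne with ⟨D, h1, h2, hm⟩ | hm
  · rcases hm.R_core hTC h5 with ⟨e, he, heD, hc⟩ | ⟨w, hw, hwD, x, y, hr⟩ | ⟨e1, he1, e2, he2, e3, he3, n12, n13, n23, k1, k2, k3⟩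
    · exact Or.inl ⟨e, he, by rintro rfl; exact heD h1, hc⟩
    · refine Or.inr ⟨w, x, y, ?_, ?_, ?_, hr⟩
      · rintro rfl; exact hwD (mem_vs_left h1)
      · rintro rfl; exact hwD (mem_vs_right h1)
      · rintro rfl; exact hwD (mem_vs.2 ⟨f, h2, hzf⟩)
    · left
      by_cases h' : e1 = s(c, d)
      · exact ⟨e2, he2, by rintro rfl; exact n12 h', k2⟩
      · exact ⟨e1, he1, h', k1⟩
  · right
    have hcdn := hA.1.ne hcd
    obtain ⟨w1, hw1, w2, hw2, x1, y1, x2, y2, hne, r1, r2, _⟩ := hm.R_two hTC h5 (by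
      have := Finset.card_sdiff_add_card_eq_card (vs_mono hm.hDE)
      rw [vs_single] at this ⊢
      have := Finset.card_le_two (a := c) (b := d)
      omega)
    rw [vs_single, Finset.mem_sdiff] at hw1 hw2
    simp only [Finset.mem_insert, Finset.mem_singleton, not_or] at hw1 hw2
    by_cases h' : w1 = z
    · exact ⟨w2, x2, y2, hw2.2.1, hw2.2.2, by rintro rfl; exact hne h', r2⟩
    · exact ⟨w1, x1, y1, hw1.2.1, hw1.2.2, h', r1⟩

theorem R_edge {A : Finset (Sym2 ℕ)} (hA : Conn A) (hTC : TC A) (h5 : 5 ≤ #(vs A)) {c d x y : ℕ}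
    (hcd : s(c, d) ∈ A) (hxy : s(x, y) ∈ A) (hne : s(c, d) ≠ s(x, y)) :
    (∃ e ∈ A, e ≠ s(c, d) ∧ e ≠ s(x, y) ∧ Conn (A.erase e)) ∨
    (∃ w p q, w ≠ c ∧ w ≠ d ∧ w ≠ x ∧ w ≠ y ∧ RNode A w p q) ∨
    (∃ w u p, s(x, y) = s(w, u) ∧ w ≠ c ∧ w ≠ d ∧ RNode A w u p) := by
  rcases marks hA hcd hxy hne with ⟨D, h1, h2, hm⟩ | hm
  · rcases hm.R_core hTC h5 with ⟨e, he, heD, hc⟩ | ⟨w, hw, hwD, p, q, hr⟩ | ⟨e1, he1, e2, he2, e3, he3, n12, n13, n23, k1, k2, k3⟩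
    · exact Or.inl ⟨e, he, by rintro rfl; exact heD h1, by rintro rfl; exact heD h2, hc⟩
    · refine Or.inr (Or.inl ⟨w, p, q, ?_, ?_, ?_, ?_, hr⟩)
      · rintro rfl; exact hwD (mem_vs_left h1)
      · rintro rfl; exact hwD (mem_vs_right h1)
      · rintro rfl; exact hwD (mem_vs_left h2)
      · rintro rfl; exact hwD (mem_vs_right h2)
    · left
      have : (e1 ≠ s(c, d) ∧ e1 ≠ s(x, y)) ∨ (e2 ≠ s(c, d) ∧ e2 ≠ s(x, y)) ∨ (e3 ≠ s(c, d) ∧ e3 ≠ s(x, y)) := by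
        grind
      rcases this with h' | h' | h'
      · exact ⟨e1, he1, h'.1, h'.2, k1⟩
      · exact ⟨e2, he2, h'.1, h'.2, k2⟩
      · exact ⟨e3, he3, h'.1, h'.2, k3⟩
  · right
    have hcdn := hA.1.ne hcd
    obtain ⟨w1, hw1, w2, hw2, x1, y1, x2, y2, hne, r1, r2, a1, a2⟩ := hm.R_two hTC h5 (by
      have := Finset.card_sdiff_add_card_eq_card (vs_mono hm.hDE)
      rw [vs_single] at this ⊢
      have := Finset.card_le_two (a := c) (b := d)
      omega)
    rw [vs_single, Finset.mem_sdiff] at hw1 hw2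
    simp only [Finset.mem_insert, Finset.mem_singleton, not_or] at hw1 hw2
    by_cases h1 : w1 ≠ x ∧ w1 ≠ y
    · exact Or.inl ⟨w1, x1, y1, hw1.2.1, hw1.2.2, h1.1, h1.2, r1⟩
    by_cases h2 : w2 ≠ x ∧ w2 ≠ y
    · exact Or.inl ⟨w2, x2, y2, hw2.2.1, hw2.2.2, h2.1, h2.2, r2⟩
    right
    have hs : s(x, y) = s(w1, w2) := by
      rw [Sym2.eq_iff]; grind
    rcases a1 (mem_nb.2 (by rw [← hs]; exact hxy)) with rfl | rfl
    · exact ⟨w1, w2, y1, hs, hw1.2.1, hw1.2.2, r1⟩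
    · refine ⟨w1, w2, x1, hs, hw1.2.1, hw1.2.2, r1.deg, r1.ne.symm, r1.hy, r1.hx, ?_, ?_⟩
      · rw [Sym2.eq_swap]; exact r1.hxy
      · have := r1.conn
        unfold Red at this ⊢
        rwa [Sym2.eq_swap]

open Finset

/-- edge sets obtainable from K4 -/
def Reach (E : Finset (Sym2 ℕ)) : Prop :=
  ∃ G₀ G : FinGraph, IsK4 G₀ ∧ Relation.ReflTransGen (fun H H' => EdgeSplit H H' ∨ EdgeAdd H H') G₀ G ∧
    G.edges = E ∧ G.verts = vs E

theorem vs_insert {E : Finset (Sym2 ℕ)} {a b : ℕ} (ha : a ∈ vs E) (hb : b ∈ vs E) :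
    vs (insert s(a, b) E) = vs E := by
  ext v
  simp only [mem_vs, Finset.mem_insert]
  constructor
  · rintro ⟨e, rfl | he, hv⟩
    · rw [Sym2.mem_iff] at hv
      rcases hv with rfl | rfl
      · exact mem_vs.1 ha
      · exact mem_vs.1 hb
    · exact ⟨e, he, hv⟩
  · rintro ⟨e, he, hv⟩
    exact ⟨e, Or.inr he, hv⟩

theorem vs_spl {E : Finset (Sym2 ℕ)} {v x y z : ℕ} (hxy : s(x, y) ∈ E) (hz : z ∈ vs E) :
    vs (spl E v x y z) = insert v (vs E) := by
  ext u
  rw [mem_vs, Finset.mem_insert]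
  constructor
  · rintro ⟨e, he, hu⟩
    rw [mem_spl] at he
    rcases he with rfl | rfl | rfl | h'
    · rw [Sym2.mem_iff] at hu
      rcases hu with rfl | rfl
      · exact Or.inl rfl
      · exact Or.inr (mem_vs_left hxy)
    · rw [Sym2.mem_iff] at hu
      rcases hu with rfl | rfl
      · exact Or.inl rfl
      · exact Or.inr (mem_vs_right hxy)
    · rw [Sym2.mem_iff] at hu
      rcases hu with rfl | rfl
      · exact Or.inl rfl
      · exact Or.inr hz
    · exact Or.inr (mem_vs.2 ⟨e, h'.2, hu⟩)
  · rintro (rfl | hu)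
    · exact ⟨s(u, x), by rw [mem_spl]; tauto, by simp⟩
    · obtain ⟨e, he, hue⟩ := mem_vs.1 hu
      by_cases h' : e = s(x, y)
      · subst h'
        rw [Sym2.mem_iff] at hue
        rcases hue with rfl | rfl
        · exact ⟨s(v, u), by rw [mem_spl]; tauto, by simp⟩
        · exact ⟨s(v, u), by rw [mem_spl]; tauto, by simp⟩
      · exact ⟨e, by rw [mem_spl]; tauto, hue⟩

theorem reach_add {E : Finset (Sym2 ℕ)} (h : Reach E) {a b : ℕ} (ha : a ∈ vs E) (hb : b ∈ vs E) (hab : a ≠ b) :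
    Reach (insert s(a, b) E) := by
  by_cases hm : s(a, b) ∈ E
  · rwa [Finset.insert_eq_of_mem hm]
  obtain ⟨G₀, G, hK, hR, hE, hV⟩ := h
  refine ⟨G₀, ⟨G.verts, insert s(a, b) E, ?_, ?_⟩, hK, hR.tail (Or.inr ?_), rfl, ?_⟩
  · intro e he
    rw [Finset.mem_insert] at he
    rcases he with rfl | he
    · simpa using hab
    · exact G.not_isDiag e (hE ▸ he)
  · intro e he v hv
    rw [hV, ← vs_insert ha hb]
    exact mem_vs.2 ⟨e, he, hv⟩
  · exact ⟨a, b, by rw [hV]; exact ha, by rw [hV]; exact hb, hab, by rw [hE]; exact hm, rfl, by simp [hE]⟩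
  · show G.verts = _
    rw [vs_insert ha hb, hV]

theorem reach_spl {E : Finset (Sym2 ℕ)} (h : Reach E) {v x y z : ℕ} (hxy : s(x, y) ∈ E) (hz : z ∈ vs E)
    (hzx : z ≠ x) (hzy : z ≠ y) (hv : v ∉ vs E) : Reach (spl E v x y z) := by
  obtain ⟨G₀, G, hK, hR, hE, hV⟩ := h
  have hx := mem_vs_left hxy
  have hy := mem_vs_right hxy
  refine ⟨G₀, ⟨insert v G.verts, spl E v x y z, ?_, ?_⟩, hK, hR.tail (Or.inl ?_), rfl, ?_⟩
  · intro e he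
    rw [mem_spl] at he
    rcases he with rfl | rfl | rfl | h'
    · simp only [Sym2.mk_isDiag_iff]; rintro rfl; exact hv hx
    · simp only [Sym2.mk_isDiag_iff]; rintro rfl; exact hv hy
    · simp only [Sym2.mk_isDiag_iff]; rintro rfl; exact hv hz
    · exact G.not_isDiag e (hE ▸ h'.2)
  · intro e he u hu
    rw [hV, ← vs_spl hxy hz]
    exact mem_vs.2 ⟨e, he, hu⟩
  · refine ⟨v, x, y, z, ?_, ?_, ?_, ?_, hzx, hzy, ?_, rfl, ?_⟩
    · rw [hV]; exact hv
    · rw [hV]; exact hx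
    · rw [hV]; exact hy
    · rw [hV]; exact hz
    · rw [hE]; exact hxy
    · show spl E v x y z = _
      rw [hE]
      ext e
      simp only [mem_spl, Finset.mem_insert, Finset.mem_erase]
  · show insert v G.verts = _
    rw [vs_spl hxy hz, hV]

theorem insert_erase_or (E : Finset (Sym2 ℕ)) (e : Sym2 ℕ) : E.erase e = E ∨ insert e (E.erase e) = E := by
  by_cases h : e ∈ E
  · exact Or.inr (Finset.insert_erase h)
  · exact Or.inl (Finset.erase_eq_of_notMem h)

theorem conn_of_erase {E : Finset (Sym2 ℕ)} {c d : ℕ} (h : Conn (E.erase s(c, d)))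
    (hc : c ∈ vs (E.erase s(c, d))) (hd : d ∈ vs (E.erase s(c, d))) (hcd : c ≠ d) : Conn E := by
  rcases insert_erase_or E s(c, d) with h' | h'
  · rwa [h'] at h
  · rw [← h']; exact conn_add h hc hd hcd

theorem reach_of_erase {E : Finset (Sym2 ℕ)} {c d : ℕ} (h : Reach (E.erase s(c, d)))
    (hc : c ∈ vs (E.erase s(c, d))) (hd : d ∈ vs (E.erase s(c, d))) (hcd : c ≠ d) : Reach E := by
  rcases insert_erase_or E s(c, d) with h' | h'
  · rwa [h'] at h
  · rw [← h']; exact reach_add h hc hd hcd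

/-- subdivision -/
def sbd (P : Finset (Sym2 ℕ)) (v x y : ℕ) : Finset (Sym2 ℕ) :=
  insert s(v, x) (insert s(v, y) (P.erase s(x, y)))

theorem mem_sbd {P : Finset (Sym2 ℕ)} {v x y : ℕ} {e : Sym2 ℕ} :
    e ∈ sbd P v x y ↔ e = s(v, x) ∨ e = s(v, y) ∨ (e ≠ s(x, y) ∧ e ∈ P) := by
  simp [sbd]

theorem vs_sbd {P : Finset (Sym2 ℕ)} {v x y : ℕ} (hxy : s(x, y) ∈ P) : vs (sbd P v x y) = insert v (vs P) := by
  ext u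
  rw [mem_vs, Finset.mem_insert]
  constructor
  · rintro ⟨e, he, hu⟩
    rw [mem_sbd] at he
    rcases he with rfl | rfl | h'
    · rw [Sym2.mem_iff] at hu
      rcases hu with rfl | rfl
      · exact Or.inl rfl
      · exact Or.inr (mem_vs_left hxy)
    · rw [Sym2.mem_iff] at hu
      rcases hu with rfl | rfl
      · exact Or.inl rfl
      · exact Or.inr (mem_vs_right hxy)
    · exact Or.inr (mem_vs.2 ⟨e, h'.2, hu⟩)
  · rintro (rfl | hu)
    · exact ⟨s(u, x), by rw [mem_sbd]; tauto, by simp⟩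
    · obtain ⟨e, he, hue⟩ := mem_vs.1 hu
      by_cases h' : e = s(x, y)
      · subst h'
        rw [Sym2.mem_iff] at hue
        rcases hue with rfl | rfl
        · exact ⟨s(v, u), by rw [mem_sbd]; tauto, by simp⟩
        · exact ⟨s(v, u), by rw [mem_sbd]; tauto, by simp⟩
      · exact ⟨e, by rw [mem_sbd]; tauto, hue⟩

/-- outer part of a 2-separation with a distinguished vertex -/
structure Outer (Q : Finset (Sym2 ℕ)) (c d t : ℕ) : Prop where
  o1 : ∀ P z, Conn P → 1 < #P → s(c, d) ∈ P → vs P ∩ vs Q = {c, d} → z ∈ vs P → z ∉ vs Q →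
    Conn (insert s(z, t) ((P ∪ Q).erase s(c, d)))
  o2 : ∀ z, z ∉ vs Q → Conn (Q ∪ {s(z, c), s(z, d), s(z, t)})

theorem vs_glue {P Q : Finset (Sym2 ℕ)} {c d : ℕ} (hP : Conn P) (h1 : 1 < #P) :
    vs P ⊆ vs ((P ∪ Q).erase s(c, d)) := by
  intro v hv
  obtain ⟨a, b, e, hab, _, _, ha, hb, _⟩ := hP.deg h1 hv
  by_cases h' : s(v, a) = s(c, d)
  · refine mem_vs_left (b := b) (Finset.mem_erase.2 ⟨?_, Finset.mem_union_left _ hb⟩)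
    intro h''
    rw [← h', Sym2.eq_iff] at h''
    rcases h'' with h'' | h''
    · exact hab h''.2.symm
    · exact hab (h''.1.symm.trans h''.2.symm)
  · exact mem_vs_left (Finset.mem_erase.2 ⟨h', Finset.mem_union_left _ ha⟩)

theorem outer_conn {Q : Finset (Sym2 ℕ)} (hQ : Conn Q) (h1 : 1 < #Q) {c d t : ℕ} (hcd : s(c, d) ∈ Q) (ht : t ∈ vs Q)
    (htc : t ≠ c) (htd : t ≠ d) : Outer Q c d t := by
  constructor
  · intro P z hP hP1 hcdP hv hz hzQ
    refine conn_add (conn_two_sum hP hQ hcdP hcd hv hP1 h1) (vs_glue hP hP1 hz) ?_ ?_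
    · rw [Finset.union_comm]; exact vs_glue hQ h1 ht
    · rintro rfl; exact hzQ ht
  · intro z hz
    have h := conn_spl hQ hcd ht htc htd hz
    have hne : c ≠ d := hQ.1.ne hcd
    have h2 := conn_add h (a := c) (b := d) (by rw [vs_spl hcd ht]; simp [mem_vs_left hcd])
      (by rw [vs_spl hcd ht]; simp [mem_vs_right hcd]) hne
    have e : insert s(c, d) (spl Q z c d t) = Q ∪ {s(z, c), s(z, d), s(z, t)} := by
      ext e
      simp only [Finset.mem_insert, mem_spl, Finset.mem_union, Finset.mem_singleton]
      constructor
      · rintro (rfl | h' | h' | h' | h') <;> tauto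
      · tauto
    rwa [e] at h2

theorem outer_sbd_aux {R : Finset (Sym2 ℕ)} (hR : Conn R) {c d t x y z : ℕ} (hcd : s(c, d) ∈ R)
    (hxy : s(x, y) ∈ R) (ht : t ∉ vs R) (hz : z ∉ insert t (vs R)) (hcx : c ≠ x) (hcy : c ≠ y) :
    Conn (sbd R t x y ∪ {s(z, c), s(z, d), s(z, t)}) := by
  have hc := mem_vs_left hcd
  have hd := mem_vs_right hcd
  have hne := hR.1.ne hcd
  have h1 := conn_spl hR hxy hc hcx hcy ht
  have hv1 := vs_spl (v := t) hxy hc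
  have hdt : d ≠ t := by rintro rfl; exact ht hd
  have h2 := conn_spl h1 (x := t) (y := c) (z := d) (v := z) (by rw [mem_spl]; tauto)
    (by rw [hv1]; simp [hd]) hdt hne.symm (by rw [hv1]; exact hz)
  have e : spl (spl R t x y c) z t c d = sbd R t x y ∪ {s(z, c), s(z, d), s(z, t)} := by
    ext e
    simp only [Finset.mem_insert, mem_spl, Finset.mem_union, Finset.mem_singleton, mem_sbd]
    have hn1 : s(t, x) ≠ s(t, c) := by
      rw [Ne, Sym2.eq_iff]; rintro (h | h)
      · exact hcx h.2.symm
      · exact hcx (h.1.symm.trans h.2.symm)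
    have hn2 : s(t, y) ≠ s(t, c) := by
      rw [Ne, Sym2.eq_iff]; rintro (h | h)
      · exact hcy h.2.symm
      · exact hcy (h.1.symm.trans h.2.symm)
    have hn3 : ∀ e ∈ R, e ≠ s(t, c) := by
      rintro e he rfl
      exact ht (mem_vs_left he)
    constructor
    · rintro (rfl | rfl | rfl | ⟨h3, rfl | rfl | rfl | h4⟩) <;> tauto
    · rintro ((rfl | rfl | ⟨h3, h4⟩) | (rfl | rfl | rfl))
      · exact Or.inr (Or.inr (Or.inr ⟨hn1, by tauto⟩))
      · exact Or.inr (Or.inr (Or.inr ⟨hn2, by tauto⟩))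
      · exact Or.inr (Or.inr (Or.inr ⟨hn3 e h4, by tauto⟩))
      · tauto
      · tauto
      · tauto
  rwa [e] at h2

theorem outer_sbd {R : Finset (Sym2 ℕ)} (hR : Conn R) (h1 : 1 < #R) {c d t x y : ℕ} (hcd : s(c, d) ∈ R)
    (hxy : s(x, y) ∈ R) (hne : s(x, y) ≠ s(c, d)) (ht : t ∉ vs R) : Outer (sbd R t x y) c d t := by
  have hv := vs_sbd (v := t) hxy
  have hcdn := hR.1.ne hcd
  constructor
  · intro P z hP hP1 hcdP hPQ hz hzQ
    rw [hv] at hPQ hzQ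
    have htc : t ≠ c := by rintro rfl; exact ht (mem_vs_left hcd)
    have htd : t ≠ d := by rintro rfl; exact ht (mem_vs_right hcd)
    have htP : t ∉ vs P := by
      intro h'
      have : t ∈ vs P ∩ insert t (vs R) := by simp [h']
      rw [hPQ] at this
      simp only [Finset.mem_insert, Finset.mem_singleton] at this
      tauto
    have hPR : vs P ∩ vs R = {c, d} := by
      rw [← hPQ]
      ext u
      simp only [Finset.mem_inter, Finset.mem_insert]
      constructor
      · tauto
      · rintro ⟨h1, rfl | h2⟩
        · exact absurd h1 htP
        · exact ⟨h1, h2⟩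
    have hG := conn_two_sum hP hR hcdP hcd hPR hP1 h1
    have hzR : z ∉ vs R := fun h' => hzQ (by simp [h'])
    have h2 := conn_spl hG (v := t) (x := x) (y := y) (z := z)
      (Finset.mem_erase.2 ⟨hne, Finset.mem_union_right _ hxy⟩) (vs_glue hP hP1 hz)
      (by rintro rfl; exact hzR (mem_vs_left hxy)) (by rintro rfl; exact hzR (mem_vs_right hxy))
      (by
        intro h'
        have := vs_mono (Finset.erase_subset _ _) h'
        obtain ⟨e, he, hte⟩ := mem_vs.1 this
        rw [Finset.mem_union] at he
        rcases he with he | he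
        · exact htP (mem_vs.2 ⟨e, he, hte⟩)
        · exact ht (mem_vs.2 ⟨e, he, hte⟩))
    have e : spl ((P ∪ R).erase s(c, d)) t x y z = insert s(z, t) ((P ∪ sbd R t x y).erase s(c, d)) := by
      ext e
      simp only [mem_spl, Finset.mem_insert, Finset.mem_erase, Finset.mem_union, mem_sbd]
      have hn : ∀ u, s(t, u) ≠ s(c, d) := by
        intro u h'
        rw [Sym2.eq_iff] at h'
        rcases h' with h' | h'
        · exact htc h'.1
        · exact htd h'.1
      have hPx : ∀ e ∈ P, e ≠ s(c, d) → e ≠ s(x, y) := by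
        rintro e he h1 rfl
        have hx : x ∈ vs P ∩ vs R := Finset.mem_inter.2 ⟨mem_vs_left he, mem_vs_left hxy⟩
        have hy : y ∈ vs P ∩ vs R := Finset.mem_inter.2 ⟨mem_vs_right he, mem_vs_right hxy⟩
        rw [hPR] at hx hy
        exact hne (edge_eq_of_mem (hR.1 _ hxy) (Finset.mk_mem_sym2_iff.2 ⟨hx, hy⟩))
      rw [show s(z, t) = s(t, z) from Sym2.eq_swap]
      constructor
      · rintro (rfl | rfl | rfl | ⟨h3, h4, h5⟩)
        · exact Or.inr ⟨hn _, by tauto⟩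
        · exact Or.inr ⟨hn _, by tauto⟩
        · tauto
        · exact Or.inr ⟨h4, by tauto⟩
      · rintro (rfl | ⟨h3, h4 | rfl | rfl | ⟨h5, h6⟩⟩)
        · tauto
        · exact Or.inr (Or.inr (Or.inr ⟨hPx e h4 h3, h3, Or.inl h4⟩))
        · tauto
        · tauto
        · exact Or.inr (Or.inr (Or.inr ⟨h5, h3, Or.inr h6⟩))
    rwa [e] at h2
  · intro z hz
    rw [hv] at hz
    by_cases hc : c ≠ x ∧ c ≠ y
    · exact outer_sbd_aux hR hcd hxy ht hz hc.1 hc.2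
    · have hd : d ≠ x ∧ d ≠ y := by
        constructor
        · rintro rfl
          apply hne
          rw [Sym2.eq_iff]; tauto
        · rintro rfl
          apply hne
          rw [Sym2.eq_iff]; tauto
      have := outer_sbd_aux hR (c := d) (d := c) (by rw [Sym2.eq_swap]; exact hcd) hxy ht hz hd.1 hd.2
      convert this using 2
      ext e
      simp only [Finset.mem_insert, Finset.mem_singleton]
      tauto

open Finset

/-- a separation of order at most two -/
structure Sp2 (E : Finset (Sym2 ℕ)) (A B : Finset ℕ) : Prop where
  un : A ∪ B = vs E
  cd : #(A ∩ B) ≤ 2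
  l : ¬ A ⊆ B
  r : ¬ B ⊆ A
  no : ∀ a b, a ∈ A → a ∉ B → b ∈ B → b ∉ A → s(a, b) ∉ E

theorem Sp2.symm {E : Finset (Sym2 ℕ)} {A B : Finset ℕ} (h : Sp2 E A B) : Sp2 E B A := by
  refine ⟨by rw [Finset.union_comm]; exact h.un, by rw [Finset.inter_comm]; exact h.cd, h.r, h.l, ?_⟩
  intro a b h1 h2 h3 h4 h5
  rw [Sym2.eq_swap] at h5
  exact h.no b a h3 h4 h1 h2 h5

theorem Sp2.cov {E : Finset (Sym2 ℕ)} {A B : Finset ℕ} (h : Sp2 E A B) :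
    ∀ e ∈ E, e ∈ A.sym2 ∨ e ∈ B.sym2 := by
  intro e
  induction e with
  | _ a b =>
    intro he
    have ha := mem_vs_left he
    have hb := mem_vs_right he
    rw [← h.un, Finset.mem_union] at ha hb
    have h1 := h.no a b
    have h2 := h.symm.no a b
    simp only [Finset.mk_mem_sym2_iff]
    tauto

theorem sep_of_not_TC {E : Finset (Sym2 ℕ)} (h3 : 3 < #(vs E)) (h : ¬ TC E) : ∃ A B, Sp2 E A B := by
  unfold TC at h
  push Not at h
  obtain ⟨A, B, h1, h2, h3, h4, h5⟩ := h h3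
  exact ⟨A, B, h1, h2, h3, h4, fun a b ha ha' hb hb' => h5 a ha b hb ha' hb'⟩

theorem TC.no_sep {E : Finset (Sym2 ℕ)} (h : TC E) {A B : Finset ℕ} (hS : Sp2 E A B) : False := by
  obtain ⟨a, ha, b, hb, h1, h2, h3⟩ := h.2 A B hS.un hS.cd hS.l hS.r
  exact hS.no a b ha h1 hb h2 h3

theorem TC.deg {E : Finset (Sym2 ℕ)} (h : TC E) (hN : Nd E) {v : ℕ} (hv : v ∈ vs E) : 3 ≤ #(nb E v) := by
  by_contra! hcon
  have hsub : nb E v ⊆ vs E := fun u hu => mem_vs_right (mem_nb.1 hu)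
  have hvn : ∀ u ∈ nb E v, u ≠ v := by
    rintro u hu rfl
    exact hN.ne (mem_nb.1 hu) rfl
  obtain ⟨a, ha, b, hb, h1, h2, h3⟩ := h.2 (insert v (nb E v)) ((vs E).erase v)
    (by
      ext u
      simp only [Finset.mem_union, Finset.mem_insert, Finset.mem_erase]
      constructor
      · rintro ((rfl | h') | h')
        · exact hv
        · exact hsub h'
        · exact h'.2
      · tauto)
    (by
      refine le_trans (Finset.card_le_card (t := nb E v) ?_) (by omega)
      intro u hu
      simp only [Finset.mem_inter, Finset.mem_insert, Finset.mem_erase] at hu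
      tauto)
    (fun h' => by simpa using h' (Finset.mem_insert_self v _))
    (fun h' => by
      have h4 : vs E ⊆ insert v (nb E v) := by
        intro u hu
        by_cases hu' : u = v
        · simp [hu']
        · exact h' (by simp [hu, hu'])
      have h5 := Finset.card_le_card h4
      have h6 := Finset.card_insert_le v (nb E v)
      have := h.1
      omega)
  have hav : a = v := by
    rw [Finset.mem_insert] at ha
    rcases ha with rfl | ha
    · rfl
    · exact absurd (by simp [hvn a ha, hsub ha]) h1
  subst hav
  exact h2 (Finset.mem_insert_of_mem (mem_nb.2 h3))

/-- connectivity inside a vertex set -/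
def TwoC (E : Finset (Sym2 ℕ)) (W : Finset ℕ) : Prop :=
  ∀ A B, W ⊆ A ∪ B → ¬ W ⊆ A → ¬ W ⊆ B → #(A ∩ B ∩ W) ≤ 1 →
    ∃ a ∈ W, ∃ b ∈ W, a ∈ A ∧ a ∉ B ∧ b ∈ B ∧ b ∉ A ∧ s(a, b) ∈ E

theorem TwoC.mono {E E' : Finset (Sym2 ℕ)} {W : Finset ℕ} (h : TwoC E W) (hE : E ⊆ E') : TwoC E' W := by
  intro A B h1 h2 h3 h4
  obtain ⟨a, ha, b, hb, h5, h6, h7, h8, h9⟩ := h A B h1 h2 h3 h4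
  exact ⟨a, ha, b, hb, h5, h6, h7, h8, hE h9⟩

theorem twoC_of_conn {P : Finset (Sym2 ℕ)} (hP : Conn P) (h1 : 1 < #P) (e : Sym2 ℕ) :
    TwoC (P.erase e) (vs P) := by
  intro A B hW hA hB hc
  obtain ⟨F, hF, hS, hT, _⟩ := rig_erase hP h1 e
  obtain ⟨a, ha, b, hb, h2, h3, h4⟩ := tight_cut (U := vs P) (A := A ∩ vs P) (B := B ∩ vs P) hS.1 (hS.lsp _)
    subset_rfl hT
    (by rw [← Finset.union_inter_distrib_right]; exact Finset.inter_eq_right.2 hW)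
    (fun h' => hA (fun u hu => by
      by_contra hua
      have := hW hu
      rw [Finset.mem_union] at this
      exact hua (Finset.mem_inter.1 (h' (Finset.mem_inter.2 ⟨this.resolve_left hua, hu⟩))).1))
    (fun h' => hB (fun u hu => by
      by_contra hua
      have := hW hu
      rw [Finset.mem_union] at this
      exact hua (Finset.mem_inter.1 (h' (Finset.mem_inter.2 ⟨this.resolve_right hua, hu⟩))).1))
    (by
      refine le_trans (Finset.card_le_card ?_) hc
      intro u hu
      simp only [Finset.mem_inter] at hu ⊢
      tauto)
  rw [Finset.mem_inter] at ha hb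
  exact ⟨a, ha.2, b, hb.2, ha.1, fun h => h2 (Finset.mem_inter.2 ⟨h, ha.2⟩), hb.1,
    fun h => h3 (Finset.mem_inter.2 ⟨h, hb.2⟩), hF h4⟩

theorem twoC_sbd_aux {F : Finset (Sym2 ℕ)} {V : Finset ℕ} (h : TwoC F V) {x y z : ℕ}
    (hx : x ∈ V) (hy : y ∈ V) (hne : x ≠ y) {A B : Finset ℕ}
    (h1 : insert z V ⊆ A ∪ B) (h2 : ¬ insert z V ⊆ A)
    (h4 : #(A ∩ B ∩ insert z V) ≤ 1) (hzA : z ∈ A) (hzB : z ∉ B) :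
    ∃ a ∈ insert z V, ∃ b ∈ insert z V, a ∈ A ∧ a ∉ B ∧ b ∈ B ∧ b ∉ A ∧ s(a, b) ∈ sbd F z x y := by
  have hxm : x ∈ insert z V := by simp [hx]
  have hym : y ∈ insert z V := by simp [hy]
  have hzm : z ∈ insert z V := by simp
  by_cases hxA : x ∈ A
  · by_cases hyA : y ∈ A
    · obtain ⟨a, ha, b, hb, h5, h6, h7, h8, h9⟩ := h A B ((Finset.subset_insert _ _).trans h1)
        (fun h' => h2 (Finset.insert_subset hzA h'))
        (fun h' => by
          have : ({x, y} : Finset ℕ) ⊆ A ∩ B ∩ insert z V := by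
            intro u hu
            simp only [Finset.mem_insert, Finset.mem_singleton] at hu
            rcases hu with rfl | rfl
            · simp [hx, hxA, h' hx]
            · simp [hy, hyA, h' hy]
          have := Finset.card_le_card this
          rw [Finset.card_pair hne] at this
          omega)
        (le_trans (Finset.card_le_card (Finset.inter_subset_inter_left (Finset.subset_insert _ _))) h4)
      refine ⟨a, by simp [ha], b, by simp [hb], h5, h6, h7, h8, mem_sbd.2 (Or.inr (Or.inr ⟨?_, h9⟩))⟩
      intro h'
      rw [Sym2.eq_iff] at h'
      rcases h' with ⟨rfl, rfl⟩ | ⟨rfl, rfl⟩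
      · exact h8 hyA
      · exact h8 hxA
    · have := h1 hym
      rw [Finset.mem_union] at this
      exact ⟨z, hzm, y, hym, hzA, hzB, this.resolve_left hyA, hyA, mem_sbd.2 (Or.inr (Or.inl rfl))⟩
  · have := h1 hxm
    rw [Finset.mem_union] at this
    exact ⟨z, hzm, x, hxm, hzA, hzB, this.resolve_left hxA, hxA, mem_sbd.2 (Or.inl rfl)⟩

theorem twoC_sbd_mid {F : Finset (Sym2 ℕ)} {V : Finset ℕ} (h : TwoC F V) (h3 : 3 ≤ #V) {x y : ℕ}
    (hx : x ∈ V) (hy : y ∈ V) {A B : Finset ℕ}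
    (h1 : V ⊆ A ∪ B) (h4 : A ∩ B ∩ V = ∅) (hxA : x ∈ A) (hyB : y ∈ B) :
    ∃ a ∈ V, ∃ b ∈ V, a ∈ A ∧ a ∉ B ∧ b ∈ B ∧ b ∉ A ∧ s(a, b) ∈ F ∧ s(a, b) ≠ s(x, y) := by
  have hdis : ∀ u ∈ V, u ∈ A → u ∉ B := by
    intro u hu hA hB
    have : u ∈ A ∩ B ∩ V := by simp [hu, hA, hB]
    rw [h4] at this
    simp at this
  have hxB := hdis x hx hxA
  have hyA : y ∉ A := fun h' => hdis y hy h' hyB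
  by_cases hc : V ⊆ insert y A
  · -- B ∩ V = {y}
    have hc2 : ¬ V ⊆ insert x B := by
      intro h'
      have : V ⊆ {x, y} := by
        intro u hu
        have h5 := hc hu
        have h6 := h' hu
        have h7 := hdis u hu
        simp only [Finset.mem_insert, Finset.mem_singleton] at h5 h6 ⊢
        tauto
      have := Finset.card_le_card this
      have := Finset.card_le_two (a := x) (b := y)
      omega
    obtain ⟨a, ha, b, hb, h5, h6, h7, h8, h9⟩ := h A (insert x B)
      (h1.trans (Finset.union_subset_union_right (Finset.subset_insert _ _)))
      (fun h' => hyA (h' hy)) hc2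
      (by
        refine le_trans (Finset.card_le_card (t := {x}) ?_) (by simp)
        intro u hu
        simp only [Finset.mem_inter, Finset.mem_insert, Finset.mem_singleton] at hu ⊢
        have := hdis u hu.2 hu.1.1
        tauto)
    simp only [Finset.mem_insert, not_or] at h6 h7
    refine ⟨a, ha, b, hb, h5, h6.2, ?_, h8, h9, ?_⟩
    · rcases h7 with rfl | h7
      · exact absurd hxA h8
      · exact h7
    · intro h'
      rw [Sym2.eq_iff] at h'
      rcases h' with h' | h'
      · exact h6.1 h'.1
      · rw [h'.1] at h5; exact hyA h5
  · obtain ⟨a, ha, b, hb, h5, h6, h7, h8, h9⟩ := h (insert y A) B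
      (h1.trans (Finset.union_subset_union_left (Finset.subset_insert _ _))) hc
      (fun h' => hxB (h' hx))
      (by
        refine le_trans (Finset.card_le_card (t := {y}) ?_) (by simp)
        intro u hu
        simp only [Finset.mem_inter, Finset.mem_insert, Finset.mem_singleton] at hu ⊢
        have := hdis u hu.2
        tauto)
    simp only [Finset.mem_insert, not_or] at h5 h8
    refine ⟨a, ha, b, hb, ?_, h6, h7, h8.2, h9, ?_⟩
    · rcases h5 with rfl | h5
      · exact absurd hyB h6
      · exact h5
    · intro h'
      rw [Sym2.eq_iff] at h'
      rcases h' with h' | h'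
      · exact h8.1 h'.2
      · rw [h'.2] at h7; exact hxB h7

theorem twoC_sbd {F : Finset (Sym2 ℕ)} {V : Finset ℕ} (h : TwoC F V) (h3 : 3 ≤ #V) {x y z : ℕ}
    (hx : x ∈ V) (hy : y ∈ V) (hne : x ≠ y) (hz : z ∉ V) : TwoC (sbd F z x y) (insert z V) := by
  intro A B h1 h2 h2' h4
  by_cases hzB : z ∈ B
  · by_cases hzA : z ∈ A
    · have hV1 : V ⊆ A ∪ B := (Finset.subset_insert _ _).trans h1
      have hemp : A ∩ B ∩ V = ∅ := by
        by_contra hcon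
        obtain ⟨u, hu⟩ := Finset.nonempty_iff_ne_empty.2 hcon
        have hsub : ({z, u} : Finset ℕ) ⊆ A ∩ B ∩ insert z V := by
          intro w hw
          simp only [Finset.mem_insert, Finset.mem_singleton, Finset.mem_inter] at hw hu ⊢
          rcases hw with rfl | rfl <;> tauto
        have hzu : z ≠ u := by
          rintro rfl
          exact hz (Finset.mem_inter.1 hu).2
        have := Finset.card_le_card hsub
        rw [Finset.card_pair hzu] at this
        omega
      have fin : (∃ a ∈ V, ∃ b ∈ V, a ∈ A ∧ a ∉ B ∧ b ∈ B ∧ b ∉ A ∧ s(a, b) ∈ F ∧ s(a, b) ≠ s(x, y)) →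
          ∃ a ∈ insert z V, ∃ b ∈ insert z V, a ∈ A ∧ a ∉ B ∧ b ∈ B ∧ b ∉ A ∧ s(a, b) ∈ sbd F z x y := by
        rintro ⟨a, ha, b, hb, h5, h6, h7, h8, h9, h10⟩
        exact ⟨a, by simp [ha], b, by simp [hb], h5, h6, h7, h8, mem_sbd.2 (Or.inr (Or.inr ⟨h10, h9⟩))⟩
      apply fin
      obtain ⟨a, ha, b, hb, h5, h6, h7, h8, h9⟩ := h A B hV1
        (fun h' => h2 (Finset.insert_subset hzA h')) (fun h' => h2' (Finset.insert_subset hzB h'))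
        (by rw [hemp]; simp)
      by_cases hc : s(a, b) = s(x, y)
      · have := twoC_sbd_mid h h3 ha hb hV1 hemp h5 h7
        rwa [hc] at this
      · exact ⟨a, ha, b, hb, h5, h6, h7, h8, h9, hc⟩
    · obtain ⟨a, ha, b, hb, h5, h6, h7, h8, h9⟩ := twoC_sbd_aux h hx hy hne (A := B) (B := A)
        (by rwa [Finset.union_comm]) h2' (by rwa [Finset.inter_comm B A]) hzB hzA
      exact ⟨b, hb, a, ha, h7, h8, h5, h6, by rw [Sym2.eq_swap]; exact h9⟩
  · have hzA : z ∈ A := by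
      have := h1 (Finset.mem_insert_self z V)
      rw [Finset.mem_union] at this
      tauto
    exact twoC_sbd_aux h hx hy hne h1 h2 h4 hzA hzB

open Finset

/-- configurations: a Henneberg-type reduction of E whose result has a small separation -/
inductive Cfg (E : Finset (Sym2 ℕ)) (A : Finset ℕ) (m : ℕ) : Prop
  | add (E2 : Finset (Sym2 ℕ)) (B : Finset ℕ) (a b : ℕ) : Conn E2 → Sp2 E2 A B → a ∈ vs E2 → b ∈ vs E2 →
      a ≠ b → E = insert s(a, b) E2 → m = #A → Cfg E A m
  | splOut (E2 : Finset (Sym2 ℕ)) (B : Finset ℕ) (v x y z : ℕ) : Conn E2 → Sp2 E2 A B → s(x, y) ∈ E2 →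
      z ∈ vs E2 → z ≠ x → z ≠ y → v ∉ vs E2 → E = spl E2 v x y z → s(x, y) ∉ A.sym2 → m = #A → Cfg E A m
  | splIn (E2 : Finset (Sym2 ℕ)) (B : Finset ℕ) (v x y z : ℕ) : Conn E2 → Sp2 E2 A B → s(x, y) ∈ E2 →
      z ∈ vs E2 → z ≠ x → z ≠ y → v ∉ vs E2 → E = spl E2 v x y z → s(x, y) ∈ A.sym2 → m = #A + 1 → Cfg E A m

theorem nb_three {E : Finset (Sym2 ℕ)} {w x y : ℕ} (h3 : #(nb E w) = 3) (hx : x ∈ nb E w) (hy : y ∈ nb E w)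
    (hne : x ≠ y) : ∃ r, r ≠ x ∧ r ≠ y ∧ nb E w = {x, y, r} := by
  have hsub : ({x, y} : Finset ℕ) ⊆ nb E w := by
    intro u hu
    simp only [Finset.mem_insert, Finset.mem_singleton] at hu
    rcases hu with rfl | rfl
    · exact hx
    · exact hy
  have hc : #(nb E w \ {x, y}) = 1 := by
    rw [Finset.card_sdiff_of_subset hsub, h3, Finset.card_pair hne]
  obtain ⟨r, hr⟩ := Finset.card_eq_one.1 hc
  have hr' : r ∈ nb E w \ {x, y} := by rw [hr]; simp
  simp only [Finset.mem_sdiff, Finset.mem_insert, Finset.mem_singleton, not_or] at hr'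
  refine ⟨r, hr'.2.1, hr'.2.2, ?_⟩
  rw [← Finset.sdiff_union_of_subset hsub, hr]
  ext u
  simp only [Finset.mem_union, Finset.mem_insert, Finset.mem_singleton]
  tauto

theorem mem_Red {E : Finset (Sym2 ℕ)} {w x y : ℕ} {e : Sym2 ℕ} :
    e ∈ Red E w x y ↔ e = s(x, y) ∨ (e ∈ E ∧ w ∉ e) := by
  simp [Red]

theorem spl_Red {E : Finset (Sym2 ℕ)} {w p q r : ℕ} (hnb : nb E w = {p, q, r})
    (hpq : s(p, q) ∉ E) : spl (Red E w p q) w p q r = E := by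
  have hm : ∀ u, u ∈ nb E w ↔ u = p ∨ u = q ∨ u = r := by rw [hnb]; simp
  ext e
  rw [mem_spl, mem_Red]
  constructor
  · rintro (rfl | rfl | rfl | h')
    · exact mem_nb.1 ((hm p).2 (by tauto))
    · exact mem_nb.1 ((hm q).2 (by tauto))
    · exact mem_nb.1 ((hm r).2 (by tauto))
    · tauto
  · intro he
    by_cases hw : w ∈ e
    · obtain ⟨u, rfl⟩ := Sym2.mem_iff_exists.1 hw
      have := (hm u).1 (mem_nb.2 he)
      rcases this with rfl | rfl | rfl <;> tauto
    · have : e ≠ s(p, q) := by rintro rfl; exact hpq he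
      tauto

theorem not_mem_vs_Red {E : Finset (Sym2 ℕ)} {w p q : ℕ} (hp : w ≠ p) (hq : w ≠ q) : w ∉ vs (Red E w p q) := by
  intro h
  obtain ⟨e, he, hw⟩ := mem_vs.1 h
  rw [mem_Red] at he
  rcases he with rfl | he
  · rw [Sym2.mem_iff] at hw; tauto
  · exact he.2 hw

theorem vs_Red {E : Finset (Sym2 ℕ)} (hdeg : ∀ u ∈ vs E, 3 ≤ #(nb E u)) {w p q : ℕ} (hp : w ≠ p) (hq : w ≠ q)
    (hpE : p ∈ vs E) (hqE : q ∈ vs E) : vs (Red E w p q) = (vs E).erase w := by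
  ext u
  rw [Finset.mem_erase]
  constructor
  · intro hu
    refine ⟨by rintro rfl; exact not_mem_vs_Red hp hq hu, ?_⟩
    obtain ⟨e, he, hw⟩ := mem_vs.1 hu
    rw [mem_Red] at he
    rcases he with rfl | he
    · rw [Sym2.mem_iff] at hw
      rcases hw with rfl | rfl
      · exact hpE
      · exact hqE
    · exact mem_vs.2 ⟨e, he.1, hw⟩
  · rintro ⟨h1, h2⟩
    have := hdeg u h2
    obtain ⟨t, ht, htw⟩ := Finset.exists_mem_ne (show 1 < #(nb E u) by omega) w
    rw [mem_nb] at ht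
    refine mem_vs_left (b := t) (mem_Red.2 (Or.inr ⟨ht, ?_⟩))
    rw [Sym2.mem_iff]
    rintro (h | h)
    · exact h1 h.symm
    · exact htw h.symm

theorem card_Red {E : Finset (Sym2 ℕ)} {w p q : ℕ} (hp : p ∈ nb E w) (hq : q ∈ nb E w) (hpq : p ≠ q) :
    #(Red E w p q) < #E := by
  have h1 : insert s(w, p) (insert s(w, q) (E.filter (fun e => w ∉ e))) ⊆ E := by
    intro e he
    simp only [Finset.mem_insert, Finset.mem_filter] at he
    rcases he with rfl | rfl | he
    · exact mem_nb.1 hp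
    · exact mem_nb.1 hq
    · exact he.1
  have h2 := Finset.card_le_card h1
  rw [Finset.card_insert_of_notMem, Finset.card_insert_of_notMem] at h2
  · have := Finset.card_insert_le s(p, q) (E.filter (fun e => w ∉ e))
    unfold Red
    omega
  · simp
  · simp only [Finset.mem_insert, Finset.mem_filter, not_or]
    refine ⟨?_, by simp⟩
    rw [Sym2.eq_iff]
    rintro (h | h)
    · exact hpq h.2
    · exact hpq (h.2.trans h.1)

/-- frame data -/
structure Frame (E : Finset (Sym2 ℕ)) (V : Finset ℕ) (c d t : ℕ) : Prop where
  hc : c ∈ V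
  hd : d ∈ V
  hV : V ⊆ vs E
  ht : t ∈ vs E
  htV : t ∉ V
  fr : ∀ u ∈ vs E, u ∉ V → u ≠ t → ∀ v ∈ V, s(u, v) ∈ E → v = c ∨ v = d

theorem small_aux {E E2 : Finset (Sym2 ℕ)} {V W : Finset ℕ} {c d t : ℕ} (hTC : TC E) (hF : Frame E V c d t)
    (hEE : ∀ a b, a ∉ V → b ∉ V → s(a, b) ∈ E → s(a, b) ∈ E2) (hW : vs E2 = vs E \ (V \ W)) (hWsub : W ⊆ V)
    {A B : Finset ℕ} (hS : Sp2 E2 A B) (hsub : A ∩ B ⊆ W) (htA : t ∉ A) : A ⊆ W := by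
  by_contra hcon
  obtain ⟨u0, hu0, hu0W⟩ := Finset.not_subset.1 hcon
  have hA2 : ∀ u ∈ A, u ∈ vs E ∧ (u ∈ V → u ∈ W) := by
    intro u hu
    have : u ∈ vs E2 := by rw [← hS.un]; simp [hu]
    rw [hW, Finset.mem_sdiff, Finset.mem_sdiff] at this
    tauto
  have htc : t ≠ c := by rintro rfl; exact hF.htV hF.hc
  have htd : t ≠ d := by rintro rfl; exact hF.htV hF.hd
  have hUV : ∀ u, u ∈ A → u ∉ W → u ∉ V := fun u h1 h2 h3 => h2 ((hA2 u h1).2 h3)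
  refine hTC.no_sep (A := A \ W ∪ {c, d}) (B := vs E \ (A \ W)) ⟨?_, ?_, ?_, ?_, ?_⟩
  · ext u
    simp only [Finset.mem_union, Finset.mem_sdiff, Finset.mem_insert, Finset.mem_singleton]
    constructor
    · rintro ((h | rfl | rfl) | h)
      · exact (hA2 u h.1).1
      · exact hF.hV hF.hc
      · exact hF.hV hF.hd
      · exact h.1
    · tauto
  · refine le_trans (Finset.card_le_card (t := {c, d}) ?_) Finset.card_le_two
    intro u hu
    simp only [Finset.mem_inter, Finset.mem_union, Finset.mem_sdiff, Finset.mem_insert, Finset.mem_singleton] at hu ⊢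
    tauto
  · intro h
    have := h (show u0 ∈ A \ W ∪ {c, d} by simp [hu0, hu0W])
    simp [hu0, hu0W] at this
  · intro h
    have := h (show t ∈ vs E \ (A \ W) by simp [hF.ht, htA])
    simp only [Finset.mem_union, Finset.mem_sdiff, Finset.mem_insert, Finset.mem_singleton] at this
    tauto
  · intro a b ha ha' hb hb' hab
    simp only [Finset.mem_union, Finset.mem_sdiff, Finset.mem_insert, Finset.mem_singleton, not_or] at ha ha' hb hb'
    have haE : a ∈ vs E := mem_vs_left hab
    have hbE : b ∈ vs E := mem_vs_right hab
    have ha2 : a ∈ A ∧ a ∉ W := by tauto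
    have haV := hUV a ha2.1 ha2.2
    have hat : a ≠ t := by rintro rfl; exact htA ha2.1
    by_cases hbV : b ∈ V
    · have := hF.fr a haE haV hat b hbV hab
      tauto
    · have hb2 : b ∈ A ∪ B := by
        rw [hS.un, hW]
        simp [hbE, hbV]
      rw [Finset.mem_union] at hb2
      have hWV : ∀ u, u ∈ A ∩ B → u ∈ W := fun u h => hsub h
      simp only [Finset.mem_inter] at hWV
      have hbA : b ∉ A := by
        intro h
        have : b ∈ W := by tauto
        exact hbV (hWsub this)
      exact hS.no a b ha2.1 (fun h => ha2.2 (hWV a ⟨ha2.1, h⟩)) (hb2.resolve_left hbA) hbA (hEE a b haV hbV hab)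

theorem small {E E2 : Finset (Sym2 ℕ)} {V W : Finset ℕ} {c d t : ℕ} (hTC : TC E) (hF : Frame E V c d t)
    (hEE : ∀ a b, a ∉ V → b ∉ V → s(a, b) ∈ E → s(a, b) ∈ E2) (hW : vs E2 = vs E \ (V \ W)) (hWsub : W ⊆ V)
    (h2 : TwoC E2 W) {A B : Finset ℕ} (hS : Sp2 E2 A B) (hA : ¬ W ⊆ A) (hB : ¬ W ⊆ B) :
    ∃ A' B', Sp2 E2 A' B' ∧ #A' < #W := by
  have hWE : W ⊆ A ∪ B := by
    rw [hS.un, hW]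
    intro u hu
    simp only [Finset.mem_sdiff]
    exact ⟨hF.hV (hWsub hu), by tauto⟩
  have hc : 2 ≤ #(A ∩ B ∩ W) := by
    by_contra! hcon
    obtain ⟨a, ha, b, hb, h5, h6, h7, h8, h9⟩ := h2 A B hWE hA hB (by omega)
    exact hS.no a b h5 h6 h7 h8 h9
  have heq : A ∩ B ∩ W = A ∩ B :=
    Finset.eq_of_subset_of_card_le Finset.inter_subset_left (by have := hS.cd; omega)
  have hsub : A ∩ B ⊆ W := Finset.inter_eq_left.1 heq
  by_cases htA : t ∈ A
  · have htB : t ∉ B := fun h => hF.htV (hWsub (hsub (by simp [htA, h])))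
    have := small_aux hTC hF hEE hW hWsub hS.symm (by rwa [Finset.inter_comm]) htB
    exact ⟨B, A, hS.symm, Finset.card_lt_card ⟨this, hB⟩⟩
  · have := small_aux hTC hF hEE hW hWsub hS hsub htA
    exact ⟨A, B, hS, Finset.card_lt_card ⟨this, hA⟩⟩

theorem vs_erase {E : Finset (Sym2 ℕ)} (hdeg : ∀ u ∈ vs E, 3 ≤ #(nb E u)) (p q : ℕ) :
    vs (E.erase s(p, q)) = vs E := by
  apply Finset.Subset.antisymm (vs_mono (Finset.erase_subset _ _))
  intro u hu
  have := hdeg u hu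
  obtain ⟨a, b, ha, hb, hab⟩ := Finset.one_lt_card_iff.1 (show 1 < #(nb E u) by omega)
  rw [mem_nb] at ha hb
  by_cases h : s(u, a) = s(p, q)
  · refine mem_vs_left (b := b) (Finset.mem_erase.2 ⟨?_, hb⟩)
    rw [← h, Ne, Sym2.eq_iff]
    rintro (h' | h')
    · exact hab h'.2.symm
    · exact hab (h'.1.symm.trans h'.2.symm)
  · exact mem_vs_left (Finset.mem_erase.2 ⟨h, ha⟩)

theorem step_edge {E : Finset (Sym2 ℕ)} {V : Finset ℕ} {c d t : ℕ} (hN : Nd E) (hTC : TC E) (hF : Frame E V c d t)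
    (IH : ∀ E2 : Finset (Sym2 ℕ), #E2 < #E → TC E2 → Conn E2 → Reach E2)
    (IHm : ∀ A' m', m' < #V → Cfg E A' m' → Reach E)
    {p q : ℕ} (hp : p ∈ V) (hq : q ∈ V) (hpq : s(p, q) ∈ E) (hC : Conn (E.erase s(p, q)))
    (h2 : TwoC (E.erase s(p, q)) V) : Reach E := by
  have hv := vs_erase (fun u hu => hTC.deg hN hu) p q
  have hne := hN.ne hpq
  have hpE : p ∈ vs (E.erase s(p, q)) := by rw [hv]; exact mem_vs_left hpq
  have hqE : q ∈ vs (E.erase s(p, q)) := by rw [hv]; exact mem_vs_right hpq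
  by_cases hT : TC (E.erase s(p, q))
  · rw [← Finset.insert_erase hpq]
    exact reach_add (IH _ (Finset.card_erase_lt_of_mem hpq) hT hC) hpE hqE hne
  · obtain ⟨A, B, hS⟩ := sep_of_not_TC (by rw [hv]; exact hTC.1) hT
    have hcr : ∃ a ∈ V, ∃ b ∈ V, a ∉ B ∧ b ∉ A := by
      obtain ⟨a, ha, b, hb, h1, h6, h3⟩ := hTC.2 A B (by rw [hS.un, hv]) hS.cd hS.l hS.r
      have : s(a, b) = s(p, q) := by
        by_contra hcon
        exact hS.no a b ha h1 hb h6 (Finset.mem_erase.2 ⟨hcon, h3⟩)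
      rw [Sym2.eq_iff] at this
      rcases this with ⟨rfl, rfl⟩ | ⟨rfl, rfl⟩
      · exact ⟨_, hp, _, hq, h1, h6⟩
      · exact ⟨_, hq, _, hp, h1, h6⟩
    obtain ⟨a, ha, b, hb, haB, hbA⟩ := hcr
    obtain ⟨A', B', hS', hlt⟩ := small (W := V) hTC hF
      (by
        intro a b ha hb hab
        refine Finset.mem_erase.2 ⟨?_, hab⟩
        intro h
        rw [Sym2.eq_iff] at h
        rcases h with ⟨rfl, rfl⟩ | ⟨rfl, rfl⟩
        · exact ha hp
        · exact ha hq)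
      (by rw [hv]; simp) subset_rfl h2 hS (fun h => hbA (h hb)) (fun h => haB (h ha))
    exact IHm A' _ hlt (Cfg.add _ B' p q hC hS' hpE hqE hne (Finset.insert_erase hpq).symm rfl)

theorem step_node {E : Finset (Sym2 ℕ)} {V : Finset ℕ} {c d t : ℕ} (hN : Nd E) (hTC : TC E) (hF : Frame E V c d t)
    (h5 : 5 ≤ #(vs E))
    (IH : ∀ E2 : Finset (Sym2 ℕ), #E2 < #E → TC E2 → Conn E2 → Reach E2)
    (IHm : ∀ A' m', m' < #V → Cfg E A' m' → Reach E)
    {w p q r : ℕ} (hw : w ∈ V) (hp : p ∈ V) (hq : q ∈ V) (hr : r ∈ V) (hnb : nb E w = {p, q, r})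
    (hpq : s(p, q) ∉ E) (hnpq : p ≠ q) (hrp : r ≠ p) (hrq : r ≠ q) (hC : Conn (Red E w p q))
    (h2 : TwoC (Red E w p q) (V.erase w)) : Reach E := by
  have hm : ∀ u, u ∈ nb E w ↔ u = p ∨ u = q ∨ u = r := by rw [hnb]; simp
  have hpw := mem_nb.1 ((hm p).2 (by tauto))
  have hqw := mem_nb.1 ((hm q).2 (by tauto))
  have hrw := mem_nb.1 ((hm r).2 (by tauto))
  have hwp : w ≠ p := hN.ne hpw
  have hwq : w ≠ q := hN.ne hqw
  have hwr : w ≠ r := hN.ne hrw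
  have hv := vs_Red (fun u hu => hTC.deg hN hu) hwp hwq (mem_vs_right hpw) (mem_vs_right hqw)
  have hsp := spl_Red hnb hpq
  have hrR : r ∈ vs (Red E w p q) := by rw [hv]; simp [hwr.symm, mem_vs_right hrw]
  have hpqR : s(p, q) ∈ Red E w p q := mem_Red.2 (Or.inl rfl)
  have hwR := not_mem_vs_Red (E := E) hwp hwq
  have hwE : w ∈ vs E := mem_vs_left hpw
  by_cases hT : TC (Red E w p q)
  · rw [← hsp]
    exact reach_spl (IH _ (card_Red ((hm p).2 (by tauto)) ((hm q).2 (by tauto)) hnpq) hT hC) hpqR hrR hrp hrq hwR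
  · obtain ⟨A, B, hS⟩ := sep_of_not_TC (by rw [hv, Finset.card_erase_of_mem hwE]; omega) hT
    have key : ∀ A B, Sp2 (Red E w p q) A B → ¬ V.erase w ⊆ A := by
      intro A B hS hsub
      have hA : ∀ u ∈ nb E w, u ∈ A := by
        intro u hu
        rcases (hm u).1 hu with rfl | rfl | rfl
        · exact hsub (by simp [hp, hwp.symm])
        · exact hsub (by simp [hq, hwq.symm])
        · exact hsub (by simp [hr, hwr.symm])
      have hwB : w ∉ B := by
        intro h
        apply hwR
        rw [← hS.un]
        simp [h]
      have hwA : w ∉ A := by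
        intro h
        apply hwR
        rw [← hS.un]
        simp [h]
      refine hTC.no_sep (A := insert w A) (B := B) ⟨?_, ?_, ?_, ?_, ?_⟩
      · rw [Finset.insert_union, hS.un, hv, Finset.insert_erase hwE]
      · rw [Finset.insert_inter_of_notMem hwB]
        exact hS.cd
      · intro h
        exact hwB (h (Finset.mem_insert_self _ _))
      · intro h
        apply hS.r
        intro u hu
        have := h hu
        rw [Finset.mem_insert] at this
        rcases this with rfl | h'
        · exact absurd hu hwB
        · exact h'
      · intro a b ha haB hb hbA hab
        simp only [Finset.mem_insert, not_or] at ha hbA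
        rcases ha with rfl | ha
        · exact hbA.2 (hA b (mem_nb.2 hab))
        · refine hS.no a b ha haB hb hbA.2 (mem_Red.2 (Or.inr ⟨hab, ?_⟩))
          rw [Sym2.mem_iff]
          rintro (rfl | rfl)
          · exact hwA ha
          · exact hwB hb
    obtain ⟨A', B', hS', hlt⟩ := small (W := V.erase w) hTC hF
      (by
        intro a b ha hb hab
        refine mem_Red.2 (Or.inr ⟨hab, ?_⟩)
        rw [Sym2.mem_iff]
        rintro (rfl | rfl)
        · exact ha hw
        · exact hb hw)
      (by
        rw [hv]
        ext u
        simp only [Finset.mem_erase, Finset.mem_sdiff]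
        by_cases hu : u = w
        · subst hu; tauto
        · tauto) (Finset.erase_subset _ _) h2 hS (key A B hS) (key B A hS.symm)
    rw [Finset.card_erase_of_mem hw] at hlt
    by_cases hin : s(p, q) ∈ A'.sym2
    · exact IHm A' (#A' + 1) (by omega) (Cfg.splIn _ B' w p q r hC hS' hpqR hrR hrp hrq hwR hsp.symm hin rfl)
    · exact IHm A' (#A') (by omega) (Cfg.splOut _ B' w p q r hC hS' hpqR hrR hrp hrq hwR hsp.symm hin rfl)

open Finset

/-- the two sides of a separation -/
structure Sides (E P Q : Finset (Sym2 ℕ)) (A B : Finset ℕ) (c d : ℕ) : Prop where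
  ne : c ≠ d
  hAB : A ∩ B = {c, d}
  hP : Conn P
  hQ : Conn Q
  hP1 : 1 < #P
  hQ1 : 1 < #Q
  vP : vs P = A
  vQ : vs Q = B
  cP : s(c, d) ∈ P
  cQ : s(c, d) ∈ Q
  mP : ∀ e, e ≠ s(c, d) → (e ∈ P ↔ e ∈ E ∧ e ∈ A.sym2)
  mQ : ∀ e, e ≠ s(c, d) → (e ∈ Q ↔ e ∈ E ∧ e ∈ B.sym2)

theorem sides_vs {E : Finset (Sym2 ℕ)} {A B : Finset ℕ} (hS : Sp2 E A B) {c d : ℕ} (hAB : A ∩ B = {c, d}) :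
    vs (insert s(c, d) (E ∩ A.sym2)) = A := by
  have hcA : c ∈ A ∩ B := by rw [hAB]; simp
  have hdA : d ∈ A ∩ B := by rw [hAB]; simp
  rw [Finset.mem_inter] at hcA hdA
  ext u
  rw [mem_vs]
  constructor
  · rintro ⟨e, he, hu⟩
    rw [Finset.mem_insert, Finset.mem_inter] at he
    rcases he with rfl | he
    · rw [Sym2.mem_iff] at hu
      rcases hu with rfl | rfl
      · exact hcA.1
      · exact hdA.1
    · exact (Finset.mem_sym2_iff.1 he.2) u hu
  · intro hu
    by_cases huB : u ∈ B
    · have : u ∈ A ∩ B := by simp [hu, huB]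
      rw [hAB] at this
      refine ⟨s(c, d), by simp, ?_⟩
      rw [Sym2.mem_iff]
      simpa using this
    · have : u ∈ vs E := by rw [← hS.un]; simp [hu]
      obtain ⟨e, he, hue⟩ := mem_vs.1 this
      refine ⟨e, ?_, hue⟩
      rw [Finset.mem_insert, Finset.mem_inter]
      refine Or.inr ⟨he, (hS.cov e he).resolve_right ?_⟩
      intro h
      exact huB ((Finset.mem_sym2_iff.1 h) u hue)

theorem sp2_edge {E : Finset (Sym2 ℕ)} {A B : Finset ℕ} (hS : Sp2 E A B) : ∃ f ∈ E, f ∉ B.sym2 := by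
  obtain ⟨u, hu, huB⟩ := Finset.not_subset.1 hS.l
  have : u ∈ vs E := by rw [← hS.un]; simp [hu]
  obtain ⟨e, he, hue⟩ := mem_vs.1 this
  exact ⟨e, he, fun h => huB ((Finset.mem_sym2_iff.1 h) u hue)⟩

theorem sides {E : Finset (Sym2 ℕ)} (hE : Conn E) {A B : Finset ℕ} (hS : Sp2 E A B) :
    ∃ P Q c d, Sides E P Q A B c d := by
  obtain ⟨f, hf, hfB⟩ := sp2_edge hS
  obtain ⟨g, hg, hgA⟩ := sp2_edge hS.symm
  obtain ⟨c, d, hne, hAB⟩ := Finset.card_eq_two.1 (conn_sep_card hE hS.cd hS.cov hf hfB hg hgA)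
  have hAB' : B ∩ A = {c, d} := by rw [Finset.inter_comm]; exact hAB
  have hcA : c ∈ A ∩ B := by rw [hAB]; simp
  have hdA : d ∈ A ∩ B := by rw [hAB]; simp
  rw [Finset.mem_inter] at hcA hdA
  have hfA := (hS.cov f hf).resolve_right hfB
  have hgB := (hS.cov g hg).resolve_left hgA
  refine ⟨insert s(c, d) (E ∩ A.sym2), insert s(c, d) (E ∩ B.sym2), c, d, hne, hAB,
    conn_side hE hne hAB hS.cov hf hfB hg hgA, conn_side hE hne hAB' hS.symm.cov hg hgA hf hfB, ?_, ?_,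
    sides_vs hS hAB, sides_vs hS.symm hAB', by simp, by simp, ?_, ?_⟩
  · refine Finset.one_lt_card.2 ⟨f, by simp [hf, hfA], s(c, d), by simp, ?_⟩
    rintro rfl
    exact hfB (Finset.mk_mem_sym2_iff.2 ⟨hcA.2, hdA.2⟩)
  · refine Finset.one_lt_card.2 ⟨g, by simp [hg, hgB], s(c, d), by simp, ?_⟩
    rintro rfl
    exact hgA (Finset.mk_mem_sym2_iff.2 ⟨hcA.1, hdA.1⟩)
  · intro e he
    simp [he]
  · intro e he
    simp [he]

theorem Sides.shrink_aux {E P Q : Finset (Sym2 ℕ)} {A B : Finset ℕ} {c d : ℕ} (h : Sides E P Q A B c d)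
    (hS : Sp2 E A B) {A1 B1 : Finset ℕ} (h1 : Sp2 P A1 B1) (hc : c ∈ B1) (hd : d ∈ B1) :
    ∃ B', Sp2 E A1 B' ∧ A1 ⊆ A ∧ #A1 < #A := by
  have hun := h1.un
  rw [h.vP] at hun
  have hA1 : A1 ⊆ A := by rw [← hun]; exact Finset.subset_union_left
  have hB1 : B1 ⊆ A := by rw [← hun]; exact Finset.subset_union_right
  have hB : ∀ u, u ∈ A → u ∈ B → u ∈ B1 := by
    intro u h2 h3
    have : u ∈ A ∩ B := by simp [h2, h3]
    rw [h.hAB] at this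
    simp only [Finset.mem_insert, Finset.mem_singleton] at this
    rcases this with rfl | rfl
    · exact hc
    · exact hd
  refine ⟨B1 ∪ B, ⟨?_, ?_, ?_, ?_, ?_⟩, hA1, ?_⟩
  · rw [← Finset.union_assoc, hun, hS.un]
  · refine le_trans (Finset.card_le_card ?_) h1.cd
    intro u hu
    simp only [Finset.mem_inter, Finset.mem_union] at hu ⊢
    have := hB u (hA1 hu.1)
    tauto
  · intro hs
    apply h1.l
    intro u hu
    have := hs hu
    rw [Finset.mem_union] at this
    exact this.elim id (hB u (hA1 hu))
  · intro hs
    exact h1.r (Finset.subset_union_left.trans hs)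
  · intro a b ha ha' hb hb' hab
    simp only [Finset.mem_union, not_or] at ha' hb
    have haA := hA1 ha
    have h3 : s(a, b) ∈ A.sym2 := (hS.cov _ hab).resolve_right
      (fun h' => ha'.2 (Finset.mk_mem_sym2_iff.1 h').1)
    have hbA := (Finset.mk_mem_sym2_iff.1 h3).2
    have hbB1 : b ∈ B1 := hb.elim id (hB b hbA)
    refine h1.no a b ha ha'.1 hbB1 hb' ((h.mP _ ?_).2 ⟨hab, h3⟩)
    intro h'
    rw [Sym2.eq_iff] at h'
    rcases h' with ⟨rfl, rfl⟩ | ⟨rfl, rfl⟩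
    · exact ha'.1 hc
    · exact ha'.1 hd
  · apply Finset.card_lt_card
    refine ⟨hA1, fun hs => h1.r (hB1.trans hs)⟩

theorem Sides.shrink {E P Q : Finset (Sym2 ℕ)} {A B : Finset ℕ} {c d : ℕ} (h : Sides E P Q A B c d)
    (hS : Sp2 E A B) (hT : ¬ TC P) : ∃ A1 B', Sp2 E A1 B' ∧ A1 ⊆ A ∧ #A1 < #A := by
  obtain ⟨A1, B1, h1⟩ := sep_of_not_TC (h.hP.four_le h.hP1) hT
  rcases h1.cov _ h.cP with h2 | h2
  · rw [Finset.mk_mem_sym2_iff] at h2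
    exact ⟨B1, h.shrink_aux hS h1.symm h2.1 h2.2⟩
  · rw [Finset.mk_mem_sym2_iff] at h2
    exact ⟨A1, h.shrink_aux hS h1 h2.1 h2.2⟩

theorem spl_side {E : Finset (Sym2 ℕ)} {A B : Finset ℕ} (hS : Sp2 E A B) {v x y z : ℕ} (hxy : s(x, y) ∈ E)
    (hz : z ∈ vs E) (hv : v ∉ vs E) (hT : TC (spl E v x y z)) (hA : s(x, y) ∈ A.sym2) : z ∉ A := by
  intro hzA
  rw [Finset.mk_mem_sym2_iff] at hA
  have hvA : v ∉ A := fun h => hv (by rw [← hS.un]; simp [h])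
  have hvB : v ∉ B := fun h => hv (by rw [← hS.un]; simp [h])
  refine hT.no_sep (A := insert v A) (B := B) ⟨?_, ?_, ?_, ?_, ?_⟩
  · rw [vs_spl hxy hz, Finset.insert_union, hS.un]
  · rw [Finset.insert_inter_of_notMem hvB]
    exact hS.cd
  · exact fun h => hvB (h (Finset.mem_insert_self _ _))
  · intro h
    apply hS.r
    intro u hu
    have := h hu
    rw [Finset.mem_insert] at this
    rcases this with rfl | h'
    · exact absurd hu hvB
    · exact h'
  · intro a b ha haB hb hbA hab
    simp only [Finset.mem_insert, not_or] at ha hbA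
    rw [mem_spl] at hab
    have key : ∀ w, w ∈ A → s(a, b) = s(v, w) → False := by
      intro w hw h
      rw [Sym2.eq_iff] at h
      rcases h with ⟨rfl, rfl⟩ | ⟨rfl, rfl⟩
      · exact hbA.2 hw
      · exact hvB hb
    rcases hab with h | h | h | h
    · exact key x hA.1 h
    · exact key y hA.2 h
    · exact key z hzA h
    · rcases ha with rfl | ha
      · exact hv (mem_vs_left h.2)
      · exact hS.no a b ha haB hb hbA.2 h.2

/-- working data -/
structure Dat (E P Pi Q : Finset (Sym2 ℕ)) (c d z t : ℕ) : Prop where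
  ne : c ≠ d
  hP : Conn P
  hP1 : 1 < #P
  cP : s(c, d) ∈ P
  cPi : s(c, d) ∈ Pi
  cQ : s(c, d) ∈ Q
  hv : vs P ∩ vs Q = {c, d}
  hvi : vs Pi ∩ vs Q = {c, d}
  hz : z ∈ vs Pi
  hzQ : z ∉ vs Q
  ht : t ∈ vs Q
  htP : t ∉ vs Pi
  eq : E.erase s(c, d) = insert s(z, t) ((Pi ∪ Q).erase s(c, d))
  kind : (Pi = P ∧ Outer Q c d t) ∨
    (∃ x y, s(x, y) ∈ P ∧ s(x, y) ≠ s(c, d) ∧ z ∉ vs P ∧ Pi = sbd P z x y ∧ Conn Q ∧ 1 < #Q)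

theorem Sides.cA {E P Q : Finset (Sym2 ℕ)} {A B : Finset ℕ} {c d : ℕ} (h : Sides E P Q A B c d) :
    c ∈ A ∧ c ∈ B ∧ d ∈ A ∧ d ∈ B := by
  have hcA : c ∈ A ∩ B := by rw [h.hAB]; simp
  have hdA : d ∈ A ∩ B := by rw [h.hAB]; simp
  rw [Finset.mem_inter] at hcA hdA
  tauto

theorem Sides.mPQ {E P Q : Finset (Sym2 ℕ)} {A B : Finset ℕ} {c d : ℕ} (h : Sides E P Q A B c d)
    (hS : Sp2 E A B) : ∀ e, e ≠ s(c, d) → (e ∈ E ↔ e ∈ P ∨ e ∈ Q) := by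
  intro e he
  rw [h.mP e he, h.mQ e he]
  have := hS.cov e
  tauto

theorem ne_of_not_mem {v c d : ℕ} (h1 : v ≠ c) (h2 : v ≠ d) (u : ℕ) : s(v, u) ≠ s(c, d) := by
  intro h
  rw [Sym2.eq_iff] at h
  tauto

set_option maxHeartbeats 2000000 in
theorem dat {E : Finset (Sym2 ℕ)} (hTC : TC E) {A : Finset ℕ} {m : ℕ} (h : Cfg E A m) :
    (∃ A' m', m' < m ∧ Cfg E A' m') ∨ ∃ P Pi Q c d z t, Dat E P Pi Q c d z t ∧ TC P ∧ #(vs Pi) = m := by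
  cases h with
  | add E2 B a b hC hS ha hb hab hE hm =>
    obtain ⟨P, Q, c, d, h⟩ := sides hC hS
    by_cases hT : TC P
    · right
      obtain ⟨z, hz, t, ht, hzB, htA, hzt⟩ := hTC.2 A B (by rw [hS.un, hE, vs_insert ha hb]) hS.cd hS.l hS.r
      have hzt' : s(z, t) = s(a, b) := by
        rw [hE, Finset.mem_insert] at hzt
        exact hzt.resolve_right (hS.no z t hz hzB ht htA)
      have hcA := h.cA
      refine ⟨P, P, Q, c, d, z, t, ⟨h.ne, h.hP, h.hP1, h.cP, h.cP, h.cQ, by rw [h.vP, h.vQ, h.hAB],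
        by rw [h.vP, h.vQ, h.hAB], by rwa [h.vP], by rwa [h.vQ], by rwa [h.vQ], by rwa [h.vP], ?_,
        Or.inl ⟨rfl, outer_conn h.hQ h.hQ1 h.cQ (by rwa [h.vQ]) ?_ ?_⟩⟩, hT, by rw [h.vP, hm]⟩
      · have hn : s(z, t) ≠ s(c, d) := by
          apply ne_of_not_mem
          · rintro rfl; exact hzB hcA.2.1
          · rintro rfl; exact hzB hcA.2.2.2
        ext e
        rw [hE, ← hzt']
        simp only [Finset.mem_erase, Finset.mem_insert, Finset.mem_union]
        have := h.mPQ hS e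
        constructor
        · tauto
        · rintro (rfl | h')
          · tauto
          · tauto
      · rintro rfl; exact htA hcA.1
      · rintro rfl; exact htA hcA.2.2.1
    · left
      obtain ⟨A1, B', h1, h2, h3⟩ := h.shrink hS hT
      exact ⟨A1, #A1, by omega, Cfg.add E2 B' a b hC h1 ha hb hab hE rfl⟩
  | splOut E2 B v x y z hC hS hxy hz hzx hzy hv hE hA hm =>
    obtain ⟨P, Q, c, d, h⟩ := sides hC hS
    by_cases hT : TC P
    · right
      have hB : s(x, y) ∈ B.sym2 := (hS.cov _ hxy).resolve_left hA
      have hzB : z ∉ B := spl_side hS.symm hxy hz hv (hE ▸ hTC) hB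
      have hzA : z ∈ A := by
        rw [← hS.un, Finset.mem_union] at hz
        tauto
      have hcA := h.cA
      have hvA : v ∉ A := fun h => hv (by rw [← hS.un]; simp [h])
      have hvB : v ∉ B := fun h => hv (by rw [← hS.un]; simp [h])
      have hne : s(x, y) ≠ s(c, d) := by
        intro h'
        rw [h'] at hA
        exact hA (Finset.mk_mem_sym2_iff.2 ⟨hcA.1, hcA.2.2.1⟩)
      have hxyQ : s(x, y) ∈ Q := (h.mQ _ hne).2 ⟨hxy, hB⟩
      have hxyP : s(x, y) ∉ P := fun h' => hA ((h.mP _ hne).1 h').2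
      have hvQ : vs (sbd Q v x y) = insert v B := by rw [vs_sbd hxyQ, h.vQ]
      have hABi : A ∩ insert v B = {c, d} := by
        rw [Finset.inter_insert_of_notMem hvA, h.hAB]
      have hvn : ∀ u, s(v, u) ≠ s(c, d) := by
        apply ne_of_not_mem
        · rintro rfl; exact hvB hcA.2.1
        · rintro rfl; exact hvB hcA.2.2.2
      refine ⟨P, P, sbd Q v x y, c, d, z, v, ⟨h.ne, h.hP, h.hP1, h.cP, h.cP,
        mem_sbd.2 (Or.inr (Or.inr ⟨hne.symm, h.cQ⟩)), by rw [h.vP, hvQ, hABi],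
        by rw [h.vP, hvQ, hABi], by rwa [h.vP], ?_, by rw [hvQ]; simp, by rwa [h.vP], ?_,
        Or.inl ⟨rfl, outer_sbd h.hQ h.hQ1 h.cQ hxyQ hne (by rwa [h.vQ])⟩⟩, hT, by rw [h.vP, hm]⟩
      · rw [hvQ, Finset.mem_insert, not_or]
        refine ⟨?_, hzB⟩
        rintro rfl; exact hvA hzA
      · ext e
        rw [hE, show s(z, v) = s(v, z) from Sym2.eq_swap]
        simp only [Finset.mem_erase, Finset.mem_insert, Finset.mem_union, mem_spl, mem_sbd]
        have := h.mPQ hS e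
        constructor
        · tauto
        · rintro (rfl | ⟨h', h'' | h''⟩)
          · exact ⟨hvn _, by tauto⟩
          · have : e ≠ s(x, y) := by rintro rfl; exact hxyP h''
            tauto
          · tauto
    · left
      obtain ⟨A1, B', h1, h2, h3⟩ := h.shrink hS hT
      exact ⟨A1, #A1, by omega, Cfg.splOut E2 B' v x y z hC h1 hxy hz hzx hzy hv hE
        (fun h' => hA (Finset.sym2_mono h2 h')) rfl⟩
  | splIn E2 B v x y z hC hS hxy hz hzx hzy hv hE hA hm =>
    obtain ⟨P, Q, c, d, h⟩ := sides hC hS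
    by_cases hT : TC P
    · right
      have hzA : z ∉ A := spl_side hS hxy hz hv (hE ▸ hTC) hA
      have hzB : z ∈ B := by
        rw [← hS.un, Finset.mem_union] at hz
        tauto
      have hB : s(x, y) ∉ B.sym2 := fun h' => spl_side hS.symm hxy hz hv (hE ▸ hTC) h' hzB
      have hcA := h.cA
      have hvA : v ∉ A := fun h => hv (by rw [← hS.un]; simp [h])
      have hvB : v ∉ B := fun h => hv (by rw [← hS.un]; simp [h])
      have hne : s(x, y) ≠ s(c, d) := by
        intro h'
        rw [h'] at hB
        exact hB (Finset.mk_mem_sym2_iff.2 ⟨hcA.2.1, hcA.2.2.2⟩)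
      have hxyP : s(x, y) ∈ P := (h.mP _ hne).2 ⟨hxy, hA⟩
      have hxyQ : s(x, y) ∉ Q := fun h' => hB ((h.mQ _ hne).1 h').2
      have hvP : vs (sbd P v x y) = insert v A := by rw [vs_sbd hxyP, h.vP]
      have hABi : insert v A ∩ B = {c, d} := by
        rw [Finset.insert_inter_of_notMem hvB, h.hAB]
      have hvn : ∀ u, s(v, u) ≠ s(c, d) := by
        apply ne_of_not_mem
        · rintro rfl; exact hvB hcA.2.1
        · rintro rfl; exact hvB hcA.2.2.2
      refine ⟨P, sbd P v x y, Q, c, d, v, z, ⟨h.ne, h.hP, h.hP1, h.cP,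
        mem_sbd.2 (Or.inr (Or.inr ⟨hne.symm, h.cP⟩)), h.cQ, by rw [h.vP, h.vQ, h.hAB],
        by rw [hvP, h.vQ, hABi], by rw [hvP]; simp, by rwa [h.vQ], by rwa [h.vQ], ?_, ?_,
        Or.inr ⟨x, y, hxyP, hne, by rwa [h.vP], rfl, h.hQ, h.hQ1⟩⟩, hT,
        by rw [hvP, hm, Finset.card_insert_of_notMem hvA]⟩
      · rw [hvP, Finset.mem_insert, not_or]
        refine ⟨?_, hzA⟩
        rintro rfl; exact hvB hzB
      · ext e
        rw [hE]
        simp only [Finset.mem_erase, Finset.mem_insert, Finset.mem_union, mem_spl, mem_sbd]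
        have := h.mPQ hS e
        constructor
        · tauto
        · rintro (rfl | ⟨h', h'' | h''⟩)
          · exact ⟨hvn _, by tauto⟩
          · tauto
          · have : e ≠ s(x, y) := by rintro rfl; exact hxyQ h''
            tauto
    · left
      obtain ⟨A1, B', h1, h2, h3⟩ := h.shrink hS hT
      by_cases hin : s(x, y) ∈ A1.sym2
      · exact ⟨A1, #A1 + 1, by omega, Cfg.splIn E2 B' v x y z hC h1 hxy hz hzx hzy hv hE hin rfl⟩
      · exact ⟨A1, #A1, by omega, Cfg.splOut E2 B' v x y z hC h1 hxy hz hzx hzy hv hE hin rfl⟩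

open Finset

theorem conn_card3 {P : Finset (Sym2 ℕ)} (hP : Conn P) (h1 : 1 < #P) : 3 ≤ #P := by
  obtain ⟨e, he⟩ := Finset.card_pos.1 (show 0 < #P by omega)
  induction e with
  | _ v u =>
    obtain ⟨a, b, c, hab, hac, hbc, ha, hb, hc⟩ := hP.deg h1 (mem_vs_left he)
    have hsub : ({s(v, a), s(v, b), s(v, c)} : Finset (Sym2 ℕ)) ⊆ P := by
      intro f hf
      simp only [Finset.mem_insert, Finset.mem_singleton] at hf
      rcases hf with rfl | rfl | rfl <;> assumption
    have h2 := Finset.card_le_card hsub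
    have key : ∀ p q : ℕ, p ≠ q → s(v, p) ≠ s(v, q) := by
      intro p q hpq h
      rw [Sym2.eq_iff] at h
      rcases h with h | h
      · exact hpq h.2
      · exact hpq (h.2.trans h.1)
    rw [Finset.card_eq_three.2 ⟨_, _, _, key a b hab, key a c hac, key b c hbc, rfl⟩] at h2
    exact h2

theorem conn_deg' {P : Finset (Sym2 ℕ)} (hP : Conn P) (h1 : 1 < #P) : ∀ u ∈ vs P, 3 ≤ #(nb P u) :=
  fun _ hu => hP.nb_deg h1 hu

theorem vs_edge {E : Finset (Sym2 ℕ)} {u : ℕ} (h : u ∈ vs E) : ∃ v, s(u, v) ∈ E := by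
  obtain ⟨e, he, hu⟩ := mem_vs.1 h
  obtain ⟨v, rfl⟩ := Sym2.mem_iff_exists.1 hu
  exact ⟨v, he⟩

theorem conn_K4 {P : Finset (Sym2 ℕ)} (hP : Conn P) (h1 : 1 < #P) (h4 : #(vs P) = 4) {u v : ℕ} (hu : u ∈ vs P)
    (hv : v ∈ vs P) (hne : u ≠ v) : s(u, v) ∈ P := by
  have hsub : nb P u ⊆ (vs P).erase u := by
    intro w hw
    rw [mem_nb] at hw
    exact Finset.mem_erase.2 ⟨(hP.1.ne hw).symm, mem_vs_right hw⟩
  have := Finset.eq_of_subset_of_card_le hsub (by rw [Finset.card_erase_of_mem hu, h4]; exact hP.nb_deg h1 hu)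
  rw [← mem_nb, this]
  exact Finset.mem_erase.2 ⟨hne.symm, hv⟩

theorem TC_clique {E E3 : Finset (Sym2 ℕ)} {q : ℕ} (hTC : TC E) (hq : q ∉ vs E3) (hv : vs E = insert q (vs E3))
    (hE : ∀ a b, a ≠ q → b ≠ q → s(a, b) ∈ E → s(a, b) ∈ E3)
    (hcl : ∀ a ∈ nb E q, ∀ b ∈ nb E q, a ≠ b → s(a, b) ∈ E3) (hnq : ∀ a ∈ nb E q, a ∈ vs E3)
    (h3 : 3 < #(vs E3)) : TC E3 := by
  by_contra hcon
  obtain ⟨A, B, hS⟩ := sep_of_not_TC h3 hcon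
  have key : ∀ A B, Sp2 E3 A B → (∀ a ∈ nb E q, a ∈ A) → False := by
    intro A B hS hA
    have hqA : q ∉ A := fun h => hq (by rw [← hS.un]; simp [h])
    have hqB : q ∉ B := fun h => hq (by rw [← hS.un]; simp [h])
    refine hTC.no_sep (A := insert q A) (B := B) ⟨?_, ?_, ?_, ?_, ?_⟩
    · rw [hv, Finset.insert_union, hS.un]
    · rw [Finset.insert_inter_of_notMem hqB]
      exact hS.cd
    · exact fun h => hqB (h (Finset.mem_insert_self _ _))
    · intro h
      apply hS.r
      intro u hu
      have := h hu
      rw [Finset.mem_insert] at this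
      rcases this with rfl | h'
      · exact absurd hu hqB
      · exact h'
    · intro a b ha haB hb hbA hab
      simp only [Finset.mem_insert, not_or] at ha hbA
      rcases ha with rfl | ha
      · exact hbA.2 (hA b (mem_nb.2 hab))
      · exact hS.no a b ha haB hb hbA.2 (hE a b (by rintro rfl; exact hqA ha) hbA.1 hab)
  by_cases hA : ∀ a ∈ nb E q, a ∈ A
  · exact key A B hS hA
  · push Not at hA
    obtain ⟨a, ha, haA⟩ := hA
    refine key B A hS.symm ?_
    intro b hb
    by_contra hbB
    have ha2 := hnq a ha
    have hb2 := hnq b hb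
    rw [← hS.un, Finset.mem_union] at ha2 hb2
    have hab : b ≠ a := by rintro rfl; tauto
    exact hS.no b a (by tauto) hbB (by tauto) haA (hcl b hb a ha hab)

theorem card_spl {E : Finset (Sym2 ℕ)} {v x y z : ℕ} (hv : v ∉ vs E) (hxy : x ≠ y) : #E < #(spl E v x y z) := by
  have h1 : insert s(v, x) (insert s(v, y) (E.erase s(x, y))) ⊆ spl E v x y z := by
    intro e he
    simp only [Finset.mem_insert, Finset.mem_erase] at he
    rw [mem_spl]
    tauto
  have h2 := Finset.card_le_card h1
  rw [Finset.card_insert_of_notMem, Finset.card_insert_of_notMem] at h2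
  · have := Finset.pred_card_le_card_erase (s := E) (a := s(x, y))
    omega
  · simp [notMem_of_vs hv]
  · simp only [Finset.mem_insert, Finset.mem_erase, not_or]
    refine ⟨?_, by simp [notMem_of_vs hv]⟩
    rw [Sym2.eq_iff]
    rintro (h | h)
    · exact hxy h.2
    · exact hxy (h.2.trans h.1)

namespace Dat
variable {E P Pi Q : Finset (Sym2 ℕ)} {c d z t : ℕ}

theorem cdm (D : Dat E P Pi Q c d z t) : c ∈ vs Pi ∧ d ∈ vs Pi ∧ c ∈ vs Q ∧ d ∈ vs Q ∧ c ∈ vs P ∧ d ∈ vs P :=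
  ⟨mem_vs_left D.cPi, mem_vs_right D.cPi, mem_vs_left D.cQ, mem_vs_right D.cQ, mem_vs_left D.cP, mem_vs_right D.cP⟩

theorem zn (D : Dat E P Pi Q c d z t) : z ≠ c ∧ z ≠ d ∧ t ≠ c ∧ t ≠ d ∧ z ≠ t := by
  have := D.cdm
  have h1 := D.hzQ
  have h2 := D.htP
  refine ⟨?_, ?_, ?_, ?_, ?_⟩
  · rintro rfl; tauto
  · rintro rfl; tauto
  · rintro rfl; tauto
  · rintro rfl; tauto
  · rintro rfl; exact h1 D.ht

theorem both (D : Dat E P Pi Q c d z t) {u : ℕ} (h1 : u ∈ vs Pi) (h2 : u ∈ vs Q) : u = c ∨ u = d := by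
  have : u ∈ vs Pi ∩ vs Q := by simp [h1, h2]
  rw [D.hvi] at this
  simpa using this

theorem mE (D : Dat E P Pi Q c d z t) {e : Sym2 ℕ} (he : e ≠ s(c, d)) :
    e ∈ E ↔ e = s(z, t) ∨ e ∈ Pi ∨ e ∈ Q := by
  have : e ∈ E ↔ e ∈ E.erase s(c, d) := by simp [he]
  rw [this, D.eq]
  simp [he]

theorem edge_ne (D : Dat E P Pi Q c d z t) {u : ℕ} (hu : u ∈ vs P) :
    ∃ v, s(u, v) ∈ Pi ∧ s(u, v) ≠ s(c, d) := by
  obtain ⟨a, b, e, hab, hae, hbe, ha, hb, he⟩ := D.hP.deg D.hP1 hu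
  have key : ∃ v, s(u, v) ∈ P ∧ s(u, v) ≠ s(c, d) := by
    by_cases h : s(u, a) = s(c, d)
    · refine ⟨b, hb, ?_⟩
      rw [← h, Ne, Sym2.eq_iff]
      rintro (h' | h')
      · exact hab h'.2.symm
      · exact hab (h'.1.symm.trans h'.2.symm)
    · exact ⟨a, ha, h⟩
  obtain ⟨v, hv, hne⟩ := key
  rcases D.kind with ⟨rfl, _⟩ | ⟨x, y, hxy, hxyn, hzP, hPi, _⟩
  · exact ⟨v, hv, hne⟩
  · have hzn : s(u, z) ≠ s(c, d) := by
      rw [Sym2.eq_swap]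
      exact ne_of_not_mem D.zn.1 D.zn.2.1 u
    by_cases h : s(u, v) = s(x, y)
    · refine ⟨z, ?_, hzn⟩
      rw [hPi, mem_sbd]
      rw [Sym2.eq_iff] at h
      rw [show s(u, z) = s(z, u) from Sym2.eq_swap]
      rcases h with ⟨rfl, rfl⟩ | ⟨rfl, rfl⟩ <;> tauto
    · exact ⟨v, by rw [hPi, mem_sbd]; tauto, hne⟩

theorem cE (D : Dat E P Pi Q c d z t) : c ∈ vs (E.erase s(c, d)) ∧ d ∈ vs (E.erase s(c, d)) := by
  have h := D.cdm
  constructor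
  · obtain ⟨v, h1, h2⟩ := D.edge_ne h.2.2.2.2.1
    exact mem_vs_left (b := v) (Finset.mem_erase.2 ⟨h2, (D.mE h2).2 (by tauto)⟩)
  · obtain ⟨v, h1, h2⟩ := D.edge_ne h.2.2.2.2.2
    exact mem_vs_left (b := v) (Finset.mem_erase.2 ⟨h2, (D.mE h2).2 (by tauto)⟩)

theorem vE (D : Dat E P Pi Q c d z t) : vs E = vs Pi ∪ vs Q := by
  have hce := D.cE
  ext u
  rw [Finset.mem_union]
  constructor
  · intro hu
    obtain ⟨v, hv⟩ := vs_edge hu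
    by_cases h : s(u, v) = s(c, d)
    · left
      apply mem_vs_left (b := v)
      rw [h]; exact D.cPi
    · rcases (D.mE h).1 hv with h' | h' | h'
      · rw [Sym2.eq_iff] at h'
        rcases h' with ⟨rfl, rfl⟩ | ⟨rfl, rfl⟩
        · exact Or.inl D.hz
        · exact Or.inr D.ht
      · exact Or.inl (mem_vs_left h')
      · exact Or.inr (mem_vs_left h')
  · intro hu
    by_cases huc : u = c
    · subst huc; exact vs_mono (Finset.erase_subset _ _) hce.1
    by_cases hud : u = d
    · subst hud; exact vs_mono (Finset.erase_subset _ _) hce.2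
    rcases hu with hu | hu
    · obtain ⟨v, hv⟩ := vs_edge hu
      exact mem_vs_left ((D.mE (ne_of_not_mem huc hud v)).2 (by tauto))
    · obtain ⟨v, hv⟩ := vs_edge hu
      exact mem_vs_left ((D.mE (ne_of_not_mem huc hud v)).2 (by tauto))

theorem frame (D : Dat E P Pi Q c d z t) : Frame E (vs Pi) c d t := by
  have h := D.cdm
  refine ⟨h.1, h.2.1, by rw [D.vE]; exact Finset.subset_union_left, by rw [D.vE]; simp [D.ht], D.htP, ?_⟩
  intro u hu huV hut v hv huv
  have hne : s(u, v) ≠ s(c, d) := by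
    apply ne_of_not_mem
    · rintro rfl; exact huV h.1
    · rintro rfl; exact huV h.2.1
  rcases (D.mE hne).1 huv with h' | h' | h'
  · rw [Sym2.eq_iff] at h'
    rcases h' with ⟨rfl, rfl⟩ | ⟨rfl, rfl⟩
    · exact absurd D.hz huV
    · exact absurd rfl hut
  · exact absurd (mem_vs_left h') huV
  · exact D.both hv (mem_vs_right h')

theorem five (D : Dat E P Pi Q c d z t) (h4 : 4 ≤ #(vs Pi)) : 5 ≤ #(vs E) := by
  have h1 : insert t (vs Pi) ⊆ vs E := by
    rw [D.vE]
    intro u hu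
    rw [Finset.mem_insert] at hu
    rcases hu with rfl | hu
    · simp [D.ht]
    · simp [hu]
  have := Finset.card_le_card h1
  rw [Finset.card_insert_of_notMem D.htP] at this
  omega

end Dat

open Finset

namespace Dat
variable {E P Pi Q : Finset (Sym2 ℕ)} {c d z t : ℕ}

theorem edge_PQ (D : Dat E P P Q c d z t) {a b : ℕ} (h1 : s(a, b) ∈ Q) (ha : a ∈ vs P) (hb : b ∈ vs P)
    (hne : a ≠ b) : s(a, b) = s(c, d) := by
  have h3 := D.both ha (mem_vs_left h1)
  have h4 := D.both hb (mem_vs_right h1)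
  rcases h3 with rfl | rfl <;> rcases h4 with rfl | rfl
  · exact absurd rfl hne
  · rfl
  · exact Sym2.eq_swap
  · exact absurd rfl hne

theorem plain_edge (D : Dat E P P Q c d z t) (hO : Outer Q c d t) (hTC : TC E) (hN : Nd E)
    (IH : ∀ E2 : Finset (Sym2 ℕ), #E2 < #E → TC E2 → Conn E2 → Reach E2)
    (IHm : ∀ A' m', m' < #(vs P) → Cfg E A' m' → Reach E)
    {p q : ℕ} (he : s(p, q) ∈ P) (hne : s(p, q) ≠ s(c, d)) (hC : Conn (P.erase s(p, q))) : Reach E := by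
  have hp := mem_vs_left he
  have hq := mem_vs_right he
  have hpq := D.hP.1.ne he
  have h3 := conn_card3 D.hP D.hP1
  have h1 : 1 < #(P.erase s(p, q)) := by rw [Finset.card_erase_of_mem he]; omega
  have hv := vs_erase (conn_deg' D.hP D.hP1) p q
  have hcd : s(c, d) ∈ P.erase s(p, q) := Finset.mem_erase.2 ⟨hne.symm, D.cP⟩
  have hX := hO.o1 (P.erase s(p, q)) z hC h1 hcd (by rw [hv]; exact D.hv) (by rw [hv]; exact D.hz) D.hzQ
  have heq : (E.erase s(p, q)).erase s(c, d) = insert s(z, t) ((P.erase s(p, q) ∪ Q).erase s(c, d)) := by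
    ext e
    simp only [Finset.mem_erase, Finset.mem_insert, Finset.mem_union]
    have hzt1 : s(z, t) ≠ s(c, d) := ne_of_not_mem D.zn.1 D.zn.2.1 t
    have hzt2 : s(z, t) ≠ s(p, q) := by
      intro h
      have := mem_vs_right (h ▸ he)
      exact D.htP this
    have hQ : e ∈ Q → e ≠ s(c, d) → e ≠ s(p, q) := by
      rintro h h' rfl
      exact h' (D.edge_PQ h hp hq hpq)
    by_cases hec : e = s(c, d)
    · subst hec; tauto
    · rw [D.mE hec]
      by_cases hez : e = s(z, t)
      · subst hez; tauto
      · tauto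
  have hvg : vs (P.erase s(p, q)) ⊆ vs ((E.erase s(p, q)).erase s(c, d)) := by
    rw [heq]
    exact (vs_glue (Q := Q) hC h1).trans (vs_mono (Finset.subset_insert _ _))
  rw [← heq] at hX
  have hcdm := D.cdm
  refine step_edge hN hTC D.frame IH IHm hp hq ((D.mE hne).2 (by tauto)) ?_ ?_
  · exact conn_of_erase hX (hvg (by rw [hv]; tauto)) (hvg (by rw [hv]; tauto)) D.ne
  · have h2 := twoC_of_conn hC h1 s(c, d)
    rw [hv] at h2
    refine h2.mono ?_
    intro e h
    simp only [Finset.mem_erase] at h ⊢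
    exact ⟨h.2.1, (D.mE h.1).2 (by tauto)⟩

set_option maxHeartbeats 4000000 in
theorem plain_node (D : Dat E P P Q c d z t) (hO : Outer Q c d t) (hTC : TC E) (hN : Nd E)
    (IH : ∀ E2 : Finset (Sym2 ℕ), #E2 < #E → TC E2 → Conn E2 → Reach E2)
    (IHm : ∀ A' m', m' < #(vs P) → Cfg E A' m' → Reach E)
    {w p q : ℕ} (hwc : w ≠ c) (hwd : w ≠ d) (hwz : w ≠ z) (hR : RNode P w p q) : Reach E := by
  obtain ⟨r, hrp, hrq, hnb⟩ := nb_three hR.deg hR.hx hR.hy hR.ne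
  have hpw := mem_nb.1 hR.hx
  have hqw := mem_nb.1 hR.hy
  have hrw : s(w, r) ∈ P := mem_nb.1 (by rw [hnb]; simp)
  have hp := mem_vs_right hpw
  have hq := mem_vs_right hqw
  have hr := mem_vs_right hrw
  have hw := mem_vs_left hpw
  have hwp := D.hP.1.ne hpw
  have hwq := D.hP.1.ne hqw
  have hwQ : w ∉ vs Q := by
    intro h
    rcases D.both hw h with h | h
    · exact hwc h
    · exact hwd h
  have hwt : w ≠ t := by rintro rfl; exact hwQ D.ht
  have hcdm := D.cdm
  have hv := vs_Red (conn_deg' D.hP D.hP1) hwp hwq hp hq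
  have hpqc : s(p, q) ≠ s(c, d) := fun h => hR.hxy (h ▸ D.cP)
  have hwcd : w ∉ s(c, d) := by rw [Sym2.mem_iff]; tauto
  have hcd : s(c, d) ∈ Red P w p q := mem_Red.2 (Or.inr ⟨D.cP, hwcd⟩)
  have h1 : 1 < #(Red P w p q) :=
    Finset.one_lt_card.2 ⟨s(p, q), mem_Red.2 (Or.inl rfl), s(c, d), hcd, hpqc⟩
  have hpqE : s(p, q) ∉ E := by
    rw [D.mE hpqc]
    rintro (h | h | h)
    · have : t ∈ s(p, q) := by rw [h]; simp
      rw [Sym2.mem_iff] at this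
      rcases this with rfl | rfl
      · exact D.htP hp
      · exact D.htP hq
    · exact hR.hxy h
    · exact hpqc (D.edge_PQ h hp hq hR.ne)
  have hnbE : nb E w = {p, q, r} := by
    rw [← hnb]
    ext u
    rw [mem_nb, mem_nb, D.mE (ne_of_not_mem hwc hwd u)]
    have hn1 : s(w, u) ≠ s(z, t) := ne_of_not_mem hwz hwt u
    have hn2 : s(w, u) ∉ Q := fun h => hwQ (mem_vs_left h)
    tauto
  have hX := hO.o1 (Red P w p q) z hR.conn h1 hcd
    (by
      rw [hv, Finset.erase_inter, D.hv]
      apply Finset.erase_eq_of_notMem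
      simp [hwc, hwd])
    (by rw [hv]; exact Finset.mem_erase.2 ⟨hwz.symm, D.hz⟩) D.hzQ
  have heq : (Red E w p q).erase s(c, d) = insert s(z, t) ((Red P w p q ∪ Q).erase s(c, d)) := by
    ext e
    simp only [Finset.mem_erase, Finset.mem_insert, Finset.mem_union, mem_Red]
    have hzt1 : s(z, t) ≠ s(c, d) := ne_of_not_mem D.zn.1 D.zn.2.1 t
    have hwzt : w ∉ s(z, t) := by rw [Sym2.mem_iff]; tauto
    have hQ : e ∈ Q → w ∉ e := fun h h' => hwQ (mem_vs.2 ⟨e, h, h'⟩)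
    by_cases hec : e = s(c, d)
    · subst hec; tauto
    · rw [D.mE hec]
      by_cases hez : e = s(z, t)
      · subst hez; tauto
      · tauto
  have hvg : vs (Red P w p q) ⊆ vs ((Red E w p q).erase s(c, d)) := by
    rw [heq]
    exact (vs_glue (Q := Q) hR.conn h1).trans (vs_mono (Finset.subset_insert _ _))
  rw [← heq] at hX
  refine step_node hN hTC D.frame (D.five (D.hP.four_le D.hP1)) IH IHm hw hp hq hr hnbE hpqE hR.ne hrp hrq ?_ ?_
  · exact conn_of_erase hX (hvg (by rw [hv, Finset.mem_erase]; tauto)) (hvg (by rw [hv, Finset.mem_erase]; tauto)) D.ne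
  · have h2 := twoC_of_conn hR.conn h1 s(c, d)
    rw [hv] at h2
    refine h2.mono ?_
    intro e h
    simp only [Finset.mem_erase, mem_Red] at h ⊢
    rcases h.2 with h' | h'
    · exact Or.inl h'
    · exact Or.inr ⟨(D.mE h.1).2 (by tauto), h'.2⟩

set_option maxHeartbeats 4000000 in
theorem plain_four (D : Dat E P P Q c d z t) (hO : Outer Q c d t) (hTC : TC E)
    (IH : ∀ E2 : Finset (Sym2 ℕ), #E2 < #E → TC E2 → Conn E2 → Reach E2)
    (h4 : #(vs P) = 4) : Reach E := by
  have hcdm := D.cdm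
  have hzn := D.zn
  have hsub : ({c, d, z} : Finset ℕ) ⊆ vs P := by
    intro u hu
    simp only [Finset.mem_insert, Finset.mem_singleton] at hu
    rcases hu with rfl | rfl | rfl
    · tauto
    · tauto
    · exact D.hz
  have h3 : #({c, d, z} : Finset ℕ) = 3 :=
    Finset.card_eq_three.2 ⟨c, d, z, D.ne, hzn.1.symm, hzn.2.1.symm, rfl⟩
  obtain ⟨q, hq⟩ := Finset.card_eq_one.1 (show #(vs P \ {c, d, z}) = 1 by
    rw [Finset.card_sdiff_of_subset hsub, h3, h4])
  have hvP : vs P = {q, c, d, z} := by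
    rw [← Finset.sdiff_union_of_subset hsub, hq]
    rfl
  have hqm : q ∈ vs P \ {c, d, z} := by rw [hq]; simp
  simp only [Finset.mem_sdiff, Finset.mem_insert, Finset.mem_singleton, not_or] at hqm
  obtain ⟨hqP, hqc, hqd, hqz⟩ := hqm
  have hqQ : q ∉ vs Q := by
    intro h
    rcases D.both hqP h with h | h
    · exact hqc h
    · exact hqd h
  have hqt : q ≠ t := by rintro rfl; exact hqQ D.ht
  have hK : ∀ {u v : ℕ}, u ∈ vs P → v ∈ vs P → u ≠ v → s(u, v) ∈ P := fun hu hv hne => conn_K4 D.hP D.hP1 h4 hu hv hne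
  have hPm : ∀ e, e ≠ s(c, d) → (e ∈ P ↔ e = s(q, c) ∨ e = s(q, d) ∨ e = s(q, z) ∨ e = s(z, c) ∨ e = s(z, d)) := by
    intro e hec
    constructor
    · intro he
      induction e with
      | _ a b =>
        have ha := mem_vs_left he
        have hb := mem_vs_right he
        have hne := D.hP.1.ne he
        rw [hvP] at ha hb
        simp only [Finset.mem_insert, Finset.mem_singleton] at ha hb
        clear * - hec ha hb hne
        rcases ha with rfl | rfl | rfl | rfl <;> rcases hb with rfl | rfl | rfl | rfl <;>
          simp_all
    · have hc : c ∈ vs P := by tauto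
      have hd : d ∈ vs P := by tauto
      rintro (rfl | rfl | rfl | rfl | rfl)
      · exact hK hqP hc hqc
      · exact hK hqP hd hqd
      · exact hK hqP D.hz hqz
      · exact hK D.hz hc hzn.1
      · exact hK D.hz hd hzn.2.1
  set E3 := Q ∪ {s(z, c), s(z, d), s(z, t)} with hE3
  have hC3 := hO.o2 z D.hzQ
  rw [← hE3] at hC3
  have hm3 : ∀ e, e ∈ E3 ↔ e ∈ Q ∨ e = s(z, c) ∨ e = s(z, d) ∨ e = s(z, t) := by
    intro e
    rw [hE3]
    simp only [Finset.mem_union, Finset.mem_insert, Finset.mem_singleton]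
  have hv3 : vs E3 = insert z (vs Q) := by
    ext u
    rw [Finset.mem_insert]
    constructor
    · intro hu
      obtain ⟨v, hv⟩ := vs_edge hu
      have ht := D.ht
      rw [hm3] at hv
      rcases hv with h | h | h | h
      · exact Or.inr (mem_vs_left h)
      all_goals
        rw [Sym2.eq_iff] at h
        rcases h with ⟨rfl, rfl⟩ | ⟨rfl, rfl⟩ <;> tauto
    · rintro (rfl | hu)
      · exact mem_vs_left (b := c) ((hm3 _).2 (by tauto))
      · exact vs_mono (fun e he => (hm3 e).2 (Or.inl he)) hu
  have hq3 : q ∉ vs E3 := by rw [hv3, Finset.mem_insert]; tauto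
  have hvE : vs E = insert q (vs E3) := by
    rw [D.vE, hv3, hvP]
    ext u
    simp only [Finset.mem_union, Finset.mem_insert, Finset.mem_singleton]
    constructor
    · rintro ((h | h | h | h) | h)
      · tauto
      · subst h; tauto
      · subst h; tauto
      · tauto
      · tauto
    · tauto
  have hnq : ∀ a, a ∈ nb E q → a = c ∨ a = d ∨ a = z := by
    intro a ha
    have hne := ne_of_not_mem hqc hqd a
    rw [mem_nb, D.mE hne, hPm _ hne] at ha
    have hn1 : s(q, a) ∉ Q := fun h => hqQ (mem_vs_left h)
    have hn2 : s(q, a) ≠ s(z, t) := ne_of_not_mem hqz hqt a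
    have hn3 : s(q, a) ≠ s(z, c) := ne_of_not_mem hqz hqc a
    have hn4 : s(q, a) ≠ s(z, d) := ne_of_not_mem hqz hqd a
    simp only [hn1, hn2, hn3, hn4, false_or, or_false, Sym2.eq_iff] at ha
    tauto
  have hT3 : TC E3 := by
    refine TC_clique hTC hq3 hvE ?_ ?_ ?_ ?_
    · intro a b haq hbq hab
      rw [hm3]
      by_cases hec : s(a, b) = s(c, d)
      · left; rw [hec]; exact D.cQ
      · rw [D.mE hec, hPm _ hec] at hab
        have h' : ∀ u, s(a, b) ≠ s(q, u) := by
          intro u h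
          rw [Sym2.eq_iff] at h
          tauto
        have := h' c
        have := h' d
        have := h' z
        tauto
    · have e1 : s(c, d) ∈ E3 := (hm3 _).2 (Or.inl D.cQ)
      have e2 : s(z, c) ∈ E3 := (hm3 _).2 (by tauto)
      have e3 : s(z, d) ∈ E3 := (hm3 _).2 (by tauto)
      have e1' : s(d, c) ∈ E3 := by rw [Sym2.eq_swap]; exact e1
      have e2' : s(c, z) ∈ E3 := by rw [Sym2.eq_swap]; exact e2
      have e3' : s(d, z) ∈ E3 := by rw [Sym2.eq_swap]; exact e3
      intro a ha b hb hab
      rcases hnq a ha with rfl | rfl | rfl <;> rcases hnq b hb with rfl | rfl | rfl <;> tauto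
    · intro a ha
      rw [hv3, Finset.mem_insert]
      rcases hnq a ha with rfl | rfl | rfl <;> tauto
    · have := D.five (by omega)
      rw [hvE, Finset.card_insert_of_notMem hq3] at this
      omega
  have heq : E.erase s(c, d) = spl E3 q c d z := by
    ext e
    rw [mem_spl, hm3, Finset.mem_erase]
    have hn1 := ne_of_not_mem hqc hqd c
    have hn2 := ne_of_not_mem hqc hqd d
    have hn3 := ne_of_not_mem hqc hqd z
    by_cases hec : e = s(c, d)
    · subst hec
      constructor
      · tauto
      · rintro (h | h | h | h)
        · exact absurd h.symm hn1
        · exact absurd h.symm hn2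
        · exact absurd h.symm hn3
        · tauto
    · rw [D.mE hec, hPm _ hec]
      tauto
  have hR3 : Reach E3 := by
    refine IH E3 ?_ hT3 hC3
    have h1 := card_spl (z := z) hq3 D.ne
    rw [← heq] at h1
    have := Finset.card_le_card (Finset.erase_subset s(c, d) E)
    omega
  have := reach_spl hR3 (v := q) (x := c) (y := d) (z := z) ((hm3 _).2 (Or.inl D.cQ)) (by rw [hv3]; simp)
    hzn.1 hzn.2.1 hq3
  rw [← heq] at this
  exact reach_of_erase this D.cE.1 D.cE.2 D.ne

theorem plain (D : Dat E P P Q c d z t) (hO : Outer Q c d t) (hTP : TC P) (hTC : TC E) (hN : Nd E)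
    (IH : ∀ E2 : Finset (Sym2 ℕ), #E2 < #E → TC E2 → Conn E2 → Reach E2)
    (IHm : ∀ A' m', m' < #(vs P) → Cfg E A' m' → Reach E) : Reach E := by
  have h4 := D.hP.four_le D.hP1
  by_cases h5 : 5 ≤ #(vs P)
  · rcases R_vertex D.hP hTP h5 D.cP D.hz D.zn.1 D.zn.2.1 with ⟨e, he, hne, hC⟩ | ⟨w, x, y, h1, h2, h3, hR⟩
    · induction e with
      | _ p q => exact D.plain_edge hO hTC hN IH IHm he hne hC
    · exact D.plain_node hO hTC hN IH IHm h1 h2 h3 hR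
  · exact D.plain_four hO hTC IH (by omega)

end Dat

open Finset

theorem sbd_congr {P : Finset (Sym2 ℕ)} {z x y x' y' : ℕ} (h : s(x, y) = s(x', y')) : sbd P z x y = sbd P z x' y' := by
  ext e
  rw [mem_sbd, mem_sbd, h]
  rw [Sym2.eq_iff] at h
  rcases h with ⟨rfl, rfl⟩ | ⟨rfl, rfl⟩ <;> tauto

theorem sub_core {E2 P2 Q : Finset (Sym2 ℕ)} {c d z t a b : ℕ} (hP : Conn P2) (h1 : 1 < #P2) (hQ : Conn Q)
    (hQ1 : 1 < #Q) (hcP : s(c, d) ∈ P2) (hcQ : s(c, d) ∈ Q) (hv : vs P2 ∩ vs Q = {c, d}) (hab : s(a, b) ∈ P2)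
    (hne : s(a, b) ≠ s(c, d)) (hzP : z ∉ vs P2) (hzQ : z ∉ vs Q) (htP : t ∉ vs P2) (htQ : t ∈ vs Q)
    (hE : ∀ e, e ≠ s(c, d) → (e ∈ E2 ↔ e = s(z, t) ∨ e ∈ sbd P2 z a b ∨ e ∈ Q)) :
    Conn E2 ∧ TwoC E2 (insert z (vs P2)) := by
  have ha := mem_vs_left hab
  have hb := mem_vs_right hab
  have hG := conn_two_sum hP hQ hcP hcQ hv h1 hQ1
  have hvP : vs P2 ⊆ vs ((P2 ∪ Q).erase s(c, d)) := vs_glue hP h1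
  have hvQ : vs Q ⊆ vs ((P2 ∪ Q).erase s(c, d)) := by
    rw [Finset.union_comm]; exact vs_glue hQ hQ1
  have hzG : z ∉ vs ((P2 ∪ Q).erase s(c, d)) := by
    intro h
    obtain ⟨u, hu⟩ := vs_edge h
    rw [Finset.mem_erase, Finset.mem_union] at hu
    rcases hu.2 with h' | h'
    · exact hzP (mem_vs_left h')
    · exact hzQ (mem_vs_left h')
  have habG : s(a, b) ∈ (P2 ∪ Q).erase s(c, d) := by simp [hne, hab]
  have hS := conn_spl hG habG (hvQ htQ) (by rintro rfl; exact htP ha) (by rintro rfl; exact htP hb) hzG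
  have habQ : s(a, b) ∉ Q := by
    intro h
    have h3 : a ∈ vs P2 ∩ vs Q := by simp [ha, mem_vs_left h]
    have h4 : b ∈ vs P2 ∩ vs Q := by simp [hb, mem_vs_right h]
    rw [hv] at h3 h4
    exact hne (edge_eq_of_mem (hP.1 _ hab) (Finset.mk_mem_sym2_iff.2 ⟨h3, h4⟩))
  have hzc : z ≠ c := by rintro rfl; exact hzP (mem_vs_left hcP)
  have hzd : z ≠ d := by rintro rfl; exact hzP (mem_vs_right hcP)
  have heq : E2.erase s(c, d) = spl ((P2 ∪ Q).erase s(c, d)) z a b t := by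
    ext e
    rw [mem_spl, Finset.mem_erase, Finset.mem_erase, Finset.mem_union]
    have n1 := ne_of_not_mem hzc hzd a
    have n2 := ne_of_not_mem hzc hzd b
    have n3 := ne_of_not_mem hzc hzd t
    by_cases hec : e = s(c, d)
    · subst hec
      constructor
      · intro h; exact absurd rfl h.1
      · rintro (h | h | h | h)
        · exact absurd h.symm n1
        · exact absurd h.symm n2
        · exact absurd h.symm n3
        · exact absurd rfl h.2.1
    · rw [hE e hec, mem_sbd]
      by_cases hea : e = s(a, b)
      · subst hea
        clear * - habQ hec
        tauto
      · clear * - hec hea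
        tauto
  have hvS := vs_spl (v := z) habG (hvQ htQ)
  constructor
  · rw [← heq] at hS hvS
    refine conn_of_erase hS ?_ ?_ (hP.1.ne hcP)
    · rw [hvS]; exact Finset.mem_insert_of_mem (hvP (mem_vs_left hcP))
    · rw [hvS]; exact Finset.mem_insert_of_mem (hvP (mem_vs_right hcP))
  · have h2 := twoC_of_conn hP h1 s(c, d)
    have h4 := hP.four_le h1
    refine (twoC_sbd h2 (by omega) ha hb (hP.1.ne hab) hzP).mono ?_
    intro e he
    rw [mem_sbd, Finset.mem_erase] at he
    have n1 := ne_of_not_mem hzc hzd a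
    have n2 := ne_of_not_mem hzc hzd b
    rcases he with rfl | rfl | he
    · rw [hE _ n1, mem_sbd]; tauto
    · rw [hE _ n2, mem_sbd]; tauto
    · rw [hE _ he.2.1, mem_sbd]; tauto

namespace Dat
variable {E P Pi Q : Finset (Sym2 ℕ)} {c d z t x y : ℕ}

theorem bothP (D : Dat E P Pi Q c d z t) {u : ℕ} (h1 : u ∈ vs P) (h2 : u ∈ vs Q) : u = c ∨ u = d := by
  have : u ∈ vs P ∩ vs Q := by simp [h1, h2]
  rw [D.hv] at this
  simpa using this

theorem edge_PQ' (D : Dat E P Pi Q c d z t) {a b : ℕ} (h1 : s(a, b) ∈ Q) (ha : a ∈ vs P) (hb : b ∈ vs P)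
    (hne : a ≠ b) : s(a, b) = s(c, d) := by
  have h3 := D.bothP ha (mem_vs_left h1)
  have h4 := D.bothP hb (mem_vs_right h1)
  rcases h3 with rfl | rfl <;> rcases h4 with rfl | rfl
  · exact absurd rfl hne
  · rfl
  · exact Sym2.eq_swap
  · exact absurd rfl hne

theorem sub_edge (D : Dat E P (sbd P z x y) Q c d z t) (hxy : s(x, y) ∈ P) (hxyc : s(x, y) ≠ s(c, d))
    (hzP : z ∉ vs P) (hQ : Conn Q) (hQ1 : 1 < #Q) (hTC : TC E) (hN : Nd E)
    (IH : ∀ E2 : Finset (Sym2 ℕ), #E2 < #E → TC E2 → Conn E2 → Reach E2)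
    (IHm : ∀ A' m', m' < #(vs (sbd P z x y)) → Cfg E A' m' → Reach E)
    {p q : ℕ} (he : s(p, q) ∈ P) (hne : s(p, q) ≠ s(c, d)) (hnxy : s(p, q) ≠ s(x, y))
    (hC : Conn (P.erase s(p, q))) : Reach E := by
  have hp := mem_vs_left he
  have hq := mem_vs_right he
  have hpq := D.hP.1.ne he
  have h3 := conn_card3 D.hP D.hP1
  have h1 : 1 < #(P.erase s(p, q)) := by rw [Finset.card_erase_of_mem he]; omega
  have hv := vs_erase (conn_deg' D.hP D.hP1) p q
  have hcd : s(c, d) ∈ P.erase s(p, q) := Finset.mem_erase.2 ⟨hne.symm, D.cP⟩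
  have hvi := vs_sbd (v := z) hxy
  have htP : t ∉ vs P := fun h => D.htP (by rw [hvi]; simp [h])
  have hzpq : ∀ u, s(p, q) ≠ s(z, u) := by
    intro u h
    have : z ∈ s(p, q) := by rw [h]; simp
    exact hzP (mem_vs.2 ⟨_, he, this⟩)
  have hpqQ : s(p, q) ∉ Q := fun h => hne (D.edge_PQ' h hp hq hpq)
  have core := sub_core (E2 := E.erase s(p, q)) (a := x) (b := y) hC h1 hQ hQ1 hcd D.cQ (by rw [hv]; exact D.hv)
    (Finset.mem_erase.2 ⟨hnxy.symm, hxy⟩) hxyc (by rwa [hv]) D.hzQ (by rwa [hv]) D.ht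
    (by
      intro e hec
      rw [Finset.mem_erase, D.mE hec, mem_sbd, mem_sbd, Finset.mem_erase]
      have n1 := hzpq t
      have n2 := hzpq x
      have n3 := hzpq y
      by_cases hep : e = s(p, q)
      · subst hep
        clear * - n1 n2 n3 hpqQ
        tauto
      · clear * - hep
        tauto)
  rw [hv, ← hvi] at core
  exact step_edge hN hTC D.frame IH IHm (by rw [hvi]; simp [hp]) (by rw [hvi]; simp [hq])
    ((D.mE hne).2 (Or.inr (Or.inl (mem_sbd.2 (by tauto))))) core.1 core.2

set_option maxHeartbeats 4000000 in
theorem sub_node (D : Dat E P (sbd P z x y) Q c d z t) (hxy : s(x, y) ∈ P) (hxyc : s(x, y) ≠ s(c, d))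
    (hzP : z ∉ vs P) (hQ : Conn Q) (hQ1 : 1 < #Q) (hTC : TC E) (hN : Nd E)
    (IH : ∀ E2 : Finset (Sym2 ℕ), #E2 < #E → TC E2 → Conn E2 → Reach E2)
    (IHm : ∀ A' m', m' < #(vs (sbd P z x y)) → Cfg E A' m' → Reach E)
    {w p q : ℕ} (hwc : w ≠ c) (hwd : w ≠ d) (hwx : w ≠ x) (hwy : w ≠ y) (hR : RNode P w p q) : Reach E := by
  obtain ⟨r, hrp, hrq, hnb⟩ := nb_three hR.deg hR.hx hR.hy hR.ne
  have hpw := mem_nb.1 hR.hx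
  have hqw := mem_nb.1 hR.hy
  have hrw : s(w, r) ∈ P := mem_nb.1 (by rw [hnb]; simp)
  have hp := mem_vs_right hpw
  have hq := mem_vs_right hqw
  have hr := mem_vs_right hrw
  have hw := mem_vs_left hpw
  have hwp := D.hP.1.ne hpw
  have hwq := D.hP.1.ne hqw
  have hwz : w ≠ z := by rintro rfl; exact hzP hw
  have hwQ : w ∉ vs Q := by
    intro h
    rcases D.bothP hw h with h | h
    · exact hwc h
    · exact hwd h
  have hwt : w ≠ t := by rintro rfl; exact hwQ D.ht
  have hcdm := D.cdm
  have hvi := vs_sbd (v := z) hxy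
  have htP : t ∉ vs P := fun h => D.htP (by rw [hvi]; simp [h])
  have hv := vs_Red (conn_deg' D.hP D.hP1) hwp hwq hp hq
  have hpqc : s(p, q) ≠ s(c, d) := fun h => hR.hxy (h ▸ D.cP)
  have hwcd : w ∉ s(c, d) := by rw [Sym2.mem_iff]; tauto
  have hwxy : w ∉ s(x, y) := by rw [Sym2.mem_iff]; tauto
  have hcd : s(c, d) ∈ Red P w p q := mem_Red.2 (Or.inr ⟨D.cP, hwcd⟩)
  have h1 : 1 < #(Red P w p q) :=
    Finset.one_lt_card.2 ⟨s(p, q), mem_Red.2 (Or.inl rfl), s(c, d), hcd, hpqc⟩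
  have hpqQ : s(p, q) ∉ Q := fun h => hpqc (D.edge_PQ' h hp hq hR.ne)
  have hzpq : ∀ u, s(p, q) ≠ s(z, u) := by
    intro u h
    have : z ∈ s(p, q) := by rw [h]; simp
    rw [Sym2.mem_iff] at this
    rcases this with rfl | rfl
    · exact hzP hp
    · exact hzP hq
  have hpqE : s(p, q) ∉ E := by
    rw [D.mE hpqc, mem_sbd]
    rintro (h | (h | h | h) | h)
    · exact hzpq _ h
    · exact hzpq _ h
    · exact hzpq _ h
    · exact hR.hxy h.2
    · exact hpqQ h
  have hnbE : nb E w = {p, q, r} := by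
    rw [← hnb]
    ext u
    rw [mem_nb, mem_nb, D.mE (ne_of_not_mem hwc hwd u), mem_sbd]
    have hn1 : s(w, u) ≠ s(z, t) := ne_of_not_mem hwz hwt u
    have hn2 : s(w, u) ∉ Q := fun h => hwQ (mem_vs_left h)
    have hn3 : s(w, u) ≠ s(z, x) := ne_of_not_mem hwz hwx u
    have hn4 : s(w, u) ≠ s(z, y) := ne_of_not_mem hwz hwy u
    have hn5 : s(w, u) ≠ s(x, y) := ne_of_not_mem hwx hwy u
    clear * - hn1 hn2 hn3 hn4 hn5
    tauto
  have core := sub_core (E2 := Red E w p q) (a := x) (b := y) hR.conn h1 hQ hQ1 hcd D.cQ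
    (by
      rw [hv, Finset.erase_inter, D.hv]
      apply Finset.erase_eq_of_notMem
      simp [hwc, hwd])
    (mem_Red.2 (Or.inr ⟨hxy, hwxy⟩)) hxyc (by rw [hv]; simp [hzP]) D.hzQ (by rw [hv]; simp [htP]) D.ht
    (by
      intro e hec
      rw [mem_Red, D.mE hec, mem_sbd, mem_sbd, mem_Red]
      have n1 : w ∉ s(z, t) := by rw [Sym2.mem_iff]; tauto
      have n2 : w ∉ s(z, x) := by rw [Sym2.mem_iff]; tauto
      have n3 : w ∉ s(z, y) := by rw [Sym2.mem_iff]; tauto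
      have n4 : e ∈ Q → w ∉ e := fun h h' => hwQ (mem_vs.2 ⟨e, h, h'⟩)
      have n5 : e = s(p, q) → e ≠ s(x, y) := by
        rintro rfl h
        exact hR.hxy (h ▸ hxy)
      have n1' : e = s(z, t) → w ∉ e := fun h => by rw [h]; exact n1
      have n2' : e = s(z, x) → w ∉ e := fun h => by rw [h]; exact n2
      have n3' : e = s(z, y) → w ∉ e := fun h => by rw [h]; exact n3
      clear * - n1' n2' n3' n4 n5
      tauto)
  have hV : insert z (vs (Red P w p q)) = (vs (sbd P z x y)).erase w := by
    rw [hv, hvi, Finset.erase_insert_of_ne hwz.symm]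
  rw [hV] at core
  have h4 := D.hP.four_le D.hP1
  refine step_node hN hTC D.frame (D.five ?_) IH IHm ?_ ?_ ?_ ?_ hnbE hpqE hR.ne hrp hrq core.1 core.2
  · rw [hvi, Finset.card_insert_of_notMem hzP]; omega
  all_goals rw [hvi]; exact Finset.mem_insert_of_mem (by assumption)

set_option maxHeartbeats 4000000 in
theorem sub_moved (D : Dat E P (sbd P z x y) Q c d z t) (hxy : s(x, y) ∈ P)
    (hzP : z ∉ vs P) (hQ : Conn Q) (hQ1 : 1 < #Q) (hTC : TC E) (hN : Nd E)
    (IH : ∀ E2 : Finset (Sym2 ℕ), #E2 < #E → TC E2 → Conn E2 → Reach E2)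
    (IHm : ∀ A' m', m' < #(vs (sbd P z x y)) → Cfg E A' m' → Reach E)
    {w u p : ℕ} (hwu : s(x, y) = s(w, u)) (hwc : w ≠ c) (hwd : w ≠ d) (hR : RNode P w u p) : Reach E := by
  obtain ⟨q, hqu, hqp, hnb⟩ := nb_three hR.deg hR.hx hR.hy hR.ne
  have huw := mem_nb.1 hR.hx
  have hpw := mem_nb.1 hR.hy
  have hqw : s(w, q) ∈ P := mem_nb.1 (by rw [hnb]; simp)
  have hu := mem_vs_right huw
  have hp := mem_vs_right hpw
  have hq := mem_vs_right hqw
  have hw := mem_vs_left hpw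
  have hwu' := D.hP.1.ne huw
  have hwp := D.hP.1.ne hpw
  have hwq := D.hP.1.ne hqw
  have hwz : w ≠ z := by rintro rfl; exact hzP hw
  have hpz : p ≠ z := by rintro rfl; exact hzP hp
  have hqz : q ≠ z := by rintro rfl; exact hzP hq
  have hwQ : w ∉ vs Q := by
    intro h
    rcases D.bothP hw h with h | h
    · exact hwc h
    · exact hwd h
  have hwt : w ≠ t := by rintro rfl; exact hwQ D.ht
  have hzn := D.zn
  have hvi := vs_sbd (v := z) hxy
  have htP : t ∉ vs P := fun h => D.htP (by rw [hvi]; simp [h])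
  have hpt : p ≠ t := by rintro rfl; exact htP hp
  have hs := sbd_congr (P := P) (z := z) hwu
  have hmE : ∀ e, e ≠ s(c, d) →
      (e ∈ E ↔ e = s(z, t) ∨ (e = s(z, w) ∨ e = s(z, u) ∨ (e ≠ s(w, u) ∧ e ∈ P)) ∨ e ∈ Q) := by
    intro e he
    rw [D.mE he, hs, mem_sbd]
  have hv := vs_Red (conn_deg' D.hP D.hP1) hwu' hwp hu hp
  have hupc : s(u, p) ≠ s(c, d) := fun h => hR.hxy (h ▸ D.cP)
  have hwcd : w ∉ s(c, d) := by rw [Sym2.mem_iff]; tauto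
  have hcd : s(c, d) ∈ Red P w u p := mem_Red.2 (Or.inr ⟨D.cP, hwcd⟩)
  have h1 : 1 < #(Red P w u p) :=
    Finset.one_lt_card.2 ⟨s(u, p), mem_Red.2 (Or.inl rfl), s(c, d), hcd, hupc⟩
  have hupQ : s(u, p) ∉ Q := fun h => hupc (D.edge_PQ' h hu hp hR.ne)
  have hzpE : s(z, p) ∉ E := by
    rw [hmE _ (ne_of_not_mem hzn.1 hzn.2.1 p)]
    have key : ∀ v, v ≠ p → s(z, p) ≠ s(z, v) := by
      intro v hv h
      rw [Sym2.eq_iff] at h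
      rcases h with h | h
      · exact hv h.2.symm
      · exact hpz h.2
    rintro (h | (h | h | h) | h)
    · exact key _ hpt.symm h
    · exact key _ hwp h
    · exact key _ hR.ne h
    · exact hzP (mem_vs_left h.2)
    · exact D.hzQ (mem_vs_left h)
  have hnbE : nb E w = {z, p, q} := by
    ext v
    have hm : v ∈ nb P w ↔ v = u ∨ v = p ∨ v = q := by rw [hnb]; simp
    rw [mem_nb, hmE _ (ne_of_not_mem hwc hwd v)]
    rw [mem_nb] at hm
    rw [hm]
    have hn1 : s(w, v) ≠ s(z, t) := ne_of_not_mem hwz hwt v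
    have hn2 : s(w, v) ∉ Q := fun h => hwQ (mem_vs_left h)
    have hn3 : s(w, v) ≠ s(z, u) := ne_of_not_mem hwz hwu' v
    have hn4 : s(w, v) = s(z, w) ↔ v = z := by
      rw [Sym2.eq_iff]
      constructor
      · rintro (h | h)
        · exact absurd h.1 hwz
        · exact h.2
      · rintro rfl; tauto
    have hn5 : s(w, v) = s(w, u) ↔ v = u := by
      rw [Sym2.eq_iff]
      constructor
      · rintro (h | h)
        · exact h.2
        · exact absurd h.1 hwu'
      · rintro rfl; tauto
    rw [hn4, Ne, hn5]
    simp only [Finset.mem_insert, Finset.mem_singleton]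
    have h6 : v = p → v ≠ u := by rintro rfl h; exact hR.ne h.symm
    have h7 : v = q → v ≠ u := by rintro rfl h; exact hqu h
    clear * - hn1 hn2 hn3 h6 h7
    tauto
  have core := sub_core (E2 := Red E w z p) (a := u) (b := p) hR.conn h1 hQ hQ1 hcd D.cQ
    (by
      rw [hv, Finset.erase_inter, D.hv]
      apply Finset.erase_eq_of_notMem
      simp [hwc, hwd])
    (mem_Red.2 (Or.inl rfl)) hupc (by rw [hv]; simp [hzP]) D.hzQ (by rw [hv]; simp [htP]) D.ht
    (by
      intro e hec
      rw [mem_Red, hmE e hec, mem_sbd, mem_Red]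
      have n1 : w ∉ s(z, t) := by rw [Sym2.mem_iff]; tauto
      have n2 : w ∉ s(z, u) := by rw [Sym2.mem_iff]; tauto
      have n3 : e = s(z, w) → w ∈ e := by rintro rfl; simp
      have n4 : e ∈ Q → w ∉ e := fun h h' => hwQ (mem_vs.2 ⟨e, h, h'⟩)
      have n5 : e = s(u, p) → e ∉ P := by
        rintro rfl
        exact hR.hxy
      have n6 : e = s(w, u) → w ∈ e := by rintro rfl; simp
      have n1' : e = s(z, t) → w ∉ e := fun h => by rw [h]; exact n1
      have n2' : e = s(z, u) → w ∉ e := fun h => by rw [h]; exact n2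
      clear * - n1' n2' n3 n4 n5 n6
      tauto)
  have hV : insert z (vs (Red P w u p)) = (vs (sbd P z x y)).erase w := by
    rw [hv, hvi, Finset.erase_insert_of_ne hwz.symm]
  rw [hV] at core
  have h4 := D.hP.four_le D.hP1
  refine step_node hN hTC D.frame (D.five ?_) IH IHm ?_ ?_ ?_ ?_ hnbE hzpE hpz.symm hqz hqp core.1 core.2
  · rw [hvi, Finset.card_insert_of_notMem hzP]; omega
  all_goals
    rw [hvi]
    first
      | exact Finset.mem_insert_self _ _
      | exact Finset.mem_insert_of_mem (by assumption)

end Dat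

open Finset

theorem K4_mem {P : Finset (Sym2 ℕ)} (hP : Conn P) (h1 : 1 < #P) (h4 : #(vs P) = 4) {c d p q : ℕ}
    (hv : vs P = {c, d, p, q}) (hcd : c ≠ d) (hcp : c ≠ p) (hcq : c ≠ q) (hdp : d ≠ p) (hdq : d ≠ q) (hpq : p ≠ q)
    (e : Sym2 ℕ) : e ∈ P ↔ e = s(c, d) ∨ e = s(c, p) ∨ e = s(c, q) ∨ e = s(d, p) ∨ e = s(d, q) ∨ e = s(p, q) := by
  constructor
  · induction e with
    | _ a b =>
      intro h
      have ha := mem_vs_left h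
      have hb := mem_vs_right h
      have hne := hP.1.ne h
      rw [hv] at ha hb
      simp only [Finset.mem_insert, Finset.mem_singleton] at ha hb
      rcases ha with rfl | rfl | rfl | rfl <;> rcases hb with rfl | rfl | rfl | rfl <;> simp_all [Sym2.eq_swap]
  · have k := fun {u v : ℕ} (hu : u ∈ vs P) (hv : v ∈ vs P) (hne : u ≠ v) => conn_K4 hP h1 h4 hu hv hne
    rintro (rfl | rfl | rfl | rfl | rfl | rfl) <;> apply k <;> first | (rw [hv]; simp) | assumption

theorem four_split {S : Finset ℕ} (h4 : #S = 4) {c d : ℕ} (hc : c ∈ S) (hd : d ∈ S) (hcd : c ≠ d) :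
    ∃ p q, p ≠ q ∧ c ≠ p ∧ c ≠ q ∧ d ≠ p ∧ d ≠ q ∧ S = {c, d, p, q} := by
  have hsub : ({c, d} : Finset ℕ) ⊆ S := by
    intro u hu
    simp only [Finset.mem_insert, Finset.mem_singleton] at hu
    rcases hu with rfl | rfl <;> assumption
  have hc2 : #(S \ {c, d}) = 2 := by
    rw [Finset.card_sdiff_of_subset hsub, h4, Finset.card_pair hcd]
  obtain ⟨p, q, hpq, h⟩ := Finset.card_eq_two.1 hc2
  have hp : p ∈ S \ {c, d} := by rw [h]; simp
  have hq : q ∈ S \ {c, d} := by rw [h]; simp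
  simp only [Finset.mem_sdiff, Finset.mem_insert, Finset.mem_singleton, not_or] at hp hq
  refine ⟨p, q, hpq, Ne.symm hp.2.1, Ne.symm hq.2.1, Ne.symm hp.2.2, Ne.symm hq.2.2, ?_⟩
  rw [← Finset.sdiff_union_of_subset hsub, h]
  ext u
  simp only [Finset.mem_union, Finset.mem_insert, Finset.mem_singleton]
  tauto

theorem spl_comm {Q : Finset (Sym2 ℕ)} {z c d t : ℕ} : spl Q z c d t = spl Q z d c t := by
  ext e
  rw [mem_spl, mem_spl, Sym2.eq_swap (a := c) (b := d)]
  tauto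

namespace Dat
variable {E P Pi Q : Finset (Sym2 ℕ)} {c d z t x y : ℕ}

theorem host_aux (D : Dat E P Pi Q c d z t) (hTC : TC E) {A B : Finset ℕ} (hS : Sp2 (spl Q z c d t) A B)
    (hc : c ∈ A) (hd : d ∈ A) (hz : z ∈ A) : False := by
  have hun := hS.un
  rw [vs_spl D.cQ D.ht] at hun
  have hm : ∀ u, u ∈ A ∨ u ∈ B ↔ u = z ∨ u ∈ vs Q := by
    intro u
    rw [← Finset.mem_union, hun, Finset.mem_insert]
  have hB : ∀ u, u ∈ vs Pi → u = z ∨ u ∈ vs Q → u ∈ A := by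
    rintro u hu (rfl | h)
    · exact hz
    · rcases D.both hu h with rfl | rfl <;> assumption
  refine hTC.no_sep (A := A ∪ vs Pi) (B := B) ⟨?_, ?_, ?_, ?_, ?_⟩
  · rw [D.vE]
    ext u
    have := hm u
    have hz' := D.hz
    simp only [Finset.mem_union]
    by_cases huz : u = z
    · subst huz; tauto
    · tauto
  · refine le_trans (Finset.card_le_card ?_) hS.cd
    intro u hu
    simp only [Finset.mem_inter, Finset.mem_union] at hu ⊢
    refine ⟨?_, hu.2⟩
    rcases hu.1 with h | h
    · exact h
    · exact hB u h ((hm u).1 (Or.inr hu.2))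
  · intro h
    exact hS.l (Finset.subset_union_left.trans h)
  · intro h
    apply hS.r
    intro u hu
    have := h hu
    rw [Finset.mem_union] at this
    rcases this with h' | h'
    · exact h'
    · exact hB u h' ((hm u).1 (Or.inr hu))
  · intro a b ha haB hb hbA hab
    rw [Finset.mem_union, not_or] at hbA
    have hbc : b ≠ c := by rintro rfl; exact hbA.1 hc
    have hbd : b ≠ d := by rintro rfl; exact hbA.1 hd
    have hne : s(a, b) ≠ s(c, d) := by
      rw [Sym2.eq_swap]; exact ne_of_not_mem hbc hbd a
    rcases (D.mE hne).1 hab with h | h | h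
    · rw [Sym2.eq_iff] at h
      rcases h with ⟨rfl, rfl⟩ | ⟨rfl, rfl⟩
      · exact hS.no a b hz haB hb hbA.1 (by rw [mem_spl]; tauto)
      · exact hbA.1 hz
    · exact hbA.2 (mem_vs_right h)
    · have haA : a ∈ A := by
        rcases Finset.mem_union.1 ha with h' | h'
        · exact h'
        · exact hB a h' (Or.inr (mem_vs_left h))
      exact hS.no a b haA haB hb hbA.1 (by rw [mem_spl]; tauto)

theorem host_aux2 (D : Dat E P Pi Q c d z t) (hTC : TC E) {A B : Finset ℕ} (hS : Sp2 (spl Q z c d t) A B)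
    (hz : z ∈ A) (hzB : z ∉ B) : False := by
  have hun := hS.un
  rw [vs_spl D.cQ D.ht] at hun
  have hcm := D.cdm
  have hm : ∀ u, u ∈ vs Q → s(z, u) ∈ spl Q z c d t → u ∈ A := by
    intro u hu h
    by_contra hcon
    have : u ∈ A ∪ B := by rw [hun]; simp [hu]
    rw [Finset.mem_union] at this
    exact hS.no z u hz hzB (this.resolve_left hcon) hcon h
  exact D.host_aux hTC hS (hm c hcm.2.2.1 (by rw [mem_spl]; tauto)) (hm d hcm.2.2.2.1 (by rw [mem_spl]; tauto)) hz

theorem host_TC (D : Dat E P Pi Q c d z t) (hQ : Conn Q) (hQ1 : 1 < #Q) (hTC : TC E) : TC (spl Q z c d t) := by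
  have hv := vs_spl (v := z) D.cQ D.ht
  have h4 := hQ.four_le hQ1
  have hcm := D.cdm
  by_contra hcon
  obtain ⟨A, B, hS⟩ := sep_of_not_TC (by rw [hv, Finset.card_insert_of_notMem D.hzQ]; omega) hcon
  have hun := hS.un
  rw [hv] at hun
  have hm : ∀ u, u ∈ A ∨ u ∈ B ↔ u = z ∨ u ∈ vs Q := by
    intro u
    rw [← Finset.mem_union, hun, Finset.mem_insert]
  by_cases hzA : z ∈ A
  swap
  · exact D.host_aux2 hTC hS.symm (((hm z).2 (Or.inl rfl)).resolve_left hzA) hzA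
  by_cases hzB : z ∈ B
  swap
  · exact D.host_aux2 hTC hS hzA hzB
  have hA : ¬ vs Q ⊆ A := fun h => D.host_aux hTC hS (h hcm.2.2.1) (h hcm.2.2.2.1) hzA
  have hB : ¬ vs Q ⊆ B := fun h => D.host_aux hTC hS.symm (h hcm.2.2.1) (h hcm.2.2.2.1) hzB
  obtain ⟨a, ha, b, hb, h5, h6, h7, h8, h9⟩ := twoC_of_conn hQ hQ1 s(c, d) A B
    (fun u hu => by rw [Finset.mem_union]; exact (hm u).2 (Or.inr hu)) hA hB
    (by
      have h1 : A ∩ B ∩ vs Q ⊆ (A ∩ B).erase z := by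
        intro u hu
        rw [Finset.mem_inter] at hu
        refine Finset.mem_erase.2 ⟨?_, hu.1⟩
        rintro rfl
        exact D.hzQ hu.2
      have h2 := Finset.card_le_card h1
      rw [Finset.card_erase_of_mem (by simp [hzA, hzB])] at h2
      have := hS.cd
      omega)
  exact hS.no a b h5 h6 h7 h8 (by rw [mem_spl]; rw [Finset.mem_erase] at h9; tauto)

end Dat

theorem two_spl {H E : Finset (Sym2 ℕ)} {p q a b r a' b' r' : ℕ} (hH : Reach H) (hab : s(a, b) ∈ H) (hr : r ∈ vs H)
    (hra : r ≠ a) (hrb : r ≠ b) (hp : p ∉ vs H) (hq : q ∉ vs H) (hpq : p ≠ q)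
    (hab' : s(a', b') ∈ spl H p a b r) (hr' : r' ∈ vs H)
    (hra' : r' ≠ a') (hrb' : r' ≠ b') (hE : E = spl (spl H p a b r) q a' b' r') : Reach E := by
  rw [hE]
  have hv := vs_spl (v := p) hab hr
  exact reach_spl (reach_spl hH hab hr hra hrb hp) hab' (by rw [hv]; simp [hr']) hra' hrb'
    (by rw [hv]; simp [hq, hpq.symm])

open Finset

namespace Dat
variable {E P Pi Q : Finset (Sym2 ℕ)} {c d z t x y : ℕ}

theorem four_fin (D : Dat E P Pi Q c d z t) (hQ : Conn Q) (hQ1 : 1 < #Q) (hTC : TC E)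
    (IH : ∀ E2 : Finset (Sym2 ℕ), #E2 < #E → TC E2 → Conn E2 → Reach E2)
    {p q a b r a' b' r' : ℕ} (hab : s(a, b) ∈ spl Q z c d t) (hr : r ∈ vs Q)
    (hra : r ≠ a) (hrb : r ≠ b) (hp : p ∉ insert z (vs Q)) (hq : q ∉ insert z (vs Q)) (hpq : p ≠ q)
    (hab' : s(a', b') ∈ spl (spl Q z c d t) p a b r) (hr' : r' ∈ vs Q)
    (hra' : r' ≠ a') (hrb' : r' ≠ b') (hE : E.erase s(c, d) = spl (spl (spl Q z c d t) p a b r) q a' b' r') :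
    Reach E := by
  have hv := vs_spl (v := z) D.cQ D.ht
  have zn := D.zn
  have hC := conn_spl hQ D.cQ D.ht zn.2.2.1 zn.2.2.2.1 D.hzQ
  rw [← hv] at hp hq
  have hr2 : r ∈ vs (spl Q z c d t) := by rw [hv]; simp [hr]
  have hr2' : r' ∈ vs (spl Q z c d t) := by rw [hv]; simp [hr']
  have hv1 := vs_spl (v := p) hab hr2
  have hC2 := conn_spl hC hab hr2 hra hrb hp
  have hq' : q ∉ vs (spl (spl Q z c d t) p a b r) := by rw [hv1]; simp [hq, hpq.symm]
  have c1 := card_spl (z := r) hp (hC.1.ne hab)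
  have c2 := card_spl (z := r') hq' (hC2.1.ne hab')
  rw [← hE] at c2
  have c3 := Finset.card_le_card (Finset.erase_subset s(c, d) E)
  have hR := IH _ (by omega) (D.host_TC hQ hQ1 hTC) hC
  exact reach_of_erase (two_spl hR hab hr2 hra hrb hp hq hpq hab' hr2' hra' hrb' hE) D.cE.1 D.cE.2 D.ne

theorem swap (D : Dat E P (sbd P z x y) Q c d z t) (hxy : s(x, y) ∈ P) (hxyc : s(x, y) ≠ s(c, d))
    (hzP : z ∉ vs P) (hQ : Conn Q) (hQ1 : 1 < #Q) : Dat E P (sbd P z x y) Q d c z t := by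
  have e1 : s(d, c) = s(c, d) := Sym2.eq_swap
  have e2 : ({d, c} : Finset ℕ) = {c, d} := Finset.pair_comm _ _
  refine ⟨D.ne.symm, D.hP, D.hP1, ?_, ?_, ?_, ?_, ?_, D.hz, D.hzQ, D.ht, D.htP, ?_,
    Or.inr ⟨x, y, hxy, ?_, hzP, rfl, hQ, hQ1⟩⟩
  all_goals first | rw [e1] | rw [e2]
  exacts [D.cP, D.cPi, D.cQ, D.hv, D.hvi, D.eq, hxyc]

theorem memE (D : Dat E P Pi Q c d z t) (e : Sym2 ℕ) : e ∈ E.erase s(c, d) ↔ e ≠ s(c, d) ∧ (e = s(z, t) ∨ e ∈ Pi ∨ e ∈ Q) := by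
  rw [Finset.mem_erase]
  constructor
  · rintro ⟨h1, h2⟩; exact ⟨h1, (D.mE h1).1 h2⟩
  · rintro ⟨h1, h2⟩; exact ⟨h1, (D.mE h1).2 h2⟩

theorem four_mid (D : Dat E P (sbd P z x y) Q c d z t)
    (hzP : z ∉ vs P) (hQ : Conn Q) (hQ1 : 1 < #Q) (hTC : TC E)
    (IH : ∀ E2 : Finset (Sym2 ℕ), #E2 < #E → TC E2 → Conn E2 → Reach E2) (h4 : #(vs P) = 4)
    {p q : ℕ} (hv : vs P = {c, d, p, q}) (hcp : c ≠ p) (hcq : c ≠ q) (hdp : d ≠ p) (hdq : d ≠ q) (hpq : p ≠ q)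
    (hxy : s(x, y) = s(p, q)) : Reach E := by
  have hK := K4_mem D.hP D.hP1 h4 hv D.ne hcp hcq hdp hdq hpq
  have zn := D.zn
  have cdm := D.cdm
  have hcd := D.ne
  have hzp : z ≠ p := by rintro rfl; exact hzP (by rw [hv]; simp)
  have hzq : z ≠ q := by rintro rfl; exact hzP (by rw [hv]; simp)
  have hpP : p ∈ vs P := by rw [hv]; simp
  have hqP : q ∈ vs P := by rw [hv]; simp
  have hpQ : p ∉ vs Q := by intro h; rcases D.bothP hpP h with h' | h' <;> simp_all
  have hqQ : q ∉ vs Q := by intro h; rcases D.bothP hqP h with h' | h' <;> simp_all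
  rw [sbd_congr hxy] at D
  refine D.four_fin hQ hQ1 hTC IH (p := p) (q := q) (a := z) (b := c) (r := d) (a' := z) (b' := d) (r' := c)
    (by rw [mem_spl]; tauto) cdm.2.2.2.1 (by tauto) (by tauto) (by simp [hpQ, hzp.symm]) (by simp [hqQ, hzq.symm]) hpq
    ?_ cdm.2.2.1 (by tauto) (by tauto) ?_
  · rw [mem_spl, mem_spl]
    have : s(z, d) ≠ s(z, c) := by rw [Ne, Sym2.eq_iff]; tauto
    tauto
  · ext e
    rw [D.memE]
    simp only [mem_spl, mem_sbd, hK]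
    obtain ⟨z1, z2, z3, z4, z5⟩ := zn
    by_cases heQ : e ∈ Q
    · have n1 : ∀ u, e ≠ s(z, u) := by rintro u rfl; exact D.hzQ (mem_vs_left heQ)
      have n2 : ∀ u, e ≠ s(p, u) := by rintro u rfl; exact hpQ (mem_vs_left heQ)
      have n3 : ∀ u, e ≠ s(q, u) := by rintro u rfl; exact hqQ (mem_vs_left heQ)
      simp [heQ, n1, n2, n3]
    · simp only [heQ, or_false, and_false]
      have htp : t ≠ p := by rintro rfl; exact hpQ D.ht
      have htq : t ≠ q := by rintro rfl; exact hqQ D.ht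
      clear * - hcd hcp hcq hdp hdq hpq hzp hzq z1 z2 z3 z4 z5 htp htq
      induction e with
      | _ a b =>
        simp only [Sym2.eq_iff, ne_eq]
        grind (splits := 60)

theorem four_side (D : Dat E P (sbd P z x y) Q c d z t)
    (hzP : z ∉ vs P) (hQ : Conn Q) (hQ1 : 1 < #Q) (hTC : TC E)
    (IH : ∀ E2 : Finset (Sym2 ℕ), #E2 < #E → TC E2 → Conn E2 → Reach E2) (h4 : #(vs P) = 4)
    {p q : ℕ} (hv : vs P = {c, d, p, q}) (hcp : c ≠ p) (hcq : c ≠ q) (hdp : d ≠ p) (hdq : d ≠ q) (hpq : p ≠ q)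
    (hxy : s(x, y) = s(c, p)) : Reach E := by
  have hK := K4_mem D.hP D.hP1 h4 hv D.ne hcp hcq hdp hdq hpq
  have zn := D.zn
  have cdm := D.cdm
  have hcd := D.ne
  have hzp : z ≠ p := by rintro rfl; exact hzP (by rw [hv]; simp)
  have hzq : z ≠ q := by rintro rfl; exact hzP (by rw [hv]; simp)
  have hpP : p ∈ vs P := by rw [hv]; simp
  have hqP : q ∈ vs P := by rw [hv]; simp
  have hpQ : p ∉ vs Q := by intro h; rcases D.bothP hpP h with h' | h' <;> simp_all
  have hqQ : q ∉ vs Q := by intro h; rcases D.bothP hqP h with h' | h' <;> simp_all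
  rw [sbd_congr hxy] at D
  refine D.four_fin hQ hQ1 hTC IH (p := p) (q := q) (a := z) (b := d) (r := c) (a' := p) (b' := c) (r' := d)
    (by rw [mem_spl]; tauto) cdm.2.2.1 (by tauto) (by tauto) (by simp [hpQ, hzp.symm]) (by simp [hqQ, hzq.symm]) hpq
    (by rw [mem_spl]; tauto) cdm.2.2.2.1 (by tauto) (by tauto) ?_
  ext e
  rw [D.memE]
  simp only [mem_spl, mem_sbd, hK]
  obtain ⟨z1, z2, z3, z4, z5⟩ := zn
  by_cases heQ : e ∈ Q
  · have n1 : ∀ u, e ≠ s(z, u) := by rintro u rfl; exact D.hzQ (mem_vs_left heQ)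
    have n2 : ∀ u, e ≠ s(p, u) := by rintro u rfl; exact hpQ (mem_vs_left heQ)
    have n3 : ∀ u, e ≠ s(q, u) := by rintro u rfl; exact hqQ (mem_vs_left heQ)
    simp [heQ, n1, n2, n3]
  · simp only [heQ, or_false, and_false]
    have htp : t ≠ p := by rintro rfl; exact hpQ D.ht
    have htq : t ≠ q := by rintro rfl; exact hqQ D.ht
    clear * - hcd hcp hcq hdp hdq hpq hzp hzq z1 z2 z3 z4 z5 htp htq
    induction e with
    | _ a b =>
      simp only [Sym2.eq_iff, ne_eq]
      grind (splits := 60)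

theorem sub_four (D : Dat E P (sbd P z x y) Q c d z t) (hxy : s(x, y) ∈ P) (hxyc : s(x, y) ≠ s(c, d))
    (hzP : z ∉ vs P) (hQ : Conn Q) (hQ1 : 1 < #Q) (hTC : TC E)
    (IH : ∀ E2 : Finset (Sym2 ℕ), #E2 < #E → TC E2 → Conn E2 → Reach E2) (h4 : #(vs P) = 4) : Reach E := by
  obtain ⟨p, q, hpq, hcp, hcq, hdp, hdq, hv⟩ := four_split h4 D.cdm.2.2.2.2.1 D.cdm.2.2.2.2.2 D.ne
  have hK := (K4_mem D.hP D.hP1 h4 hv D.ne hcp hcq hdp hdq hpq _).1 hxy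
  have D' := D.swap hxy hxyc hzP hQ hQ1
  have hv2 : vs P = {c, d, q, p} := by rw [hv, Finset.pair_comm p q]
  have hv3 : vs P = {d, c, p, q} := by rw [hv, Finset.insert_comm]
  have hv4 : vs P = {d, c, q, p} := by rw [hv2, Finset.insert_comm]
  rcases hK with h | h | h | h | h | h
  · exact absurd h hxyc
  · exact D.four_side hzP hQ hQ1 hTC IH h4 hv hcp hcq hdp hdq hpq h
  · exact D.four_side hzP hQ hQ1 hTC IH h4 hv2 hcq hcp hdq hdp hpq.symm h
  · exact D'.four_side hzP hQ hQ1 hTC IH h4 hv3 hdp hdq hcp hcq hpq h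
  · exact D'.four_side hzP hQ hQ1 hTC IH h4 hv4 hdq hdp hcq hcp hpq.symm h
  · exact D.four_mid hzP hQ hQ1 hTC IH h4 hv hcp hcq hdp hdq hpq h

theorem sub (D : Dat E P (sbd P z x y) Q c d z t) (hxy : s(x, y) ∈ P) (hxyc : s(x, y) ≠ s(c, d))
    (hzP : z ∉ vs P) (hQ : Conn Q) (hQ1 : 1 < #Q) (hTP : TC P) (hTC : TC E) (hN : Nd E)
    (IH : ∀ E2 : Finset (Sym2 ℕ), #E2 < #E → TC E2 → Conn E2 → Reach E2)
    (IHm : ∀ A' m', m' < #(vs (sbd P z x y)) → Cfg E A' m' → Reach E) : Reach E := by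
  have h4 := hTP.1
  by_cases h5 : #(vs P) = 4
  · exact D.sub_four hxy hxyc hzP hQ hQ1 hTC IH h5
  rcases R_edge D.hP hTP (by omega) D.cP hxy hxyc.symm with ⟨e, he, h1, h2, h3⟩ | ⟨w, p, q, h1, h2, h3, h4, h5⟩ | ⟨w, u, p, h1, h2, h3, h4⟩
  · induction e with
    | _ p q => exact D.sub_edge hxy hxyc hzP hQ hQ1 hTC hN IH IHm he h1 h2 h3
  · exact D.sub_node hxy hxyc hzP hQ hQ1 hTC hN IH IHm h1 h2 h3 h4 h5
  · exact D.sub_moved hxy hzP hQ hQ1 hTC hN IH IHm h1 h2 h3 h4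

end Dat

theorem claim {E : Finset (Sym2 ℕ)} (hTC : TC E) (hN : Nd E)
    (IH : ∀ E2 : Finset (Sym2 ℕ), #E2 < #E → TC E2 → Conn E2 → Reach E2) (m : ℕ) :
    ∀ A, Cfg E A m → Reach E := by
  induction m using Nat.strong_induction_on with
  | _ m ih =>
    intro A h
    rcases dat hTC h with ⟨A', m', hm, h'⟩ | ⟨P, Pi, Q, c, d, z, t, D, hTP, hm⟩
    · exact ih m' hm A' h'
    · have IHm : ∀ A' m', m' < #(vs Pi) → Cfg E A' m' → Reach E := by
        intro A' m' h1 h2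
        exact ih m' (by omega) A' h2
      rcases D.kind with ⟨h1, h2⟩ | ⟨x, y, hxy, hxyc, hzP, h1, hQ, hQ1⟩
      · subst h1
        exact D.plain h2 hTP hTC hN IH IHm
      · subst h1
        exact D.sub hxy hxyc hzP hQ hQ1 hTP hTC hN IH IHm

open Finset

theorem reach_K4 {E : Finset (Sym2 ℕ)} (hC : Conn E) (h1 : 1 < #E) (h4 : #(vs E) = 4) : Reach E := by
  obtain ⟨e, he⟩ := Finset.card_pos.1 (show 0 < #E by omega)
  induction e with
  | _ c d =>
    have hcd := hC.1.ne he
    obtain ⟨p, q, hpq, hcp, hcq, hdp, hdq, hv⟩ := four_split h4 (mem_vs_left he) (mem_vs_right he) hcd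
    have hK := K4_mem hC h1 h4 hv hcd hcp hcq hdp hdq hpq
    let G : FinGraph := ⟨vs E, E, hC.1, fun e he v hv => mem_vs.2 ⟨e, he, hv⟩⟩
    refine ⟨G, G, ⟨c, d, p, q, hcd, hcp, hcq, hdp, hdq, hpq, hv, ?_⟩, Relation.ReflTransGen.refl, rfl, rfl⟩
    ext e
    show e ∈ E ↔ _
    rw [hK]
    simp

theorem main_thm (n : ℕ) : ∀ E : Finset (Sym2 ℕ), #E = n → TC E → Conn E → Reach E := by
  induction n using Nat.strong_induction_on with
  | _ n ih =>
    intro E hn hTC hC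
    have IH : ∀ E2 : Finset (Sym2 ℕ), #E2 < #E → TC E2 → Conn E2 → Reach E2 :=
      fun E2 h h1 h2 => ih _ (by omega) E2 rfl h1 h2
    have hN := hC.1
    have hdeg : ∀ u ∈ vs E, 3 ≤ #(nb E u) := fun u hu => hTC.deg hN hu
    have h3 := hTC.1
    obtain ⟨c, hc⟩ := Finset.card_pos.1 (show 0 < #(vs E) by omega)
    obtain ⟨d, hcd⟩ := vs_edge hc
    have h1 : 1 < #E := by
      by_contra hcon
      have hle : #E ≤ 1 := by omega
      have : vs E ⊆ {c, d} := by
        intro u hu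
        obtain ⟨e, he, hue⟩ := mem_vs.1 hu
        rw [Finset.card_le_one.1 hle e he _ hcd] at hue
        simpa using hue
      have := Finset.card_le_card this
      have := Finset.card_le_two (a := c) (b := d)
      omega
    by_cases h4 : #(vs E) = 4
    · exact reach_K4 hC h1 h4
    have hcl := claim hTC hN IH
    obtain ⟨z, hz⟩ := Finset.card_pos.1 (show 0 < #(vs E \ {c, d}) by
      have := Finset.le_card_sdiff ({c, d} : Finset ℕ) (vs E)
      have := Finset.card_le_two (a := c) (b := d)
      omega)
    simp only [Finset.mem_sdiff, Finset.mem_insert, Finset.mem_singleton, not_or] at hz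
    rcases R_vertex hC hTC (by omega) hcd hz.1 hz.2.1 hz.2.2 with ⟨e, he, -, hE⟩ | ⟨w, p, q, -, -, -, hR⟩
    · induction e with
      | _ p q =>
        have hv := vs_erase hdeg p q
        have hp : p ∈ vs (E.erase s(p, q)) := by rw [hv]; exact mem_vs_left he
        have hq : q ∈ vs (E.erase s(p, q)) := by rw [hv]; exact mem_vs_right he
        by_cases hT : TC (E.erase s(p, q))
        · exact reach_of_erase (IH _ (Finset.card_erase_lt_of_mem he) hT hE) hp hq (hN.ne he)
        · obtain ⟨A, B, hS⟩ := sep_of_not_TC (by rw [hv]; omega) hT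
          exact hcl _ A (Cfg.add _ B p q hE hS hp hq (hN.ne he) (Finset.insert_erase he).symm rfl)
    · obtain ⟨r, hrp, hrq, hnb⟩ := nb_three hR.deg hR.hx hR.hy hR.ne
      have hpw := mem_nb.1 hR.hx
      have hqw := mem_nb.1 hR.hy
      have hrw : s(w, r) ∈ E := mem_nb.1 (by rw [hnb]; simp)
      have hwp := hN.ne hpw
      have hwq := hN.ne hqw
      have hwr := hN.ne hrw
      have hv := vs_Red hdeg hwp hwq (mem_vs_right hpw) (mem_vs_right hqw)
      have hsp := spl_Red hnb hR.hxy
      have hrR : r ∈ vs (Red E w p q) := by rw [hv]; simp [hwr.symm, mem_vs_right hrw]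
      have hpqR : s(p, q) ∈ Red E w p q := mem_Red.2 (Or.inl rfl)
      have hwR := not_mem_vs_Red (E := E) hwp hwq
      have hwE : w ∈ vs E := mem_vs_left hpw
      by_cases hT : TC (Red E w p q)
      · rw [← hsp]
        exact reach_spl (IH _ (card_Red hR.hx hR.hy hR.ne) hT hR.conn) hpqR hrR hrp hrq hwR
      · obtain ⟨A, B, hS⟩ := sep_of_not_TC (by rw [hv, Finset.card_erase_of_mem hwE]; omega) hT
        by_cases hA : s(p, q) ∈ A.sym2
        · exact hcl _ A (Cfg.splIn _ B w p q r hR.conn hS hpqR hrR hrp hrq hwR hsp.symm hA rfl)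
        · exact hcl _ A (Cfg.splOut _ B w p q r hR.conn hS hpqR hrR hrp hrq hwR hsp.symm hA rfl)

theorem circ_of_pair {V' : Finset ℕ} {E' : Finset (Sym2 ℕ)} (hN : Nd E') (h : PairCircuit23 V' E') {e : Sym2 ℕ}
    (he : e ∈ E') : Circ E' := by
  obtain ⟨hV, hc, hs⟩ := h
  have hsub : vs E' ⊆ V' := by
    intro v hv
    obtain ⟨f, hf, hvf⟩ := mem_vs.1 hv
    exact hV f hf v hvf
  refine ⟨hN, ?_, ?_⟩
  · intro hS
    have h2 : 2 ≤ #V' := by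
      induction e with
      | _ a b =>
        have h3 : ({a, b} : Finset ℕ) ⊆ V' := by
          intro u hu
          exact hV _ he u (by simpa using hu)
        have := Finset.card_le_card h3
        rwa [Finset.card_pair (hN.ne he)] at this
    have := sparse_card hS hsub h2
    omega
  · intro f hf
    refine ⟨hN.mono (Finset.erase_subset _ _), ?_⟩
    intro Z hZ
    unfold ii
    by_cases hne : (E'.erase f ∩ Z.sym2).Nonempty
    · have h5 := hs (V' ∩ Z) (E'.erase f ∩ Z.sym2) Finset.inter_subset_left
        (Finset.inter_subset_left.trans (Finset.erase_subset _ _))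
        (by
          intro g hg v hv
          rw [Finset.mem_inter, Finset.mem_erase, Finset.mem_sym2_iff] at hg
          exact Finset.mem_inter.2 ⟨hV g hg.1.2 v hv, hg.2 v hv⟩)
        (Or.inr (by
          intro heq
          rw [← heq] at hf
          simp at hf)) hne
      have h6 := Finset.card_le_card (Finset.inter_subset_right : V' ∩ Z ⊆ Z)
      omega
    · rw [Finset.not_nonempty_iff_eq_empty.1 hne]
      simp
      omega

theorem conn_of_MConnected {G : FinGraph} (h : MConnected G) : Conn G.edges := by
  refine ⟨G.not_isDiag, fun e he f hf _ => ?_⟩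
  obtain ⟨V', E', -, hE, heE, hfE, hC⟩ := h e he f hf
  exact ⟨E', hE, circ_of_pair (fun g hg => G.not_isDiag g (hE hg)) hC heE, heE, hfE⟩

theorem verts_eq {G : FinGraph} (h : ThreeConnected G) : vs G.edges = G.verts := by
  apply Finset.Subset.antisymm
  · intro v hv
    obtain ⟨e, he, hve⟩ := mem_vs.1 hv
    exact G.mem_verts e he v hve
  · intro v hv
    have h3 := h.1
    obtain ⟨u, hu⟩ := Finset.card_pos.1 (show 0 < #(G.verts.erase v) by
      rw [Finset.card_erase_of_mem hv]; omega)
    rw [Finset.mem_erase] at hu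
    have hR := h.2 ∅ (by simp) v hv (by simp) u hu.2 (by simp)
    rcases Relation.ReflTransGen.cases_head hR with h' | ⟨w, h', -⟩
    · exact absurd h'.symm hu.1
    · exact mem_vs_left h'.1

theorem TC_of_three {G : FinGraph} (h : ThreeConnected G) : TC G.edges := by
  have hv := verts_eq h
  refine ⟨by rw [hv]; exact h.1, ?_⟩
  intro A B hun hcd hA hB
  rw [hv] at hun
  obtain ⟨a, ha, haB⟩ := Finset.not_subset.1 hA
  obtain ⟨b, hb, hbA⟩ := Finset.not_subset.1 hB
  by_contra hcon
  push Not at hcon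
  have hR := h.2 (A ∩ B) (by omega) a (by rw [← hun]; simp [ha]) (by simp [haB]) b (by rw [← hun]; simp [hb])
    (by simp [hbA])
  have key : ∀ y, Relation.ReflTransGen (fun x y => G.Adj x y ∧ x ∉ A ∩ B ∧ y ∉ A ∩ B) a y → y ∈ A ∧ y ∉ B := by
    intro y hy
    induction hy with
    | refl => exact ⟨ha, haB⟩
    | tail _ hst ih =>
      rename_i u w _
      have hw : w ∈ A ∪ B := by
        rw [hun, ← hv]; exact mem_vs_right hst.1
      have hw2 := hst.2.2
      rw [Finset.mem_union] at hw
      rw [Finset.mem_inter] at hw2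
      have h5 := hcon u ih.1 w
      have h6 : s(u, w) ∈ G.edges := hst.1
      clear * - hw hw2 h5 h6 ih
      tauto
  exact hbA (key b hR).1

/-- **Jackson–Jordán.** Every simple graph that is 3-vertex-connected and M-connected can be
obtained from `K₄` by a finite sequence of edge splitting operations and edge additions. -/
theorem statement_8 (G : FinGraph) (h3 : ThreeConnected G) (hM : MConnected G) :
    ∃ G₀ : FinGraph, IsK4 G₀ ∧
      Relation.ReflTransGen (fun H H' => EdgeSplit H H' ∨ EdgeAdd H H') G₀ G := by

  obtain ⟨G₀, G', hK, hR, hE, hV⟩ := main_thm _ _ rfl (TC_of_three h3) (conn_of_MConnected hM)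
  rw [verts_eq h3] at hV
  have : G' = G := by
    cases G
    cases G'
    simp only at hE hV
    subst hE hV
    rfl
  subst this
  exact ⟨G₀, hK, hR⟩
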